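/- arXiv:1912.03674 — 6 statements merged into one kernel-verified Lean document; each statement's English description precedes it below -/
import Mathlib

section
/- For every integer n ≥ 1 and every pattern pair p ∈ {(012,102), (012,120), (011,102)}, the number of inversion sequences of length n avoiding both patterns of p equals the Fibonacci number F_{2n−1}, i.e. |I_n(p)| = F_{2n−1}. -/
/-- An inversion sequence of length `n` (0-indexed): `e i ≤ i` for all `i`. -/
def InvSeq {n : ℕ} (e : Fin n → ℕ) : Prop := ∀ i : Fin n, e i ≤ (i : ℕ)

/-- `e` contains the pattern `p` (a word of nonnegative integers): there is a
strictly increasing choice of positions on which `e` is order-isomorphic to `p`. -/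
def Contains {n : ℕ} (e : Fin n → ℕ) (p : List ℕ) : Prop :=
  ∃ s : Fin p.length → Fin n, StrictMono s ∧
    ∀ a b : Fin p.length,
      (p.get a < p.get b ↔ e (s a) < e (s b)) ∧
      (p.get a = p.get b ↔ e (s a) = e (s b))

/-- `e` avoids the pattern `p`. -/
def Avoids {n : ℕ} (e : Fin n → ℕ) (p : List ℕ) : Prop := ¬ Contains e p

/-- The number of zero entries of `e`. -/
def zeroStat {n : ℕ} (e : Fin n → ℕ) : ℕ :=
  (Finset.univ.filter (fun i : Fin n => e i = 0)).card

/-- The number of distinct positive values among the entries of `e`. -/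
def distStat {n : ℕ} (e : Fin n → ℕ) : ℕ :=
  ((Finset.univ.image e).filter (fun v => 0 < v)).card

/-- The number of repeated entries of `e`: `n - dist e`. -/
def repStat {n : ℕ} (e : Fin n → ℕ) : ℕ := n - distStat e

/-- The number of saturated entries of `e` (1-indexed: `e_i = i - 1`). -/
def satuStat {n : ℕ} (e : Fin n → ℕ) : ℕ :=
  (Finset.univ.filter (fun i : Fin n => e i = (i : ℕ))).card

namespace Fib9

/-- Auxiliary count: words of length `L` over `{0..v}` with weakly decreasing positive part. -/
def G : ℕ → ℕ → ℕ
  | 0, _ => 1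
  | L + 1, v => G L v + ∑ u ∈ Finset.range v, G L (u + 1)

def T : ℕ → ℕ → ℕ
  | 0, _ => 1
  | L + 1, k => T L (k + 1) + ∑ u ∈ Finset.range k, G L (u + 1)

def D : ℕ → ℕ → ℕ
  | 0, _ => 1
  | L + 1, k => G (L + 1) k + D L (k + 1)

lemma G_zero (L : ℕ) : G L 0 = 1 := by
  induction L with
  | zero => rfl
  | succ L ih => simp [G, ih]

lemma G_rec (L v : ℕ) : G (L + 1) (v + 1) + G L v = G (L + 1) v + 2 * G L (v + 1) := by
  simp only [G, Finset.sum_range_succ]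
  ring

lemma G_one (k : ℕ) : G 1 k = k + 1 := by
  simp [G]; ring

lemma D_rec (L k : ℕ) : D (L + 1) (k + 1) + D L k = D (L + 1) k + 2 * D L (k + 1) := by
  induction L generalizing k with
  | zero => simp [D, G_one]
  | succ L ih =>
    have h1 := ih (k + 1)
    have h2 := G_rec (L + 1) k
    have e1 : D (L + 1 + 1) (k + 1) = G (L + 1 + 1) (k + 1) + D (L + 1) (k + 1 + 1) := rfl
    have e2 : D (L + 1 + 1) k = G (L + 1 + 1) k + D (L + 1) (k + 1) := rfl
    have e3 : D (L + 1) (k + 1) = G (L + 1) (k + 1) + D L (k + 1 + 1) := rfl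
    have e4 : D (L + 1) k = G (L + 1) k + D L (k + 1) := rfl
    omega

lemma D_fib (n : ℕ) : D n 0 = Nat.fib (2 * n) + 1 ∧
    D (n + 1) 0 = Nat.fib (2 * n + 2) + 1 := by
  induction n with
  | zero => simp [D, G_one]
  | succ n ih =>
    obtain ⟨h1, h2⟩ := ih
    refine ⟨h2, ?_⟩
    have h3 := D_rec n 0
    have e1 : D (n + 1 + 1) 0 = G (n + 1 + 1) 0 + D (n + 1) (0 + 1) := rfl
    have e2 : D (n + 1) 0 = G (n + 1) 0 + D n (0 + 1) := rfl
    rw [G_zero] at e1 e2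
    have f1 : Nat.fib (2 * n + 2) = Nat.fib (2 * n) + Nat.fib (2 * n + 1) := Nat.fib_add_two
    have f2 : Nat.fib (2 * n + 1 + 2) = Nat.fib (2 * n + 1) + Nat.fib (2 * n + 1 + 1) :=
      Nat.fib_add_two
    have f3 : Nat.fib (2 * n + 2 + 2) = Nat.fib (2 * n + 2) + Nat.fib (2 * n + 2 + 1) :=
      Nat.fib_add_two
    have f4 : 2 * (n + 1) + 2 = 2 * n + 2 + 2 := by ring
    rw [f4]
    simp only [Nat.add_assoc, Nat.reduceAdd, Nat.zero_add] at *
    omega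

lemma T_D (L k : ℕ) : T (L + 1) k + D L k = D (L + 1) k := by
  induction L generalizing k with
  | zero => simp [T, D, G]
  | succ L ih =>
    have h := ih (k + 1)
    have e0 : T (L + 1 + 1) k = T (L + 1) (k + 1) + ∑ u ∈ Finset.range k, G (L + 1) (u + 1) := rfl
    have e1 : D (L + 1 + 1) k = G (L + 1 + 1) k + D (L + 1) (k + 1) := rfl
    have e2 : D (L + 1) k = G (L + 1) k + D L (k + 1) := rfl
    have e3 : G (L + 1 + 1) k = G (L + 1) k + ∑ u ∈ Finset.range k, G (L + 1) (u + 1) := rfl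
    omega

lemma T_fib (n : ℕ) (hn : 1 ≤ n) : T n 0 = Nat.fib (2 * n - 1) := by
  obtain ⟨m, rfl⟩ : ∃ m, n = m + 1 := ⟨n - 1, by omega⟩
  have h := T_D m 0
  obtain ⟨h1, h2⟩ := D_fib m
  have f1 : Nat.fib (2 * m + 2) = Nat.fib (2 * m) + Nat.fib (2 * m + 1) := Nat.fib_add_two
  have : 2 * (m + 1) - 1 = 2 * m + 1 := by omega
  rw [this]
  omega

/-! Pattern translations -/

lemma contains3 {n : ℕ} (e : Fin n → ℕ) (x y z : ℕ) :
    Contains e [x, y, z] ↔ ∃ i j k : Fin n, i < j ∧ j < k ∧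
      ((x < y ↔ e i < e j) ∧ (y < x ↔ e j < e i) ∧ (x < z ↔ e i < e k) ∧ (z < x ↔ e k < e i) ∧
       (y < z ↔ e j < e k) ∧ (z < y ↔ e k < e j)) := by
  constructor
  · rintro ⟨s, hs, h⟩
    refine ⟨s (0 : Fin 3), s (1 : Fin 3), s (2 : Fin 3), hs (show (0 : Fin 3) < 1 by decide),
      hs (show (1 : Fin 3) < 2 by decide), ?_⟩
    exact ⟨(h (0 : Fin 3) (1 : Fin 3)).1, (h (1 : Fin 3) (0 : Fin 3)).1,
      (h (0 : Fin 3) (2 : Fin 3)).1, (h (2 : Fin 3) (0 : Fin 3)).1,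
      (h (1 : Fin 3) (2 : Fin 3)).1, (h (2 : Fin 3) (1 : Fin 3)).1⟩
  · rintro ⟨i, j, k, hij, hjk, h⟩
    refine ⟨(![i, j, k] : Fin 3 → Fin n), ?_, ?_⟩
    · have : StrictMono (![i, j, k] : Fin 3 → Fin n) := by
        intro a b hab
        fin_cases a <;> fin_cases b <;> simp at hab ⊢ <;> first | assumption | exact hij.trans hjk
      exact this
    · have : ∀ a b : Fin 3, (([x, y, z] : List ℕ).get a < ([x, y, z] : List ℕ).get b ↔
          e ((![i, j, k] : Fin 3 → Fin n) a) < e ((![i, j, k] : Fin 3 → Fin n) b)) ∧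
          (([x, y, z] : List ℕ).get a = ([x, y, z] : List ℕ).get b ↔
          e ((![i, j, k] : Fin 3 → Fin n) a) = e ((![i, j, k] : Fin 3 → Fin n) b)) := by
        intro a b
        fin_cases a <;> fin_cases b <;> simp <;> omega
      exact this

lemma avoids012 {n : ℕ} (e : Fin n → ℕ) : Avoids e [0, 1, 2] ↔
    ∀ i j k : Fin n, i < j → j < k → ¬ (e i < e j ∧ e j < e k) := by
  unfold Avoids
  rw [contains3]
  push Not
  refine forall_congr' fun i => forall_congr' fun j => forall_congr' fun k =>
    forall_congr' fun _ => forall_congr' fun _ => ?_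
  omega

lemma avoids102 {n : ℕ} (e : Fin n → ℕ) : Avoids e [1, 0, 2] ↔
    ∀ i j k : Fin n, i < j → j < k → ¬ (e j < e i ∧ e i < e k) := by
  unfold Avoids
  rw [contains3]
  push Not
  refine forall_congr' fun i => forall_congr' fun j => forall_congr' fun k =>
    forall_congr' fun _ => forall_congr' fun _ => ?_
  omega

lemma avoids120 {n : ℕ} (e : Fin n → ℕ) : Avoids e [1, 2, 0] ↔
    ∀ i j k : Fin n, i < j → j < k → ¬ (e k < e i ∧ e i < e j) := by
  unfold Avoids
  rw [contains3]
  push Not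
  refine forall_congr' fun i => forall_congr' fun j => forall_congr' fun k =>
    forall_congr' fun _ => forall_congr' fun _ => ?_
  omega

lemma avoids011 {n : ℕ} (e : Fin n → ℕ) : Avoids e [0, 1, 1] ↔
    ∀ i j k : Fin n, i < j → j < k → ¬ (e i < e j ∧ e j = e k) := by
  unfold Avoids
  rw [contains3]
  push Not
  refine forall_congr' fun i => forall_congr' fun j => forall_congr' fun k =>
    forall_congr' fun _ => forall_congr' fun _ => ?_
  omega

/-! Case A -/

/-- weakly decreasing positive part -/
def WD {n : ℕ} (e : Fin n → ℕ) : Prop := ∀ i j : Fin n, i < j → e i ≠ 0 → e j ≤ e i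

lemma wd_iff {n : ℕ} (e : Fin n → ℕ) (he : InvSeq e) : Avoids e [0, 1, 2] ↔ WD e := by
  rw [avoids012]
  constructor
  · intro h i j hij hi
    have h0 : e ⟨0, i.pos⟩ = 0 := Nat.le_zero.1 (he ⟨0, i.pos⟩)
    have hlt : (⟨0, i.pos⟩ : Fin n) < i := by
      rw [Fin.lt_def]
      have := he i
      simp; omega
    have := h _ i j hlt hij
    omega
  · intro h i j k hij hjk ⟨h1, h2⟩
    have := h j k hjk (by omega)
    omega

lemma card_cons {n : ℕ} (P : (Fin (n + 1) → ℕ) → Prop) (v B : ℕ)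
    (hv : ∀ f, P f → f 0 ≤ v) (hB : ∀ f, P f → ∀ i, f i ≤ B) :
    Nat.card {f // P f} = ∑ x ∈ Finset.range (v + 1), Nat.card {g // P (Fin.cons x g)} := by
  have hfin : ∀ x : ℕ, Finite {g : Fin n → ℕ // P (Fin.cons x g)} := by
    intro x
    apply Set.Finite.to_subtype (s := {g : Fin n → ℕ | P (Fin.cons x g)})
    apply (Set.finite_Iic (fun _ : Fin n => B)).subset
    intro g hg i
    simpa using hB _ hg i.succ
  let eqv : {f // P f} ≃ Σ x : Fin (v + 1), {g : Fin n → ℕ // P (Fin.cons (x : ℕ) g)} :=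
    { toFun := fun f => ⟨⟨f.1 0, Nat.lt_succ_of_le (hv _ f.2)⟩, ⟨Fin.tail f.1, by
        have : (Fin.cons (f.1 0) (Fin.tail f.1) : Fin (n + 1) → ℕ) = f.1 := Fin.cons_self_tail _
        simpa [this] using f.2⟩⟩
      invFun := fun p => ⟨Fin.cons (p.1 : ℕ) p.2.1, p.2.2⟩
      left_inv := by
        intro f
        apply Subtype.ext
        exact Fin.cons_self_tail _
      right_inv := by
        rintro ⟨x, g, hg⟩
        rfl }
  rw [Nat.card_congr eqv, Nat.card_sigma, Finset.sum_range]

lemma wd_cons {n : ℕ} (x : ℕ) (g : Fin n → ℕ) :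
    WD (Fin.cons x g : Fin (n + 1) → ℕ) ↔ (x ≠ 0 → ∀ i, g i ≤ x) ∧ WD g := by
  unfold WD
  simp only [Fin.forall_fin_succ, Fin.cons_zero, Fin.cons_succ, Fin.succ_lt_succ_iff,
    Fin.succ_pos, Fin.not_lt_zero, lt_self_iff_false, forall_const, IsEmpty.forall_iff, true_and]
  constructor
  · rintro ⟨h1, h2⟩
    exact ⟨fun hx i => h1 i hx, h2⟩
  · rintro ⟨h1, h2⟩
    exact ⟨fun i hx => h1 hx i, h2⟩

lemma card_S (L v : ℕ) : Nat.card {f : Fin L → ℕ // (∀ i, f i ≤ v) ∧ WD f} = G L v := by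
  induction L generalizing v with
  | zero =>
    have : Unique {f : Fin 0 → ℕ // (∀ i, f i ≤ v) ∧ WD f} :=
      { default := ⟨Fin.elim0, fun i => i.elim0, fun i => i.elim0⟩
        uniq := fun a => Subtype.ext (Subsingleton.elim _ _) }
    rw [Nat.card_unique]; rfl
  | succ L ih =>
    rw [card_cons _ v v (fun f hf => hf.1 0) (fun f hf => hf.1), Finset.sum_range_succ']
    rw [add_comm]
    simp only [G]
    congr 1
    · rw [← ih v]
      apply Nat.card_congr (Equiv.subtypeEquivRight _)
      intro g
      rw [wd_cons]
      simp [Fin.forall_fin_succ]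
    · apply Finset.sum_congr rfl
      intro u hu
      rw [← ih (u + 1)]
      apply Nat.card_congr (Equiv.subtypeEquivRight _)
      intro g
      rw [wd_cons]
      simp only [Finset.mem_range] at hu
      simp only [Fin.forall_fin_succ, Fin.cons_zero, Fin.cons_succ]
      constructor
      · rintro ⟨_, h1, h2⟩
        exact ⟨h1 (by omega), h2⟩
      · rintro ⟨h1, h2⟩
        exact ⟨⟨by omega, fun i => (h1 i).trans (by omega)⟩, fun _ => h1, h2⟩

lemma card_T (L k : ℕ) :
    Nat.card {f : Fin L → ℕ // (∀ i, f i ≤ k + (i : ℕ)) ∧ WD f} = T L k := by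
  induction L generalizing k with
  | zero =>
    have : Unique {f : Fin 0 → ℕ // (∀ i, f i ≤ k + (i : ℕ)) ∧ WD f} :=
      { default := ⟨Fin.elim0, fun i => i.elim0, fun i => i.elim0⟩
        uniq := fun a => Subtype.ext (Subsingleton.elim _ _) }
    rw [Nat.card_unique]; rfl
  | succ L ih =>
    rw [card_cons _ k (k + L) (fun f hf => by simpa using hf.1 0)
      (fun f hf i => (hf.1 i).trans (by have := i.2; omega)), Finset.sum_range_succ']
    rw [add_comm]
    simp only [T]
    congr 1
    · rw [← ih (k + 1)]
      apply Nat.card_congr (Equiv.subtypeEquivRight _)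
      intro g
      rw [wd_cons]
      simp [Fin.forall_fin_succ, add_assoc, add_comm 1]
    · apply Finset.sum_congr rfl
      intro u hu
      rw [← card_S L (u + 1)]
      apply Nat.card_congr (Equiv.subtypeEquivRight _)
      intro g
      rw [wd_cons]
      simp only [Finset.mem_range] at hu
      simp only [Fin.forall_fin_succ, Fin.cons_zero, Fin.cons_succ]
      constructor
      · rintro ⟨_, h1, h2⟩
        exact ⟨h1 (by omega), h2⟩
      · rintro ⟨h1, h2⟩
        exact ⟨⟨by simp; omega, fun i => (h1 i).trans (by omega)⟩, fun _ => h1, h2⟩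

lemma card_A (n : ℕ) : Nat.card {e : Fin n → ℕ // InvSeq e ∧ WD e} = T n 0 := by
  rw [← card_T n 0]
  apply Nat.card_congr (Equiv.subtypeEquivRight _)
  intro e
  simp [InvSeq]

/-! Case C -/

structure CC {n : ℕ} (e : Fin n → ℕ) : Prop where
  inv : InvSeq e
  dist : ∀ i j : Fin n, i < j → e i ≠ 0 → e i ≠ e j
  av : ∀ i j k : Fin n, i < j → j < k → ¬ (e j < e i ∧ e i < e k)

lemma cc_iff {n : ℕ} (e : Fin n → ℕ) :
    (InvSeq e ∧ Avoids e [0, 1, 1] ∧ Avoids e [1, 0, 2]) ↔ CC e := by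
  rw [avoids011, avoids102]
  constructor
  · rintro ⟨he, h, h'⟩
    refine ⟨he, fun i j hij hi hc => ?_, h'⟩
    have h0 : e ⟨0, i.pos⟩ = 0 := Nat.le_zero.1 (he ⟨0, i.pos⟩)
    have hlt : (⟨0, i.pos⟩ : Fin n) < i := by
      rw [Fin.lt_def]
      have := he i
      simp; omega
    have := h _ i j hlt hij
    omega
  · rintro ⟨he, h, h'⟩
    refine ⟨he, fun i j k hij hjk => ?_, h'⟩
    rintro ⟨h1, h2⟩
    exact h j k hjk (by omega) h2

/-- front insertion -/
def lift {m : ℕ} (e : Fin m → ℕ) (o : Option (Fin m)) : Fin (m + 1) → ℕ :=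
  Fin.cons 0 (fun i => if o = some i then 1 else if e i = 0 then 0 else e i + 1)

def Valid {m : ℕ} (e : Fin m → ℕ) (o : Option (Fin m)) : Prop :=
  ∀ j, o = some j → e j = 0 ∧ ∀ i k, j < i → i < k → e i = 0 → e k = 0

open Classical in
noncomputable def CS (m : ℕ) : Finset (Fin m → ℕ) :=
  (Finset.Iic (fun i : Fin m => (i : ℕ))).filter CC

lemma mem_CS {m : ℕ} (e : Fin m → ℕ) : e ∈ CS m ↔ CC e := by
  simp only [CS, Finset.mem_filter, Finset.mem_Iic]
  exact ⟨fun h => h.2, fun h => ⟨h.inv, h⟩⟩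

lemma cc_lift {m : ℕ} (e : Fin m → ℕ) (o : Option (Fin m)) (he : CC e) (ho : Valid e o) :
    CC (lift e o) := by
  refine ⟨?_, ?_, ?_⟩
  · unfold InvSeq lift
    rw [Fin.forall_fin_succ]
    refine ⟨by simp, fun i => ?_⟩
    have := he.inv i
    simp only [Fin.cons_succ, Fin.val_succ]
    split_ifs <;> omega
  · unfold lift
    simp only [Fin.forall_fin_succ, Fin.cons_zero, Fin.cons_succ, Fin.succ_lt_succ_iff,
      Fin.not_lt_zero]
    refine ⟨by simp, fun i => ⟨by simp, fun j hij => ?_⟩⟩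
    have := he.dist i j hij
    by_cases h1 : o = some i
    · have h2 : o ≠ some j := by
        rw [h1]; simp; exact hij.ne
      simp only [h1, h2, if_true, if_false]
      rw [← h1]
      simp only [h2, if_false]
      split_ifs <;> omega
    · simp only [h1, if_false]
      split_ifs <;> omega
  · unfold lift
    simp only [Fin.forall_fin_succ, Fin.cons_zero, Fin.cons_succ, Fin.succ_lt_succ_iff,
      Fin.not_lt_zero]
    refine ⟨by simp, fun i => ⟨by simp, fun j => ⟨by simp, fun k hij hjk => ?_⟩⟩⟩
    have := he.av i j k hij hjk
    by_cases h1 : o = some i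
    · have h2 := ho i h1
      have h3 := h2.2 j k hij hjk
      split_ifs <;> omega
    · by_cases h2 : o = some j
      · have h3 := ho j h2
        rw [if_neg h1, if_pos h2]
        split_ifs <;> omega
      · rw [if_neg h1, if_neg h2]
        split_ifs <;> omega

/-- Inverse pieces. -/
def low {m : ℕ} (e : Fin (m + 1) → ℕ) : Fin m → ℕ := fun i => e i.succ - 1

open Classical in
noncomputable def opt {m : ℕ} (e : Fin (m + 1) → ℕ) : Option (Fin m) :=
  if h : ∃ i : Fin m, e i.succ = 1 then some h.choose else none

lemma opt_eq {m : ℕ} (e : Fin (m + 1) → ℕ) (he : CC e) (i : Fin m) :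
    opt e = some i ↔ e i.succ = 1 := by
  unfold opt
  split_ifs with h
  · have hs := h.choose_spec
    constructor
    · intro hi
      rw [← Option.some.inj hi]; exact hs
    · intro hi
      congr 1
      by_contra hne
      rcases lt_or_gt_of_ne hne with hlt | hlt
      · exact he.dist _ _ (Fin.succ_lt_succ_iff.2 hlt) (by omega) (by omega)
      · exact he.dist _ _ (Fin.succ_lt_succ_iff.2 hlt) (by omega) (by omega)
  · simp
    intro hi
    exact h ⟨i, hi⟩

lemma lift_low {m : ℕ} (e : Fin (m + 1) → ℕ) (he : CC e) : lift (low e) (opt e) = e := by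
  funext i
  refine Fin.cases ?_ (fun i => ?_) i
  · have := he.inv 0
    simp [lift] at this ⊢
    exact this.symm
  · simp only [lift, Fin.cons_succ]
    have hlow : low e i = e i.succ - 1 := rfl
    by_cases h1 : e i.succ = 1
    · rw [if_pos ((opt_eq e he i).2 h1), h1]
    · rw [if_neg (fun h => h1 ((opt_eq e he i).1 h))]
      by_cases h2 : low e i = 0
      · rw [if_pos h2]; omega
      · rw [if_neg h2]; omega

lemma low_lift {m : ℕ} (e : Fin m → ℕ) (o : Option (Fin m)) (ho : Valid e o) :
    low (lift e o) = e := by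
  funext i
  simp only [lift, Fin.cons_succ, low]
  by_cases h : o = some i
  · have := (ho i h).1
    simp [h, this]
  · simp only [h, if_false]
    split_ifs <;> omega

lemma opt_lift {m : ℕ} (e : Fin m → ℕ) (o : Option (Fin m)) (he : CC e) (ho : Valid e o) :
    opt (lift e o) = o := by
  apply Option.ext
  intro i
  change opt (lift e o) = some i ↔ o = some i
  rw [opt_eq _ (cc_lift e o he ho)]
  simp only [lift, Fin.cons_succ]
  split_ifs <;> simp_all

lemma cc_low {m : ℕ} (e : Fin (m + 1) → ℕ) (he : CC e) : CC (low e) := by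
  refine ⟨?_, ?_, ?_⟩
  · intro i
    have := he.inv i.succ
    simp only [Fin.val_succ] at this
    simp only [low]; omega
  · intro i j hij h1 h2
    have := he.dist i.succ j.succ (Fin.succ_lt_succ_iff.2 hij)
    simp only [low] at h1 h2
    omega
  · intro i j k hij hjk
    have := he.av i.succ j.succ k.succ (Fin.succ_lt_succ_iff.2 hij) (Fin.succ_lt_succ_iff.2 hjk)
    simp only [low]
    omega

lemma valid_low {m : ℕ} (e : Fin (m + 1) → ℕ) (he : CC e) : Valid (low e) (opt e) := by
  intro j hj
  rw [opt_eq e he] at hj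
  refine ⟨by simp [low, hj], fun i k hij hik h0 => ?_⟩
  have h1 := he.av j.succ i.succ k.succ (Fin.succ_lt_succ_iff.2 hij) (Fin.succ_lt_succ_iff.2 hik)
  have h2 := he.dist j.succ i.succ (Fin.succ_lt_succ_iff.2 hij)
  simp only [low] at *
  omega

open Classical in
lemma sum_CS (m : ℕ) (φ : (Fin (m + 1) → ℕ) → ℕ) :
    ∑ e ∈ CS (m + 1), φ e =
      ∑ e ∈ CS m, ∑ o : Option (Fin m), if Valid e o then φ (lift e o) else 0 := by
  have : ∀ e : Fin m → ℕ, (∑ o : Option (Fin m), if Valid e o then φ (lift e o) else 0) =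
      ∑ o ∈ Finset.univ.filter (fun o => Valid e o), φ (lift e o) := by
    intro e
    rw [Finset.sum_filter]
  simp only [this]
  rw [Finset.sum_sigma']
  refine Finset.sum_bij' (fun e _ => ⟨low e, opt e⟩) (fun p _ => lift p.1 p.2) ?_ ?_ ?_ ?_ ?_
  · intro e he
    rw [mem_CS] at he
    simp [mem_CS, cc_low e he, valid_low e he]
  · rintro ⟨e, o⟩ h
    simp [mem_CS] at h ⊢
    exact cc_lift e o h.1 h.2
  · intro e he
    rw [mem_CS] at he
    exact lift_low e he
  · rintro ⟨e, o⟩ h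
    simp [mem_CS] at h
    simp [low_lift e o h.2, opt_lift e o h.1 h.2]
  · intro e he
    rw [mem_CS] at he
    simp [lift_low e he]

/-- One plus the position of the last nonzero entry (0 if none). -/
def tau {m : ℕ} (e : Fin m → ℕ) : ℕ :=
  Finset.univ.sup (fun i : Fin m => if e i = 0 then 0 else (i : ℕ) + 1)

lemma tau_le_iff {m : ℕ} (e : Fin m → ℕ) (b : ℕ) :
    tau e ≤ b ↔ ∀ i, e i ≠ 0 → (i : ℕ) + 1 ≤ b := by
  unfold tau
  rw [Finset.sup_le_iff]
  constructor
  · intro h i hi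
    simpa [hi] using h i (Finset.mem_univ _)
  · intro h i _
    split_ifs with h0
    · omega
    · exact h i h0

lemma tau_le {m : ℕ} (e : Fin m → ℕ) : tau e ≤ m := by
  rw [tau_le_iff]; intro i _; exact i.2

lemma tau_zero {m : ℕ} (e : Fin m → ℕ) (h : tau e = 0) (i : Fin m) : e i = 0 := by
  have := (tau_le_iff e 0).1 h.le i
  omega

lemma tau_lift_none {m : ℕ} (e : Fin m → ℕ) :
    tau (lift e none) = if tau e = 0 then 0 else tau e + 1 := by
  apply eq_of_forall_ge_iff
  intro c
  rw [tau_le_iff, Fin.forall_fin_succ]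
  simp only [lift, Fin.cons_zero, Fin.cons_succ, Fin.val_succ, reduceCtorEq, if_false]
  by_cases h : tau e = 0
  · rw [if_pos h]
    have := tau_zero e h
    simp [this]
  · rw [if_neg h]
    have h2 := tau_le_iff e (c - 1)
    constructor
    · rintro ⟨_, h1⟩
      have h3 : tau e ≤ c - 1 := h2.2 (fun i hi => by
        have := h1 i (by simp [hi]); omega)
      by_contra hc
      have h4 : c = 0 := by omega
      subst h4
      omega
    · intro hc
      refine ⟨by simp, fun i hi => ?_⟩
      have := h2.1 (by omega) i (by intro h0; simp [h0] at hi)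
      omega

lemma tau_lift_some {m : ℕ} (e : Fin m → ℕ) (j : Fin m) :
    tau (lift e (some j)) = max (tau e + 1) ((j : ℕ) + 2) := by
  apply eq_of_forall_ge_iff
  intro c
  rw [tau_le_iff, Fin.forall_fin_succ]
  simp only [lift, Fin.cons_zero, Fin.cons_succ, Fin.val_succ, max_le_iff]
  have h2 := tau_le_iff e (c - 1)
  constructor
  · rintro ⟨_, h1⟩
    have h5 := h1 j (by simp)
    have h3 : tau e ≤ c - 1 := h2.2 (fun i hi => by
        have := h1 i (by split_ifs <;> simp); omega)
    omega
  · rintro ⟨h1, h3⟩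
    refine ⟨by simp, fun i hi => ?_⟩
    by_cases hij : j = i
    · subst hij; omega
    · have := h2.1 (by omega) i (by intro h0; simp [h0, hij] at hi)
      omega

def phi {m : ℕ} (L : ℕ) (e : Fin m → ℕ) : ℕ := if tau e = 0 then T L m else G L (m - tau e + 1)

lemma sum_tail (m t : ℕ) (ht : t ≤ m) (f : ℕ → ℕ) :
    (∑ j : Fin m, if t ≤ (j : ℕ) then f (m - 1 - j) else 0) = ∑ s ∈ Finset.range (m - t), f s := by
  rw [← Finset.sum_range (fun j => if t ≤ j then f (m - 1 - j) else 0),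
    ← Finset.sum_filter]
  refine Finset.sum_bij' (fun j _ => m - 1 - j) (fun s _ => m - 1 - s) ?_ ?_ ?_ ?_ ?_
  · intro j hj; simp at hj ⊢; omega
  · intro j hj; simp at hj ⊢; omega
  · intro j hj; simp at hj ⊢; omega
  · intro j hj; simp at hj ⊢; omega
  · intro j hj; rfl

open Classical in
lemma step {m : ℕ} (L : ℕ) (e : Fin m → ℕ) (he : CC e) :
    (∑ o : Option (Fin m), if Valid e o then phi L (lift e o) else 0) = phi (L + 1) e := by
  rw [Fintype.sum_option]
  have hnone : Valid e none := by intro j hj; simp at hj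
  rw [if_pos hnone]
  have hle := tau_le e
  by_cases h0 : tau e = 0
  · have hz := tau_zero e h0
    have hv : ∀ j, Valid e (some j) := fun j => fun i _ => ⟨hz i, fun _ k _ _ _ => hz k⟩
    simp only [hv, if_true, phi, tau_lift_none, tau_lift_some, h0, T]
    congr 1
    rw [← Nat.sub_zero m, ← sum_tail m 0 (by omega) (fun u => G L (u + 1))]
    apply Finset.sum_congr rfl
    intro j _
    have := j.2
    rw [if_neg (by omega), if_pos (by omega)]
    congr 1
    simp
    omega
  · -- last nonzero position
    obtain ⟨l, hl0, hlt⟩ : ∃ l : Fin m, e l ≠ 0 ∧ (l : ℕ) + 1 = tau e := by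
      by_contra hcon
      push Not at hcon
      have : tau e ≤ tau e - 1 := by
        rw [tau_le_iff]
        intro i hi
        have h1 := (tau_le_iff e (tau e)).1 le_rfl i hi
        have h2 := hcon i hi
        omega
      omega
    have hafter : ∀ i : Fin m, tau e ≤ (i : ℕ) → e i = 0 := by
      intro i hi
      by_contra hc
      have := (tau_le_iff e (tau e)).1 le_rfl i hc
      omega
    -- last zero before it
    have hne : (Finset.univ.filter (fun i : Fin m => e i = 0 ∧ i < l)).Nonempty := by
      refine ⟨⟨0, l.pos⟩, ?_⟩
      have h1 : e ⟨0, l.pos⟩ = 0 := Nat.le_zero.1 (he.inv ⟨0, l.pos⟩)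
      have := he.inv l
      simp only [Finset.mem_filter, Finset.mem_univ, true_and]
      refine ⟨h1, Fin.lt_def.2 ?_⟩
      change 0 < (l : ℕ)
      omega
    obtain ⟨z, hz, hmax⟩ := Finset.exists_max_image _ (fun i : Fin m => i) hne
    simp only [Finset.mem_filter, Finset.mem_univ, true_and] at hz hmax
    have hzl : (z : ℕ) < l := hz.2
    have hval : ∀ j, Valid e (some j) ↔ j = z ∨ tau e ≤ (j : ℕ) := by
      intro j
      constructor
      · intro h
        obtain ⟨h1, h2⟩ := h j rfl
        by_contra hc
        push Not at hc
        obtain ⟨hc1, hc2⟩ := hc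
        have hjl : j < l := by
          refine lt_of_le_of_ne (by rw [Fin.le_def]; omega) ?_
          rintro rfl
          exact hl0 h1
        have hjz : j < z := lt_of_le_of_ne (hmax j ⟨h1, hjl⟩) hc1
        exact hl0 (h2 z l hjz hz.2 hz.1)
      · intro h j' hj'
        obtain rfl := Option.some.inj hj'
        rcases h with rfl | h
        · refine ⟨hz.1, fun i k hji hik hi => ?_⟩
          by_cases hil : i < l
          · exact absurd (hmax i ⟨hi, hil⟩) (not_le.2 hji)
          · apply hafter
            rw [Fin.lt_def] at hil hik
            omega
        · refine ⟨hafter _ h, fun i k hji hik hi => hafter _ ?_⟩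
          rw [Fin.lt_def] at hji hik
          omega
    have hsplit : ∀ j : Fin m, (if Valid e (some j) then phi L (lift e (some j)) else 0) =
        (if j = z then G L (m - tau e + 1) else 0) +
        (if tau e ≤ (j : ℕ) then G L (m - 1 - j + 1) else 0) := by
      intro j
      have hj := j.2
      simp only [hval]
      by_cases hjz : j = z
      · subst hjz
        rw [if_pos (Or.inl rfl), if_pos rfl, if_neg (by omega)]
        simp only [phi, tau_lift_some]
        rw [if_neg (by omega), max_eq_left (by omega)]
        congr 1
        omega
      · by_cases hjt : tau e ≤ (j : ℕ)
        · rw [if_pos (Or.inr hjt), if_neg hjz, if_pos hjt]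
          simp only [phi, tau_lift_some]
          rw [if_neg (by omega), max_eq_right (by omega), zero_add]
          congr 1
          omega
        · rw [if_neg (by tauto), if_neg hjz, if_neg hjt]
    simp only [hsplit]
    rw [Finset.sum_add_distrib, sum_tail m (tau e) hle (fun s => G L (s + 1))]
    simp only [Finset.sum_ite_eq', Finset.mem_univ, if_true]
    simp only [phi, tau_lift_none, h0, if_false, G, Finset.sum_range_succ]
    rw [if_neg (by omega)]
    have : m + 1 - (tau e + 1) + 1 = m - tau e + 1 := by omega
    rw [this]
    ring

lemma sum_phi (m L : ℕ) : ∑ e ∈ CS m, phi L e = T (m + L) 0 := by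
  induction m generalizing L with
  | zero =>
    have : CS 0 = {Fin.elim0} := by
      ext e
      rw [mem_CS]
      simp only [Finset.mem_singleton]
      refine ⟨fun _ => Subsingleton.elim _ _, fun _ => ⟨fun i => i.elim0, fun i => i.elim0,
        fun i => i.elim0⟩⟩
    rw [this, Finset.sum_singleton]
    simp [phi, tau]
  | succ m ih =>
    rw [sum_CS, Finset.sum_congr rfl (fun e he => step L e ((mem_CS e).1 he)), ih]
    congr 1
    ring

lemma card_C (n : ℕ) : Nat.card {e : Fin n → ℕ // CC e} = T n 0 := by
  have h := sum_phi n 0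
  have h1 : ∀ e : Fin n → ℕ, phi 0 e = 1 := by
    intro e; simp [phi, T, G]
  simp only [h1, Finset.sum_const, smul_eq_mul, mul_one, Nat.add_zero] at h
  rw [← h]
  exact Nat.subtype_card (CS n) mem_CS

end Fib9

open Fib9 in
theorem stmt_9 (n : ℕ) (hn : 1 ≤ n) (p q : List ℕ)
    (hpq : (p, q) = ([0,1,2], [1,0,2]) ∨ (p, q) = ([0,1,2], [1,2,0]) ∨
           (p, q) = ([0,1,1], [1,0,2])) :
    Nat.card {e : Fin n → ℕ // InvSeq e ∧ Avoids e p ∧ Avoids e q}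
      = Nat.fib (2 * n - 1) := by
  rw [← T_fib n hn]
  rcases hpq with h | h | h
  · obtain ⟨rfl, rfl⟩ := Prod.mk.inj h
    rw [← card_A]
    apply Nat.card_congr (Equiv.subtypeEquivRight _)
    intro e
    constructor
    · rintro ⟨h1, h2, _⟩
      exact ⟨h1, (wd_iff e h1).1 h2⟩
    · rintro ⟨h1, h2⟩
      refine ⟨h1, (wd_iff e h1).2 h2, (avoids102 e).2 ?_⟩
      rintro i j k hij hjk ⟨h3, h4⟩
      have := h2 i k (hij.trans hjk) (by omega)
      omega
  · obtain ⟨rfl, rfl⟩ := Prod.mk.inj h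
    rw [← card_A]
    apply Nat.card_congr (Equiv.subtypeEquivRight _)
    intro e
    constructor
    · rintro ⟨h1, h2, _⟩
      exact ⟨h1, (wd_iff e h1).1 h2⟩
    · rintro ⟨h1, h2⟩
      refine ⟨h1, (wd_iff e h1).2 h2, (avoids120 e).2 ?_⟩
      rintro i j k hij hjk ⟨h3, h4⟩
      have := h2 i j hij (by omega)
      omega
  · obtain ⟨rfl, rfl⟩ := Prod.mk.inj h
    rw [← card_C]
    exact Nat.card_congr (Equiv.subtypeEquivRight cc_iff)
end

section
/- For every integer n ≥ 1, the number of inversion sequences of length n avoiding both patterns 021 and 120 equals 1 + ∑_{i=1}^{n−1} binom(2i, i−1), i.e. |I_n(021,120)| = 1 + ∑_{i=1}^{n−1} binom(2i, i−1). (This resolves the conjecture of Martinez and Savage that |I_n(>,≠,−)| = |I_n(<,>,≠)|, since I_n(021,120) = I_n(<,>,≠).) -/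
namespace P10

def ext (s : Finset ℕ) (t : ℕ → Finset (List ℕ)) : Finset (List ℕ) :=
  s.biUnion (fun x => (t x).image (List.cons x))

lemma card_ext (s : Finset ℕ) (t : ℕ → Finset (List ℕ)) :
    (ext s t).card = ∑ x ∈ s, (t x).card := by
  unfold ext
  rw [Finset.card_biUnion]
  · refine Finset.sum_congr rfl fun x _ => Finset.card_image_of_injective _ ?_
    intro a b h
    simpa using h
  · intro x _ y _ hxy
    rw [Function.onFun, Finset.disjoint_left]
    intro l h1 h2
    simp only [Finset.mem_image] at h1 h2
    obtain ⟨a, _, rfl⟩ := h1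
    obtain ⟨b, _, h⟩ := h2
    simp only [List.cons.injEq] at h
    exact hxy h.1.symm

lemma nil_mem_ext (s : Finset ℕ) (t : ℕ → Finset (List ℕ)) : [] ∉ ext s t := by
  simp [ext]

lemma cons_mem_ext (s : Finset ℕ) (t : ℕ → Finset (List ℕ)) (x : ℕ) (l : List ℕ) :
    x :: l ∈ ext s t ↔ x ∈ s ∧ l ∈ t x := by
  simp [ext]

def setC : ℕ → ℕ → ℕ → Finset (List ℕ)
  | 0, _, _ => {[]}
  | j + 1, i, v => ext (Finset.Icc v i) (fun x => setC j (i + 1) x)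

def setB : ℕ → ℕ → ℕ → Finset (List ℕ)
  | 0, _, _ => {[]}
  | j + 1, i, v => ext (insert 0 (insert v (Finset.Icc (v + 1) i)))
      (fun x => if x ≤ v then setB j (i + 1) v else setC j (i + 1) x)

def setA : ℕ → ℕ → Finset (List ℕ)
  | 0, _ => {[]}
  | j + 1, i => ext (insert 0 (Finset.Icc 1 i))
      (fun x => if x = 0 then setA j (i + 1) else setB j (i + 1) x)

def bnd : ℕ → List ℕ → Prop
  | _, [] => True
  | i, x :: l => x ≤ i ∧ bnd (i + 1) l

lemma bnd_iff (l : List ℕ) : ∀ i, bnd i l ↔ ∀ k (h : k < l.length), l[k] ≤ i + k := by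
  induction l with
  | nil => intro i; simp [bnd]
  | cons x l ih =>
    intro i
    rw [bnd, ih]
    constructor
    · rintro ⟨h1, h2⟩ k hk
      cases k with
      | zero => simpa using h1
      | succ k =>
        have := h2 k (by simpa using hk)
        simp only [List.getElem_cons_succ]
        omega
    · intro h
      refine ⟨h 0 (by simp), fun k hk => ?_⟩
      have := h (k + 1) (by simpa using hk)
      simp only [List.getElem_cons_succ] at this
      omega

lemma mem_setC (l : List ℕ) : ∀ j i v, l ∈ setC j i v ↔
    l.length = j ∧ bnd i l ∧ (∀ x ∈ l, v ≤ x) ∧ l.Pairwise (· ≤ ·) := by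
  induction l with
  | nil =>
    intro j i v
    cases j with
    | zero => simp [setC, bnd]
    | succ j => simp [setC, nil_mem_ext]
  | cons x l ih =>
    intro j i v
    cases j with
    | zero => simp [setC]
    | succ j =>
      rw [setC, cons_mem_ext, ih]
      simp only [Finset.mem_Icc, List.length_cons, bnd, List.mem_cons, List.pairwise_cons]
      constructor
      · rintro ⟨⟨h1, h2⟩, h3, h4, h5, h6⟩
        refine ⟨by omega, ⟨h2, h4⟩, ?_, h5, h6⟩
        rintro y (rfl | hy)
        · exact h1
        · exact h1.trans (h5 y hy)
      · rintro ⟨h1, ⟨h2, h3⟩, h4, h5, h6⟩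
        exact ⟨⟨h4 x (Or.inl rfl), h2⟩, by omega, h3, h5, h6⟩

lemma mem_setB (l : List ℕ) : ∀ j i v, 0 < v → v < i → (l ∈ setB j i v ↔
    l.length = j ∧ bnd i l ∧ (∀ x ∈ l, x = 0 ∨ v ≤ x) ∧
      l.Pairwise (fun b c => c = 0 ∨ b ≤ c) ∧ l.Pairwise (fun b c => v < b → c ≠ 0)) := by
  induction l with
  | nil =>
    intro j i v _ _
    cases j with
    | zero => simp [setB, bnd]
    | succ j => simp [setB, nil_mem_ext]
  | cons x l ih =>
    intro j i v hv hi
    cases j with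
    | zero => simp [setB]
    | succ j =>
      rw [setB, cons_mem_ext]
      simp only [Finset.mem_Icc, Finset.mem_insert, List.length_cons, bnd, List.mem_cons,
        List.pairwise_cons, forall_eq_or_imp]
      by_cases hx : x ≤ v
      · rw [if_pos hx, ih _ _ _ hv (by omega)]
        constructor
        · rintro ⟨h0, h1, h2, h3, h4, h5⟩
          refine ⟨by omega, ⟨by omega, h2⟩, ⟨by omega, h3⟩, ⟨?_, h4⟩, ?_, h5⟩
          · intro y hy
            have := h3 y hy
            omega
          · intro y hy
            omega
        · rintro ⟨h1, ⟨h2, h3⟩, ⟨h4, h5⟩, ⟨h6, h7⟩, h8, h9⟩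
          exact ⟨by omega, by omega, h3, h5, h7, h9⟩
      · rw [if_neg hx, mem_setC]
        constructor
        · rintro ⟨h0, h1, h2, h3, h4⟩
          refine ⟨by omega, ⟨by omega, h2⟩, ⟨by omega, fun y hy => ?_⟩,
            ⟨fun y hy => Or.inr (h3 y hy), h4.imp fun h => Or.inr h⟩, fun y hy => ?_, ?_⟩
          · have := h3 y hy
            omega
          · have := h3 y hy
            omega
          · exact h4.imp (fun {a b} h h' => by omega)
        · rintro ⟨h1, ⟨h2, h3⟩, ⟨h4, h5⟩, ⟨h6, h7⟩, h8, h9⟩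
          have hp : ∀ y ∈ l, x ≤ y := fun y hy => by
            have := h6 y hy
            have := h8 y hy (by omega)
            omega
          refine ⟨by omega, by omega, h3, hp, ?_⟩
          refine h7.imp_of_mem (fun {a b} ha hb h => ?_)
          have := hp b hb
          omega

lemma mem_setA (l : List ℕ) : ∀ j i, (l ∈ setA j i ↔
    l.length = j ∧ bnd i l ∧
      l.Pairwise (fun b c => c = 0 ∨ b ≤ c) ∧
      l.Triplewise (fun a b c => 0 < a → a < b → c ≠ 0)) := by
  induction l with
  | nil =>
    intro j i
    cases j with
    | zero => simp [setA, bnd]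
    | succ j => simp [setA, nil_mem_ext]
  | cons x l ih =>
    intro j i
    cases j with
    | zero => simp [setA]
    | succ j =>
      rw [setA, cons_mem_ext]
      simp only [Finset.mem_Icc, Finset.mem_insert, List.length_cons, bnd,
        List.pairwise_cons, List.triplewise_cons]
      by_cases hx : x = 0
      · rw [if_pos hx, ih]
        subst hx
        have ht : List.Pairwise (fun b c : ℕ => (0 : ℕ) < 0 → 0 < b → c ≠ 0) l :=
          List.pairwise_of_forall (fun _ _ h => absurd h (lt_irrefl 0))
        have hq : ∀ y ∈ l, y = 0 ∨ 0 ≤ y := fun y _ => Or.inr (Nat.zero_le y)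
        constructor
        · rintro ⟨_, h1, h2, h3, h4⟩
          exact ⟨by omega, ⟨by omega, h2⟩, ⟨hq, h3⟩, ht, h4⟩
        · rintro ⟨h1, ⟨_, h2⟩, ⟨_, h3⟩, _, h4⟩
          exact ⟨Or.inl rfl, by omega, h2, h3, h4⟩
      · rw [if_neg hx]
        constructor
        · rintro ⟨h0, h⟩
          rw [mem_setB _ _ _ _ (by omega) (by omega)] at h
          obtain ⟨h1, h2, h3, h4, h5⟩ := h
          refine ⟨by omega, ⟨by omega, h2⟩, ⟨fun y hy => h3 y hy, h4⟩, ?_, ?_⟩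
          · exact h5.imp fun {a b} h _ => h
          · clear ih h1 h2 h4
            induction l with
            | nil => simp
            | cons y l ih2 =>
              rw [List.pairwise_cons] at h5
              rw [List.triplewise_cons]
              refine ⟨h5.2.imp fun {a b} h h6 h7 => h ?_,
                ih2 (fun z hz => h3 z (List.mem_cons_of_mem _ hz)) h5.2⟩
              have := h3 y (by simp)
              omega
        · rintro ⟨h1, ⟨h2, h3⟩, ⟨h4, h5⟩, h6, h7⟩
          refine ⟨by omega, ?_⟩
          rw [mem_setB _ _ _ _ (by omega) (by omega)]
          exact ⟨by omega, h3, h4, h5, h6.imp fun {a b} h => h (by omega)⟩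

/-! ### Counting -/

def c : ℕ → ℕ → ℕ
  | 0, _ => 1
  | j + 1, d => ∑ s ∈ Finset.range (d + 1), c j (s + 1)

lemma sum_slack (f : ℕ → ℕ) (v d : ℕ) :
    ∑ x ∈ Finset.Icc v (v + d), f (v + d + 1 - x) = ∑ s ∈ Finset.range (d + 1), f (s + 1) := by
  refine Finset.sum_bij' (fun x _ => v + d - x) (fun s _ => v + d - s) ?_ ?_ ?_ ?_ ?_
  · intro x hx; simp only [Finset.mem_Icc, Finset.mem_range] at *; omega
  · intro x hx; simp only [Finset.mem_Icc, Finset.mem_range] at *; omega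
  · intro x hx; simp only [Finset.mem_Icc, Finset.mem_range] at *; omega
  · intro x hx; simp only [Finset.mem_Icc, Finset.mem_range] at *; omega
  · intro x hx
    simp only [Finset.mem_Icc] at hx
    congr 1; omega

lemma card_setC (j : ℕ) : ∀ i v, v ≤ i → (setC j i v).card = c j (i - v) := by
  induction j with
  | zero => intro i v _; simp [setC, c]
  | succ j ih =>
    intro i v h
    obtain ⟨d, rfl⟩ := Nat.exists_eq_add_of_le h
    rw [setC, card_ext, c, Nat.add_sub_cancel_left, ← sum_slack]
    refine Finset.sum_congr rfl fun x hx => ?_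
    simp only [Finset.mem_Icc] at hx
    exact ih _ _ (by omega)

lemma c_succ_zero (j : ℕ) : c (j + 1) 0 = c j 1 := by simp [c]
lemma c_succ_succ (j d : ℕ) : c (j + 1) (d + 1) = c (j + 1) d + c j (d + 2) := by
  exact Finset.sum_range_succ (fun s => c j (s + 1)) (d + 1)

lemma c_closed (j : ℕ) : ∀ d, c (j + 1) d + (2 * j + 2 + d).choose j
    = (2 * j + 2 + d).choose (j + 1) := by
  induction j with
  | zero =>
    intro d
    simp [c]; omega
  | succ j ih =>
    intro d
    induction d with
    | zero =>
      rw [c_succ_zero]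
      have h := ih 1
      have e1 : (2 * (j + 1) + 2 + 0).choose (j + 1)
          = (2 * j + 2 + 1).choose j + (2 * j + 2 + 1).choose (j + 1) := Nat.choose_succ_succ _ _
      have e2 : (2 * (j + 1) + 2 + 0).choose (j + 1 + 1)
          = (2 * j + 2 + 1).choose (j + 1) + (2 * j + 2 + 1).choose (j + 2) :=
        Nat.choose_succ_succ _ _
      have e3 : (2 * j + 2 + 1).choose (j + 1) = (2 * j + 2 + 1).choose (j + 2) :=
        Nat.choose_symm_of_eq_add (by omega)
      omega
    | succ d ihd =>
      rw [c_succ_succ]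
      have h := ih (d + 2)
      have e0 : 2 * j + 2 + (d + 2) = 2 * (j + 1) + 2 + d := by ring
      rw [e0] at h
      have e1 : (2 * (j + 1) + 2 + (d + 1)).choose (j + 1)
          = (2 * (j + 1) + 2 + d).choose j + (2 * (j + 1) + 2 + d).choose (j + 1) :=
        Nat.choose_succ_succ _ _
      have e2 : (2 * (j + 1) + 2 + (d + 1)).choose (j + 1 + 1)
          = (2 * (j + 1) + 2 + d).choose (j + 1) + (2 * (j + 1) + 2 + d).choose (j + 2) :=
        Nat.choose_succ_succ _ _
      have e4 : (2 * (j + 1) + 2 + d).choose (j + 1 + 1) = (2 * (j + 1) + 2 + d).choose (j + 2) :=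
        rfl
      omega

lemma card_setB (j : ℕ) : ∀ v d, 0 < v →
    (setB j (v + d + 1) v).card = (2 * j + d + 1).choose j := by
  induction j with
  | zero => intro v d _; simp [setB]
  | succ j ih =>
    intro v d hv
    rw [setB, card_ext, Finset.sum_insert, Finset.sum_insert]
    · have h1 : ∑ x ∈ Finset.Icc (v + 1) (v + d + 1), (if x ≤ v then setB j (v + d + 1 + 1) v
          else setC j (v + d + 1 + 1) x).card = c (j + 1) d := by
        have e : v + d + 1 = v + 1 + d := by ring
        rw [c, ← sum_slack _ (v + 1), e]
        refine Finset.sum_congr rfl fun x hx => ?_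
        simp only [Finset.mem_Icc] at hx
        rw [if_neg (by omega), card_setC _ _ _ (by omega)]
      rw [h1, if_pos (by omega), if_pos le_rfl]
      have h2 := ih v (d + 1) hv
      have h3 := c_closed j d
      have e1 : (2 * (j + 1) + d + 1).choose (j + 1)
          = (2 * j + 2 + d).choose j + (2 * j + 2 + d).choose (j + 1) := by
        rw [← Nat.choose_succ_succ]
        congr 1 <;> omega
      have e2 : 2 * j + (d + 1) + 1 = 2 * j + 2 + d := by ring
      rw [e2] at h2
      have e3 : v + d + 1 + 1 = v + (d + 1) + 1 := by ring
      rw [e3, h2]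
      omega
    · simp
    · simp; omega

lemma sum_choose (j i : ℕ) : ∑ s ∈ Finset.range i, (2 * j + s + 1).choose j
    + (2 * j + 1).choose (j + 1) = (2 * j + i + 1).choose (j + 1) := by
  induction i with
  | zero => simp
  | succ i ih =>
    rw [Finset.sum_range_succ]
    have : (2 * j + (i + 1) + 1).choose (j + 1)
      = (2 * j + i + 1).choose j + (2 * j + i + 1).choose (j + 1) := Nat.choose_succ_succ _ _
    omega

lemma card_setA (j : ℕ) : ∀ i, (setA j i).card
    + ∑ k ∈ Finset.range j, (2 * k + 1).choose (k + 1) = (i + 2 * j).choose j := by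
  induction j with
  | zero => intro i; simp [setA]
  | succ j ih =>
    intro i
    rw [setA, card_ext, Finset.sum_insert (by simp), if_pos rfl, Finset.sum_range_succ]
    have h1 : ∑ x ∈ Finset.Icc 1 i, (if x = 0 then setA j (i + 1) else setB j (i + 1) x).card
        = ∑ s ∈ Finset.range i, (2 * j + s + 1).choose j := by
      cases i with
      | zero => simp
      | succ i =>
        have := sum_slack (fun s => (2 * j + s).choose j) 1 i
        rw [show i + 1 = 1 + i by ring, add_comm 1 i] at *
        refine Eq.trans (Finset.sum_congr rfl fun x hx => ?_) this
        simp only [Finset.mem_Icc] at hx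
        rw [if_neg (by omega)]
        have h := card_setB j x (i + 1 - x) (by omega)
        rw [show x + (i + 1 - x) + 1 = i + 1 + 1 by omega] at h
        rw [h]
        congr 1 <;> omega
    rw [h1]
    have h2 := sum_choose j i
    have h3 := ih (i + 1)
    have e : (i + 2 * (j + 1)).choose (j + 1)
      = (2 * j + i + 1).choose j + (2 * j + i + 1).choose (j + 1) := by
      rw [← Nat.choose_succ_succ]
      congr 1
      omega
    rw [show i + 1 + 2 * j = 2 * j + i + 1 by ring] at h3
    omega

lemma final_sum (n : ℕ) : 1 + ∑ i ∈ Finset.Icc 1 n, (2 * i).choose (i - 1)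
    + ∑ k ∈ Finset.range (n + 1), (2 * k + 1).choose (k + 1) = (2 * (n + 1)).choose (n + 1) := by
  induction n with
  | zero => simp
  | succ n ih =>
    rw [Finset.sum_Icc_succ_top (by omega), Finset.sum_range_succ _ (n + 1), Nat.add_sub_cancel]
    have e1 : (2 * (n + 1 + 1)).choose (n + 1 + 1)
      = (2 * (n + 1) + 1).choose (n + 1) + (2 * (n + 1) + 1).choose (n + 1 + 1) :=
      Nat.choose_succ_succ _ _
    have e2 : (2 * (n + 1) + 1).choose (n + 1)
      = (2 * (n + 1)).choose n + (2 * (n + 1)).choose (n + 1) := Nat.choose_succ_succ _ _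
    omega

/-! ### Patterns -/

lemma avoids021 {n : ℕ} (e : Fin n → ℕ) : Avoids e [0,2,1] ↔
    ∀ i j k : Fin n, i < j → j < k → ¬ (e i < e k ∧ e k < e j) := by
  constructor
  · intro h i j k hij hjk hh
    refine h ⟨![i, j, k], ?_, ?_⟩
    · intro a b hab
      fin_cases a <;> fin_cases b <;> simp at hab ⊢ <;> first | assumption | exact hij.trans hjk
    · intro a b
      fin_cases a <;> fin_cases b <;> simp <;> omega
  · rintro h ⟨s, hs, hp⟩
    refine h (s 0) (s 1) (s 2) (hs (by simp)) (hs (by simp)) ⟨?_, ?_⟩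
    · exact (hp 0 2).1.1 (by simp)
    · exact (hp 2 1).1.1 (by simp)

lemma avoids120 {n : ℕ} (e : Fin n → ℕ) : Avoids e [1,2,0] ↔
    ∀ i j k : Fin n, i < j → j < k → ¬ (e k < e i ∧ e i < e j) := by
  constructor
  · intro h i j k hij hjk hh
    refine h ⟨![i, j, k], ?_, ?_⟩
    · intro a b hab
      fin_cases a <;> fin_cases b <;> simp at hab ⊢ <;> first | assumption | exact hij.trans hjk
    · intro a b
      fin_cases a <;> fin_cases b <;> simp <;> omega
  · rintro h ⟨s, hs, hp⟩
    refine h (s 0) (s 1) (s 2) (hs (by simp)) (hs (by simp)) ⟨?_, ?_⟩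
    · exact (hp 2 0).1.1 (by simp)
    · exact (hp 0 1).1.1 (by simp)

lemma mem_ofFn {n : ℕ} (e : Fin n → ℕ) : List.ofFn e ∈ setA n 0 ↔
    InvSeq e ∧ Avoids e [0,2,1] ∧ Avoids e [1,2,0] := by
  rw [mem_setA, bnd_iff, List.pairwise_iff_getElem, List.triplewise_iff_getElem,
    avoids021, avoids120]
  simp only [List.length_ofFn, List.getElem_ofFn, true_and, zero_add]
  constructor
  · rintro ⟨h1, h2, h3⟩
    refine ⟨fun i => h1 i i.2, ?_, ?_⟩
    · intro i j k hij hjk hh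
      have := h2 j k j.2 k.2 hjk
      simp only [Fin.eta] at this
      omega
    · intro i j k hij hjk hh
      have a := h2 i k i.2 k.2 (hij.trans hjk)
      have b := h3 i j k hij hjk k.2
      simp only [Fin.eta] at a b
      omega
  · rintro ⟨h1, h2, h3⟩
    refine ⟨fun k hk => h1 ⟨k, hk⟩, ?_, ?_⟩
    · intro i j hi hj hij
      by_contra hc
      have h0 := h1 ⟨0, by omega⟩
      simp only [Nat.le_zero] at h0
      rcases Nat.eq_zero_or_pos i with rfl | hpos
      · omega
      · have := h2 ⟨0, by omega⟩ ⟨i, hi⟩ ⟨j, hj⟩ hpos hij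
        omega
    · intro i j k hij hjk hk ha hb hc
      have := h3 ⟨i, by omega⟩ ⟨j, by omega⟩ ⟨k, hk⟩ hij hjk
      omega

lemma card_eq (n : ℕ) :
    Nat.card {e : Fin n → ℕ // InvSeq e ∧ Avoids e [0,2,1] ∧ Avoids e [1,2,0]}
      = (setA n 0).card := by
  rw [← Set.ncard_coe_finset]
  have : ((setA n 0 : Finset (List ℕ)) : Set (List ℕ)) = Set.image List.ofFn
      {e : Fin n → ℕ | InvSeq e ∧ Avoids e [0,2,1] ∧ Avoids e [1,2,0]} := by
    ext l
    simp only [Finset.mem_coe, Set.mem_image, Set.mem_ofPred_eq]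
    constructor
    · intro h
      have hl : l.length = n := ((mem_setA _ _ _).1 h).1
      subst hl
      refine ⟨l.get, ?_, List.ofFn_get l⟩
      rw [← mem_ofFn, List.ofFn_get]
      exact h
    · rintro ⟨e, he, rfl⟩
      exact (mem_ofFn e).2 he
  rw [this, Set.ncard_image_of_injective _ List.ofFn_injective]
  rfl

end P10

theorem stmt_10 (n : ℕ) (hn : 1 ≤ n) :
    Nat.card {e : Fin n → ℕ // InvSeq e ∧ Avoids e [0,2,1] ∧ Avoids e [1,2,0]}
      = 1 + ∑ i ∈ Finset.Icc 1 (n - 1), Nat.choose (2 * i) (i - 1) := by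
  rw [P10.card_eq]
  obtain ⟨m, rfl⟩ := Nat.exists_eq_add_of_le' hn
  have h1 := P10.card_setA (m + 1) 0
  have h2 := P10.final_sum m
  rw [Nat.zero_add] at h1
  rw [Nat.add_sub_cancel]
  omega
end

section
/- For every integer n ≥ 1, the number of inversion sequences of length n avoiding both patterns 110 and 102 equals 1 + ∑_{i=1}^{n−1} binom(2i, i−1), i.e. |I_n(110,102)| = 1 + ∑_{i=1}^{n−1} binom(2i, i−1). -/
namespace S11

def Inc (p : ℕ) (e : ℕ → ℕ) : Prop := ∀ i j, i < j → j < p → e i ≤ e j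

/-- Avoiding inversion sequences of length `n` with values `< d`, extended by zero. -/
def Good (n d : ℕ) (e : ℕ → ℕ) : Prop :=
  (∀ i, n ≤ i → e i = 0) ∧ (∀ i, i < n → e i ≤ i) ∧ (∀ i, i < n → e i < d) ∧
  (∀ i j k, i < j → j < k → k < n → e i = e j → ¬ e k < e i) ∧
  (∀ i j k, i < j → j < k → k < n → e j < e i → ¬ e i < e k)

def Desc (n p : ℕ) (e : ℕ → ℕ) : Prop := 0 < p ∧ p < n ∧ e p < e (p - 1)

def NdInc (n d : ℕ) (e : ℕ → ℕ) : Prop :=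
  ∀ i j, i < j → j < n → e i ≠ d → e j ≠ d → e i ≤ e j

def SV (n d p : ℕ) : Set (ℕ → ℕ) := {e | Good n d e ∧ Inc p e ∧ ¬ Inc n e}
def SU (n d p : ℕ) : Set (ℕ → ℕ) := {e | Good n d e ∧ Inc p e ∧ Desc n p e}
def SW (n d : ℕ) : Set (ℕ → ℕ) := {e | Good n d e ∧ Inc n e}
def SN (n d p : ℕ) : Set (ℕ → ℕ) :=
  {e | Good n (d + 1) e ∧ Inc p e ∧ Desc n p e ∧ NdInc n d e}

noncomputable def V (n d p : ℕ) : ℕ := (SV n d p).ncard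
noncomputable def U (n d p : ℕ) : ℕ := (SU n d p).ncard
noncomputable def W (n d : ℕ) : ℕ := (SW n d).ncard
noncomputable def Nw (n d p : ℕ) : ℕ := (SN n d p).ncard

lemma good_finite (n d : ℕ) : {e | Good n d e}.Finite := by
  apply Set.Finite.subset (Set.finite_range
    (fun (f : Fin n → Fin d) (i : ℕ) => if h : i < n then (f ⟨i, h⟩ : ℕ) else 0))
  intro e he
  refine ⟨fun i => ⟨e i, he.2.2.1 i i.2⟩, ?_⟩
  funext i
  by_cases h : i < n
  · simp [h]
  · simp [h, he.1 i (by omega)]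

lemma ncard_eq_of_inv {A B : Set (ℕ → ℕ)} (f g : (ℕ → ℕ) → (ℕ → ℕ))
    (hf : ∀ a ∈ A, f a ∈ B) (hg : ∀ b ∈ B, g b ∈ A)
    (hgf : ∀ a ∈ A, g (f a) = a) (hfg : ∀ b ∈ B, f (g b) = b) : A.ncard = B.ncard := by
  apply Set.ncard_congr (fun a _ => f a) hf
  · intro a b ha hb h
    have := congrArg g h
    rwa [hgf a ha, hgf b hb] at this
  · intro b hb
    exact ⟨g b, hg b hb, hfg b hb⟩

lemma ncard_split {A B C : Set (ℕ → ℕ)} {n d : ℕ} (hA : A ⊆ {e | Good n d e})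
    (h : A = B ∪ C) (hd : ∀ e, e ∈ B → e ∈ C → False) : A.ncard = B.ncard + C.ncard := by
  have hfin := (good_finite n d).subset hA
  subst h
  exact Set.ncard_union_eq (Set.disjoint_left.mpr hd)
    (hfin.subset Set.subset_union_left) (hfin.subset Set.subset_union_right)

/-- Insert `d` at position `q`. -/
def ins (q d : ℕ) (e : ℕ → ℕ) : ℕ → ℕ :=
  fun i => if i < q then e i else if i = q then d else e (i - 1)
/-- Remove position `q`. -/
def rem (q : ℕ) (e : ℕ → ℕ) : ℕ → ℕ := fun i => if i < q then e i else e (i + 1)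

lemma rem_ins (q d : ℕ) (e : ℕ → ℕ) : rem q (ins q d e) = e := by
  funext i
  simp only [rem, ins]
  grind

lemma ins_rem (q d : ℕ) (e : ℕ → ℕ) (h : e q = d) : ins q d (rem q e) = e := by
  funext i
  simp only [rem, ins]
  grind

lemma ins_lt {q d i : ℕ} {e : ℕ → ℕ} (h : i < q) : ins q d e i = e i := by simp [ins, h]
lemma ins_eq {q d : ℕ} {e : ℕ → ℕ} : ins q d e q = d := by simp [ins]
lemma ins_gt {q d i : ℕ} {e : ℕ → ℕ} (h : q ≤ i) : ins q d e (i + 1) = e i := by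
  simp only [ins]; grind

lemma good_rem {m d q : ℕ} {e : ℕ → ℕ} (h : Good (m + 1) (d + 1) e) (hq : q < m + 1)
    (hd : e q = d) (hu : ∀ i, i < m + 1 → e i = d → i = q) : Good m d (rem q e) := by
  obtain ⟨h0, h1, h2, h3, h4⟩ := h
  have hlt : ∀ i, i < m + 1 → i ≠ q → e i < d := by
    intro i hi hne
    have := h2 i hi
    have := hu i hi
    grind
  have hdq := h1 q hq
  obtain ⟨s, hs⟩ : ∃ s : ℕ → ℕ, s = fun i => if i < q then i else i + 1 := ⟨_, rfl⟩
  have hr : ∀ i, rem q e i = e (s i) := by intro i; simp only [rem, hs]; grind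
  have hmono : ∀ i j, i < j → s i < s j := by intro i j hij; simp only [hs]; grind
  have hsm : ∀ i, i < m → s i < m + 1 := by intro i hi; simp only [hs]; grind
  have hsq : ∀ i, s i ≠ q := by intro i; simp only [hs]; grind
  refine ⟨?_, ?_, ?_, ?_, ?_⟩
  · intro i hi
    simp only [rem]
    have := h0 (i + 1) (by omega)
    have := h0 i
    grind
  · intro i hi
    have a1 := hlt (s i) (hsm i hi) (hsq i)
    by_cases hiq : i < q
    · have := h1 i (by omega)
      simp only [rem, hiq, if_true]; exact this
    · rw [hr]; omega
  · intro i hi; rw [hr]; exact hlt _ (hsm i hi) (hsq i)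
  · intro i j k hij hjk hk
    rw [hr, hr, hr]
    exact h3 _ _ _ (hmono _ _ hij) (hmono _ _ hjk) (hsm _ hk)
  · intro i j k hij hjk hk
    rw [hr, hr, hr]
    exact h4 _ _ _ (hmono _ _ hij) (hmono _ _ hjk) (hsm _ hk)

lemma inc_rem {q : ℕ} {e : ℕ → ℕ} (h : Inc (q + 1) e) : Inc q (rem q e) := by
  intro i j hij hj
  have := h i j hij (by omega)
  simp only [rem]; grind

lemma good_ins {m d q : ℕ} {e : ℕ → ℕ} (h : Good m d e) (hq : q ≤ m)
    (hd : d ≤ q) (hi : Inc q e) : Good (m + 1) (d + 1) (ins q d e) := by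
  obtain ⟨h0, h1, h2, h3, h4⟩ := h
  obtain ⟨s, hs⟩ : ∃ s : ℕ → ℕ, s = fun i => if i < q then i else i - 1 := ⟨_, rfl⟩
  have hr : ∀ i, i ≠ q → ins q d e i = e (s i) := by intro i; simp only [ins, hs]; grind
  have hmono : ∀ i j, i ≠ q → j ≠ q → i < j → s i < s j := by
    intro i j h1 h2 hij; simp only [hs]; grind
  have hsm : ∀ i, i ≠ q → i < m + 1 → s i < m := by intro i hi; simp only [hs]; grind
  have hsle : ∀ i, s i ≤ i := by intro i; simp only [hs]; grind
  have hsq : ∀ i, i < q → s i = i := by intro i; simp only [hs]; grind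
  have hlt : ∀ i, i ≠ q → i < m + 1 → ins q d e i < d := by
    intro i hi him; rw [hr i hi]; exact h2 _ (hsm i hi him)
  have hle : ∀ i, i < m + 1 → ins q d e i ≤ d := by
    intro i him
    by_cases hi : i = q
    · subst hi; rw [ins_eq]
    · exact (hlt i hi him).le
  refine ⟨?_, ?_, ?_, ?_, ?_⟩
  · intro i him
    rw [hr i (by omega)]
    apply h0; simp only [hs]; grind
  · intro i him
    by_cases hi : i = q
    · subst hi; rw [ins_eq]; exact hd
    · rw [hr i hi]; exact (h1 _ (hsm i hi him)).trans (hsle i)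
  · intro i him; have := hle i him; omega
  · intro i j k hij hjk hk he hlt'
    by_cases hiq : i = q
    · have := hlt j (by omega) (by omega)
      subst hiq; rw [ins_eq] at he; omega
    · by_cases hjq : j = q
      · have := hlt i (by omega) (by omega)
        subst hjq; rw [ins_eq] at he; omega
      · by_cases hkq : k = q
        · have := hle i (by omega)
          subst hkq; rw [ins_eq] at hlt'; omega
        · rw [hr i hiq, hr j hjq] at he
          rw [hr i hiq, hr k hkq] at hlt'
          exact h3 _ _ _ (hmono _ _ hiq hjq hij) (hmono _ _ hjq hkq hjk) (hsm _ hkq hk) he hlt'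
  · intro i j k hij hjk hk he hlt'
    by_cases hiq : i = q
    · have := hle k hk
      subst hiq; rw [ins_eq] at hlt'; omega
    · by_cases hjq : j = q
      · have := hle i (by omega)
        subst hjq; rw [ins_eq] at he; omega
      · by_cases hkq : k = q
        · have := hi i j hij (by omega)
          rw [hr i hiq, hr j hjq, hsq i (by omega), hsq j (by omega)] at he
          omega
        · rw [hr i hiq, hr j hjq] at he
          rw [hr i hiq, hr k hkq] at hlt'
          exact h4 _ _ _ (hmono _ _ hiq hjq hij) (hmono _ _ hjq hkq hjk) (hsm _ hkq hk) he hlt'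

lemma inc_ins {m d q : ℕ} {e : ℕ → ℕ} (h : Good m d e) (hq : q ≤ m) (hi : Inc q e) :
    Inc (q + 1) (ins q d e) := by
  intro i j hij hj
  rw [ins_lt (by omega : i < q)]
  by_cases hjq : j = q
  · subst hjq; rw [ins_eq]; exact (h.2.2.1 i (by omega)).le
  · rw [ins_lt (by omega)]; exact hi i j hij (by omega)

lemma desc_ins {m d q : ℕ} {e : ℕ → ℕ} (h : Good m d e) (hq : q < m) :
    Desc (m + 1) (q + 1) (ins q d e) := by
  refine ⟨by omega, by omega, ?_⟩
  rw [ins_gt le_rfl, Nat.add_sub_cancel, ins_eq]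
  exact h.2.2.1 q hq

lemma ins_uniq {m d q i : ℕ} {e : ℕ → ℕ} (h : Good m d e) (hi : i < m + 1) (hq : q ≤ m)
    (hd : ins q d e i = d) : i = q := by
  by_contra hne
  have := h.2.2.1
  rcases Nat.lt_or_gt_of_ne hne with h1 | h1
  · rw [ins_lt h1] at hd
    have := this i (by omega); omega
  · obtain ⟨i, rfl⟩ : ∃ j, i = j + 1 := ⟨i - 1, by omega⟩
    rw [ins_gt (by omega)] at hd
    have := this i (by omega); omega

lemma ndInc_ins {m d q : ℕ} {e : ℕ → ℕ} (h : Good m d e) (hq : q ≤ m) :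
    NdInc (m + 1) d (ins q d e) ↔ Inc m e := by
  constructor
  · intro hn i j hij hj
    have h2 := h.2.2.1
    have a1 := h2 i (by omega)
    have a2 := h2 j (by omega)
    by_cases hi : i < q
    · by_cases hj : j < q
      · have := hn i j hij (by omega)
        rw [ins_lt hi, ins_lt hj] at this
        exact this (by omega) (by omega)
      · have := hn i (j + 1) (by omega) (by omega)
        rw [ins_lt hi, ins_gt (by omega)] at this
        exact this (by omega) (by omega)
    · have := hn (i + 1) (j + 1) (by omega) (by omega)
      rw [ins_gt (by omega), ins_gt (by omega)] at this
      exact this (by omega) (by omega)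
  · intro hn i j hij hj hid hjd
    have hiq : i ≠ q := by rintro rfl; exact hid ins_eq
    have hjq : j ≠ q := by rintro rfl; exact hjd ins_eq
    simp only [ins]
    have a1 := hn i j
    have a2 := hn i (j - 1)
    have a3 := hn (i - 1) (j - 1)
    grind

lemma SU_uniq {m d p : ℕ} {e : ℕ → ℕ} (h : e ∈ SU (m + 1) (d + 1) p)
    (hd : ∃ i, i < m + 1 ∧ e i = d) (hc : ¬ NdInc (m + 1) d e ∨ e m ≠ d) :
    e (p - 1) = d ∧ ∀ i, i < m + 1 → e i = d → i = p - 1 := by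
  obtain ⟨⟨h0, h1, h2, h3, h4⟩, hi, hp, hpm, hdesc⟩ := h
  -- at most one occurrence
  have huniq : ∀ i j, i < j → j < m + 1 → e i = d → e j = d → False := by
    intro i j hij hj hei hej
    have hm : e m = d := by
      by_contra hne
      have a := h2 m (by omega)
      have : j ≠ m := by rintro rfl; exact hne hej
      exact h3 i j m hij (by omega) (by omega) (by omega) (by omega)
    rcases hc with hc | hc
    · apply hc
      intro x y hxy hy hx1 hy1
      by_contra hlt
      have : y ≠ m := by rintro rfl; exact hy1 hm
      have := h2 x (by omega)
      exact h4 x y m hxy (by omega) (by omega) (by omega) (by omega)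
    · exact hc hm
  obtain ⟨q, hq, hqd⟩ := hd
  have hqp : q = p - 1 := by
    by_contra hne
    rcases Nat.lt_or_gt_of_ne hne with hlt | hgt
    · have b1 := hi q (p - 1) hlt (by omega)
      have b2 := h2 (p - 1) (by omega)
      exact huniq q (p - 1) hlt (by omega) hqd (by omega)
    · have b2 := h2 (p - 1) (by omega)
      have b3 : e (p - 1) ≠ d := fun hh => huniq (p - 1) q hgt hq hh hqd
      by_cases hqp : q = p
      · subst hqp; omega
      · exact h4 (p - 1) p q (by omega) (by omega) hq hdesc (by omega)
  subst hqp
  refine ⟨hqd, ?_⟩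
  intro i hi' hid
  by_contra hne
  rcases Nat.lt_or_gt_of_ne hne with hlt | hgt
  · exact huniq _ _ hlt hq hid hqd
  · exact huniq _ _ hgt hi' hqd hid

/-- the part of `SU` with one occurrence of `d`, whose deletion is not increasing -/
def SB (n d p : ℕ) : Set (ℕ → ℕ) :=
  {e | e ∈ SU n (d + 1) p ∧ (∃ i, i < n ∧ e i = d) ∧ ¬ NdInc n d e}

lemma SB_card {m d p : ℕ} (h1 : d + 1 ≤ p) (h2 : p ≤ m) :
    (SB (m + 1) d p).ncard = V m d (p - 1) := by
  obtain ⟨q, rfl⟩ : ∃ q, p = q + 1 := ⟨p - 1, by omega⟩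
  rw [Nat.add_sub_cancel]
  apply ncard_eq_of_inv (rem q) (ins q d)
  · rintro e ⟨he, hd, hn⟩
    obtain ⟨hqd, hu⟩ := SU_uniq he hd (Or.inl hn)
    rw [Nat.add_sub_cancel] at hqd hu
    have hg := good_rem he.1 (by omega) hqd hu
    refine ⟨hg, inc_rem he.2.1, ?_⟩
    rw [← ndInc_ins hg (by omega : q ≤ m), ins_rem q d e hqd]
    exact hn
  · rintro e ⟨hg, hi, hn⟩
    refine ⟨⟨good_ins hg (by omega) (by omega) hi, inc_ins hg (by omega) hi,
      desc_ins hg (by omega)⟩, ⟨q, by omega, ins_eq⟩, ?_⟩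
    rw [ndInc_ins hg (by omega)]; exact hn
  · rintro e ⟨he, hd, hn⟩
    obtain ⟨hqd, hu⟩ := SU_uniq he hd (Or.inl hn)
    exact ins_rem q d e (by simpa using hqd)
  · intro e _; exact rem_ins q d e

lemma SB_empty {m d p : ℕ} (h : ¬ (d + 1 ≤ p ∧ p ≤ m)) : SB (m + 1) d p = ∅ := by
  rw [Set.eq_empty_iff_forall_notMem]
  rintro e ⟨he, hd, hn⟩
  obtain ⟨hqd, hu⟩ := SU_uniq he hd (Or.inl hn)
  have a := he.2.2.1
  have b := he.2.2.2.1
  have := he.1.2.1 (p - 1) (by omega)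
  omega

lemma good_mono {n d : ℕ} {e : ℕ → ℕ} (h : Good n d e) : Good n (d + 1) e :=
  ⟨h.1, h.2.1, fun i hi => (h.2.2.1 i hi).trans (Nat.lt_succ_self d), h.2.2.2⟩

lemma good_of_no {n d : ℕ} {e : ℕ → ℕ} (h : Good n (d + 1) e)
    (hn : ¬ ∃ i, i < n ∧ e i = d) : Good n d e := by
  refine ⟨h.1, h.2.1, fun i hi => ?_, h.2.2.2⟩
  have := h.2.2.1 i hi
  have : e i ≠ d := fun hh => hn ⟨i, hi, hh⟩
  omega

lemma SN_top {n d p : ℕ} {e : ℕ → ℕ} (h : e ∈ SN n d p) : e (p - 1) = d := by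
  obtain ⟨hg, hi, ⟨hp, hpn, hlt⟩, hn⟩ := h
  by_contra hne
  have := hg.2.2.1 (p - 1) (by omega)
  have := hn (p - 1) p (by omega) hpn hne (by omega)
  omega

lemma U_rec (m d p : ℕ) : U (m + 1) (d + 1) p =
    U (m + 1) d p + Nw (m + 1) d p + if d + 1 ≤ p ∧ p ≤ m then V m d (p - 1) else 0 := by
  have e1 : U (m + 1) (d + 1) p = (SU (m + 1) d p).ncard +
      (SN (m + 1) d p ∪ SB (m + 1) d p).ncard := by
    apply ncard_split (n := m + 1) (d := d + 1) (fun e he => he.1)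
    · ext e
      constructor
      · intro he
        by_cases hd : ∃ i, i < m + 1 ∧ e i = d
        · right
          by_cases hn : NdInc (m + 1) d e
          · left; exact ⟨he.1, he.2.1, he.2.2, hn⟩
          · right; exact ⟨he, hd, hn⟩
        · left; exact ⟨good_of_no he.1 hd, he.2⟩
      · rintro (he | he | he)
        · exact ⟨good_mono he.1, he.2⟩
        · exact ⟨he.1, he.2.1, he.2.2.1⟩
        · exact he.1
    · rintro e he (h | h)
      · have h1 := SN_top h
        have h2 := he.1.2.2.1 (p - 1) (by have := he.2.2.2.1; omega)
        omega
      · obtain ⟨i, hi, hid⟩ := h.2.1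
        have := he.1.2.2.1 i hi
        omega
  have e2 : (SN (m + 1) d p ∪ SB (m + 1) d p).ncard =
      (SN (m + 1) d p).ncard + (SB (m + 1) d p).ncard := by
    apply ncard_split (n := m + 1) (d := d + 1) _ rfl
    · intro e h1 h2; exact h2.2.2 h1.2.2.2
    · rintro e (h | h)
      · exact h.1
      · exact h.1.1
  rw [e1, e2]
  split_ifs with h
  · rw [SB_card h.1 h.2]; simp only [U, Nw]; ring
  · rw [SB_empty h]; simp [U, Nw]

def SN1 (n d p : ℕ) : Set (ℕ → ℕ) := {e | e ∈ SN (n + 1) d p ∧ e n = d}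
def SN2 (n d p : ℕ) : Set (ℕ → ℕ) := {e | e ∈ SN (n + 1) d p ∧ e n ≠ d}

def app (n d : ℕ) (e : ℕ → ℕ) : ℕ → ℕ := fun i => if i = n then d else e i

lemma app_app {n a b : ℕ} {e : ℕ → ℕ} (h : e n = b) : app n b (app n a e) = e := by
  funext i; simp only [app]; grind

lemma good_trunc {n d : ℕ} {e : ℕ → ℕ} (h : Good (n + 1) d e) : Good n d (app n 0 e) := by
  obtain ⟨h0, h1, h2, h3, h4⟩ := h
  refine ⟨?_, ?_, ?_, ?_, ?_⟩
  · intro i hi; simp only [app]; have := h0 i; grind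
  · intro i hi; have := h1 i (by omega); simp only [app]; grind
  · intro i hi; have := h2 i (by omega); simp only [app]; grind
  · intro i j k hij hjk hk
    have := h3 i j k hij hjk (by omega)
    simp only [app]
    rwa [if_neg (by omega), if_neg (by omega), if_neg (by omega)]
  · intro i j k hij hjk hk
    have := h4 i j k hij hjk (by omega)
    simp only [app]
    rwa [if_neg (by omega), if_neg (by omega), if_neg (by omega)]

lemma good_app {n d : ℕ} {e : ℕ → ℕ} (h : Good n (d + 1) e) (hd : d ≤ n)
    (hn : NdInc n d e) : Good (n + 1) (d + 1) (app n d e) := by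
  obtain ⟨h0, h1, h2, h3, h4⟩ := h
  have hr : ∀ i, i ≠ n → app n d e i = e i := by intro i hi; simp [app, hi]
  have hrn : app n d e n = d := by simp [app]
  refine ⟨?_, ?_, ?_, ?_, ?_⟩
  · intro i hi; rw [hr i (by omega)]; exact h0 i (by omega)
  · intro i hi; have := h1 i; simp only [app]; grind
  · intro i hi; have := h2 i; simp only [app]; grind
  · intro i j k hij hjk hk
    rw [hr i (by omega), hr j (by omega)]
    by_cases hkn : k = n
    · subst hkn; rw [hrn]; have := h2 i (by omega); omega
    · rw [hr k hkn]; exact h3 i j k hij hjk (by omega)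
  · intro i j k hij hjk hk
    rw [hr i (by omega), hr j (by omega)]
    by_cases hkn : k = n
    · subst hkn; rw [hrn]
      intro a b
      have := hn i j hij (by omega) (by omega) (by omega)
      omega
    · rw [hr k hkn]; exact h4 i j k hij hjk (by omega)

lemma SN1_card (n d p : ℕ) : (SN1 n d p).ncard = Nw n d p := by
  apply ncard_eq_of_inv (app n 0) (app n d)
  · rintro e ⟨he, hd⟩
    have ht := SN_top he
    obtain ⟨hg, hi, ⟨hp, hpn, hlt⟩, hn⟩ := he
    have hpn' : p ≠ n := by
      rintro rfl
      omega
    refine ⟨good_trunc hg, ?_, ⟨hp, by omega, ?_⟩, ?_⟩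
    · intro i j hij hj
      have := hi i j hij hj
      simp only [app]; grind
    · simp only [app]; grind
    · intro i j hij hj
      have := hn i j hij (by omega)
      simp only [app]; grind
  · intro e he
    have ht := SN_top he
    obtain ⟨hg, hi, ⟨hp, hpn, hlt⟩, hn⟩ := he
    have hdp := hg.2.1 (p - 1) (by omega)
    refine ⟨⟨good_app hg (by omega) hn, ?_, ⟨hp, by omega, ?_⟩, ?_⟩, ?_⟩
    · intro i j hij hj
      have := hi i j hij hj
      simp only [app]; grind
    · simp only [app]; grind
    · intro i j hij hj
      have := hn i j hij
      simp only [app]; grind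
    · simp [app]
  · intro e he
    exact app_app he.2
  · intro e he
    exact app_app (he.1.1 n le_rfl)

lemma SN2_card {m d p : ℕ} (h1 : d + 1 ≤ p) (h2 : p ≤ m) :
    (SN2 m d p).ncard = W m d := by
  obtain ⟨q, rfl⟩ : ∃ q, p = q + 1 := ⟨p - 1, by omega⟩
  have key : ∀ e ∈ SN2 m d (q + 1), e q = d ∧ ∀ i, i < m + 1 → e i = d → i = q := by
    rintro e ⟨he, hd⟩
    have ht := SN_top he
    have := SU_uniq (m := m) (d := d) (p := q + 1) (e := e) ⟨he.1, he.2.1, he.2.2.1⟩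
      ⟨q, by omega, by simpa using ht⟩ (Or.inr hd)
    simpa using this
  apply ncard_eq_of_inv (rem q) (ins q d)
  · intro e he
    obtain ⟨hqd, hu⟩ := key e he
    have hg := good_rem he.1.1 (by omega) hqd hu
    refine ⟨hg, ?_⟩
    rw [← ndInc_ins hg (by omega : q ≤ m), ins_rem q d e hqd]
    exact he.1.2.2.2
  · rintro e ⟨hg, hn⟩
    have hi : Inc q e := fun i j hij hj => hn i j hij (by omega)
    refine ⟨⟨good_ins hg (by omega) (by omega) hi, inc_ins hg (by omega) hi,
      desc_ins hg (by omega), ?_⟩, ?_⟩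
    · rw [ndInc_ins hg (by omega)]; exact hn
    · intro hh
      have := ins_uniq hg (by omega) (by omega) hh
      omega
  · intro e he
    exact ins_rem q d e (key e he).1
  · intro e _; exact rem_ins q d e

lemma SN2_empty {m d p : ℕ} (h : ¬ (d + 1 ≤ p ∧ p ≤ m)) : SN2 m d p = ∅ := by
  rw [Set.eq_empty_iff_forall_notMem]
  rintro e ⟨he, hd⟩
  have ht := SN_top he
  have a := he.2.2.1.1
  have b := he.2.2.1.2.1
  have := he.1.2.1 (p - 1) (by omega)
  omega

lemma Nw_rec (m d p : ℕ) : Nw (m + 1) d p =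
    Nw m d p + if d + 1 ≤ p ∧ p ≤ m then W m d else 0 := by
  have e1 : Nw (m + 1) d p = (SN1 m d p).ncard + (SN2 m d p).ncard := by
    apply ncard_split (n := m + 1) (d := d + 1) (fun e he => he.1)
    · ext e
      constructor
      · intro he
        by_cases h : e m = d
        · left; exact ⟨he, h⟩
        · right; exact ⟨he, h⟩
      · rintro (h | h)
        · exact h.1
        · exact h.1
    · intro e h1 h2; exact h2.2 h1.2
  rw [e1, SN1_card]
  split_ifs with h
  · rw [SN2_card h.1 h.2]
  · rw [SN2_empty h]; simp

lemma Nw_zero (d p : ℕ) : Nw 0 d p = 0 := by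
  have : SN 0 d p = ∅ := by
    rw [Set.eq_empty_iff_forall_notMem]
    intro e he
    exact absurd he.2.2.1.2.1 (by omega)
  simp [Nw, this]

lemma U_big {n d p : ℕ} (h : n ≤ p) : U n d p = 0 := by
  have : SU n d p = ∅ := by
    rw [Set.eq_empty_iff_forall_notMem]
    intro e he
    exact absurd he.2.2.2.1 (by omega)
  simp [U, this]

lemma U_zero (n p : ℕ) : U n 0 p = 0 := by
  have : SU n 0 p = ∅ := by
    rw [Set.eq_empty_iff_forall_notMem]
    intro e he
    have := he.2.2.2.1
    exact absurd (he.1.2.2.1 p this) (by omega)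
  simp [U, this]

lemma V_self (n d : ℕ) : V n d n = 0 := by
  have : SV n d n = ∅ := by
    rw [Set.eq_empty_iff_forall_notMem]
    intro e he
    exact he.2.2 he.2.1
  simp [V, this]

lemma V_rec {n d p : ℕ} (h : p < n) : V n d p = U n d p + V n d (p + 1) := by
  apply ncard_split (n := n) (d := d) (fun e he => he.1)
  · ext e
    constructor
    · intro he
      by_cases hi : Inc (p + 1) e
      · right; exact ⟨he.1, hi, he.2.2⟩
      · left
        have hp : 0 < p := by
          by_contra h0
          apply hi; intro i j hij hj; omega
        refine ⟨he.1, he.2.1, hp, h, ?_⟩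
        by_contra hlt
        apply hi
        intro i j hij hj
        by_cases hjp : j = p
        · subst hjp
          by_cases hi' : i = j - 1
          · subst hi'; omega
          · have := he.2.1 i (j - 1) (by omega) (by omega)
            omega
        · exact he.2.1 i j hij (by omega)
    · rintro (he | he)
      · refine ⟨he.1, he.2.1, ?_⟩
        intro hi
        have := hi (p - 1) p (by have := he.2.2.1; omega) h
        have := he.2.2.2.2
        omega
      · exact ⟨he.1, fun i j hij hj => he.2.1 i j hij (by omega), he.2.2⟩
  · intro e he h2
    have := h2.2.1 (p - 1) p (by have := he.2.2.1; omega) (by omega)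
    have := he.2.2.2.2
    omega

lemma V_eq (n d p : ℕ) (h : p ≤ n) : V n d p = ∑ q ∈ Finset.Ico p n, U n d q := by
  induction hk : n - p generalizing p with
  | zero =>
    have : p = n := by omega
    subst this; simp [V_self]
  | succ k ih =>
    rw [V_rec (by omega), ih (p + 1) (by omega) (by omega),
      ← Finset.sum_eq_sum_Ico_succ_bot (by omega : p < n)]

lemma W_zero_zero (d : ℕ) : W 0 d = 1 := by
  have : SW 0 d = {fun _ => 0} := by
    ext e
    constructor
    · intro he; funext i; exact he.1.1 i (by omega)
    · rintro rfl
      refine ⟨⟨fun _ _ => rfl, ?_, ?_, ?_, ?_⟩, ?_⟩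
      · intro i hi; omega
      · intro i hi; omega
      · intro i j k _ _ hk; omega
      · intro i j k _ _ hk; omega
      · intro i j _ hk; omega
  simp [W, this]

lemma W_succ_zero (n : ℕ) : W (n + 1) 0 = 0 := by
  have : SW (n + 1) 0 = ∅ := by
    rw [Set.eq_empty_iff_forall_notMem]
    intro e he
    exact absurd (he.1.2.2.1 0 (by omega)) (by omega)
  simp [W, this]

def SW1 (n d : ℕ) : Set (ℕ → ℕ) := {e | e ∈ SW (n + 1) (d + 1) ∧ e n = d}

lemma SW1_card {n d : ℕ} (h : d ≤ n) : (SW1 n d).ncard = W n (d + 1) := by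
  apply ncard_eq_of_inv (app n 0) (app n d)
  · rintro e ⟨⟨hg, hi⟩, hd⟩
    refine ⟨good_trunc hg, ?_⟩
    intro i j hij hj
    have := hi i j hij (by omega)
    simp only [app]; grind
  · rintro e ⟨hg, hi⟩
    refine ⟨⟨good_app hg h (fun i j hij hj _ _ => hi i j hij hj), ?_⟩, by simp [app]⟩
    intro i j hij hj
    have := hi i j hij
    have := hg.2.2.1 i
    simp only [app]; grind
  · intro e he
    exact app_app he.2
  · intro e he
    exact app_app (he.1.1 n le_rfl)

lemma SW1_empty {n d : ℕ} (h : ¬ d ≤ n) : SW1 n d = ∅ := by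
  rw [Set.eq_empty_iff_forall_notMem]
  rintro e ⟨he, hd⟩
  have := he.1.2.1 n (by omega)
  omega

lemma W_rec (n d : ℕ) : W (n + 1) (d + 1) = W (n + 1) d + if d ≤ n then W n (d + 1) else 0 := by
  have e1 : W (n + 1) (d + 1) = (SW (n + 1) d).ncard + (SW1 n d).ncard := by
    apply ncard_split (n := n + 1) (d := d + 1) (fun e he => he.1)
    · ext e
      constructor
      · intro he
        by_cases h : e n = d
        · right; exact ⟨he, h⟩
        · left
          refine ⟨good_of_no he.1 ?_, he.2⟩
          rintro ⟨i, hi, hid⟩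
          have a := he.1.2.2.1 n (by omega)
          have : i ≠ n := by rintro rfl; exact h hid
          have := he.2 i n (by omega) (by omega)
          omega
      · rintro (h | h)
        · exact ⟨good_mono h.1, h.2⟩
        · exact h.1
    · intro e h1 h2
      have a := h1.1.2.2.1 n (by omega)
      have := h2.2
      omega
  rw [e1]
  split_ifs with h
  · rw [SW1_card h]; rfl
  · rw [SW1_empty h]; simp [W]

lemma pat110 {n : ℕ} (e : Fin n → ℕ) : Contains e [1,1,0] ↔
    ∃ i j k : Fin n, i < j ∧ j < k ∧ e i = e j ∧ e k < e i := by
  constructor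
  · rintro ⟨s, hs, h⟩
    refine ⟨s ⟨0, by simp⟩, s ⟨1, by simp⟩, s ⟨2, by simp⟩, hs (by simp), hs (by simp), ?_, ?_⟩
    · exact (h ⟨0, by simp⟩ ⟨1, by simp⟩).2.mp (by simp)
    · exact (h ⟨2, by simp⟩ ⟨0, by simp⟩).1.mp (by simp)
  · rintro ⟨i, j, k, hij, hjk, h1, h2⟩
    refine ⟨![i, j, k], ?_, ?_⟩
    · intro a b hab
      change Fin 3 at a b
      fin_cases a <;> fin_cases b <;> simp_all <;> exact hij.trans hjk
    · intro a b
      change Fin 3 at a b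
      fin_cases a <;> fin_cases b <;> simp <;> omega

lemma pat102 {n : ℕ} (e : Fin n → ℕ) : Contains e [1,0,2] ↔
    ∃ i j k : Fin n, i < j ∧ j < k ∧ e j < e i ∧ e i < e k := by
  constructor
  · rintro ⟨s, hs, h⟩
    refine ⟨s ⟨0, by simp⟩, s ⟨1, by simp⟩, s ⟨2, by simp⟩, hs (by simp), hs (by simp), ?_, ?_⟩
    · exact (h ⟨1, by simp⟩ ⟨0, by simp⟩).1.mp (by simp)
    · exact (h ⟨0, by simp⟩ ⟨2, by simp⟩).1.mp (by simp)
  · rintro ⟨i, j, k, hij, hjk, h1, h2⟩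
    refine ⟨![i, j, k], ?_, ?_⟩
    · intro a b hab
      change Fin 3 at a b
      fin_cases a <;> fin_cases b <;> simp_all <;> exact hij.trans hjk
    · intro a b
      change Fin 3 at a b
      fin_cases a <;> fin_cases b <;> simp <;> omega

lemma card_eq (n N : ℕ) (hN : n ≤ N) :
    Nat.card {e : Fin n → ℕ // InvSeq e ∧ Avoids e [1,1,0] ∧ Avoids e [1,0,2]}
      = W n N + V n N 0 := by
  have e1 : ({e | Good n N e} : Set (ℕ → ℕ)).ncard = (SW n N).ncard + (SV n N 0).ncard := by
    apply ncard_split (n := n) (d := N) (fun e he => he)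
    · ext e
      constructor
      · intro he
        by_cases h : Inc n e
        · left; exact ⟨he, h⟩
        · right; exact ⟨he, fun i j _ hj => absurd hj (by omega), h⟩
      · rintro (h | h)
        · exact h.1
        · exact h.1
    · intro e h1 h2; exact h2.2.2 h1.2
  change _ = (SW n N).ncard + (SV n N 0).ncard
  rw [← e1, ← Nat.card_coe_set_eq]
  refine Nat.card_congr ⟨fun e => ⟨fun i => if h : i < n then e.1 ⟨i, h⟩ else 0, ?_⟩,
    fun e => ⟨fun i => e.1 i, ?_⟩, ?_, ?_⟩
  · obtain ⟨e, h1, h2, h3⟩ := e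
    rw [Avoids, pat110] at h2
    rw [Avoids, pat102] at h3
    refine ⟨?_, ?_, ?_, ?_, ?_⟩
    · intro i hi; simp [not_lt.mpr hi]
    · intro i hi; simpa [hi] using h1 ⟨i, hi⟩
    · intro i hi; have := h1 ⟨i, hi⟩; simp only [hi, dif_pos]; simp at this; omega
    · intro i j k hij hjk hk a b
      have hj : j < n := by omega
      have hi : i < n := by omega
      simp only [hi, hj, hk, dif_pos] at a b
      exact h2 ⟨⟨i, hi⟩, ⟨j, hj⟩, ⟨k, hk⟩, hij, hjk, a, b⟩
    · intro i j k hij hjk hk a b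
      have hj : j < n := by omega
      have hi : i < n := by omega
      simp only [hi, hj, hk, dif_pos] at a b
      exact h3 ⟨⟨i, hi⟩, ⟨j, hj⟩, ⟨k, hk⟩, hij, hjk, a, b⟩
  · obtain ⟨e, h0, h1, h2, h3, h4⟩ := e
    refine ⟨fun i => h1 i i.2, ?_, ?_⟩
    · rw [Avoids, pat110]
      rintro ⟨i, j, k, hij, hjk, a, b⟩
      exact h3 i j k hij hjk k.2 a b
    · rw [Avoids, pat102]
      rintro ⟨i, j, k, hij, hjk, a, b⟩
      exact h4 i j k hij hjk k.2 a b
  · intro e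
    apply Subtype.ext
    funext i
    simp
  · intro e
    apply Subtype.ext
    funext i
    by_cases h : i < n
    · simp [h]
    · simp [h, e.2.1 i (by omega)]


def f (k H : ℕ) : ℕ := Nat.choose (H + 2 * k - 1) (2 * k)

lemma hockey (k r : ℕ) : ∑ h ∈ Finset.range r, f k (h + 1) = Nat.choose (r + 2 * k) (2 * k + 1) := by
  induction r with
  | zero => simp
  | succ r ih =>
    rw [Finset.sum_range_succ, ih, f]
    have : r + 1 + 2 * k = (r + 2 * k) + 1 := by ring
    rw [this, Nat.choose_succ_succ, Nat.add_sub_cancel]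
    ring

lemma sum_f (k d r P : ℕ) (h : r < P) :
    ∑ p ∈ Finset.range P, (if d + 1 ≤ p ∧ p ≤ r then f k (p - d) else 0)
      = Nat.choose (r - d + 2 * k) (2 * k + 1) := by
  rw [← Finset.sum_filter]
  have : (Finset.range P).filter (fun p => d + 1 ≤ p ∧ p ≤ r) = Finset.Ico (d + 1) (r + 1) := by
    ext p; simp only [Finset.mem_filter, Finset.mem_range, Finset.mem_Ico]; omega
  rw [this, Finset.sum_Ico_eq_sum_range, ← hockey]
  have : r + 1 - (d + 1) = r - d := by omega
  rw [this]
  apply Finset.sum_congr rfl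
  intro i _
  congr 1; omega

lemma f_rec (k H : ℕ) : f (k + 1) H = f (k + 1) (H - 1) + Nat.choose (H + 2 * k) (2 * k + 1) := by
  cases H with
  | zero =>
    simp
  | succ H =>
    simp only [f]
    have h1 : H + 1 + 2 * (k + 1) - 1 = (H + 1 + 2 * k) + 1 := by omega
    have h2 : H + 1 - 1 + 2 * (k + 1) - 1 = H + 1 + 2 * k := by omega
    have h3 : 2 * (k + 1) = (2 * k + 1) + 1 := by ring
    rw [h1, h2, h3, Nat.choose_succ_succ]
    ring

lemma f_zero (H : ℕ) : f 0 H = 1 := by simp [f]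
lemma f_succ_zero (k : ℕ) : f (k + 1) 0 = 0 := by
  simp only [f]; apply Nat.choose_eq_zero_of_lt; omega

noncomputable def Phi (P n d : ℕ) : ℕ :=
  ∑ m ∈ Finset.range (n + 1), ∑ p ∈ Finset.range P, U m d p * f (n - m) (p + 1 - d)

noncomputable def Bs (P n d : ℕ) : ℕ :=
  ∑ m ∈ Finset.range (n + 1), ∑ p ∈ Finset.range P, Nw m d p * f (n - m) (p - d)

/-- the transfer identity for one length -/
lemma transfer (P m d k : ℕ) (hP : m < P) :
    ∑ p ∈ Finset.range P, U m d p * f (k + 1) (p + 1 - d) =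
    ∑ p ∈ Finset.range P, U m d p * f (k + 1) (p - d) +
    ∑ p ∈ Finset.range P, (if d + 1 ≤ p ∧ p ≤ m then V m d (p - 1) else 0) * f k (p - d) := by
  have h1 : ∀ p ∈ Finset.range P,
      (if d + 1 ≤ p ∧ p ≤ m then V m d (p - 1) else 0) * f k (p - d) =
      ∑ q ∈ Finset.range P, U m d q * (if d + 1 ≤ p ∧ p ≤ q + 1 then f k (p - d) else 0) := by
    intro p hp
    split_ifs with h
    · rw [V_eq m d (p - 1) (by omega), Finset.sum_mul]
      have : Finset.Ico (p - 1) m = (Finset.range P).filter (fun q => p - 1 ≤ q ∧ q < m) := by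
        ext q; simp only [Finset.mem_filter, Finset.mem_range, Finset.mem_Ico]; omega
      rw [this, Finset.sum_filter]
      apply Finset.sum_congr rfl
      intro q hq
      by_cases hqm : q < m
      · by_cases hpq : p ≤ q + 1
        · rw [if_pos (by omega), if_pos (by omega)]
        · rw [if_neg (by omega), if_neg (by omega)]; simp
      · rw [if_neg (by omega), U_big (by omega)]; simp
    · rw [zero_mul]
      symm
      apply Finset.sum_eq_zero
      intro q hq
      by_cases hqm : q < m
      · rw [if_neg (by omega)]; simp
      · rw [U_big (by omega)]; simp
  rw [Finset.sum_congr rfl h1, Finset.sum_comm, ← Finset.sum_add_distrib]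
  apply Finset.sum_congr rfl
  intro q hq
  by_cases hqm : q < m
  · rw [← Finset.mul_sum, sum_f k d (q + 1) P (by omega), ← mul_add, f_rec]
    have : q + 1 - d - 1 = q - d := by omega
    rw [this]
  · rw [U_big (by omega)]; simp

lemma Phi_succ (P n d : ℕ) (hP : n < P) : Phi P n (d + 1) = Phi P n d + Bs P n d := by
  have e1 : Phi P n (d + 1) =
      ∑ m ∈ Finset.range (n + 1), ∑ p ∈ Finset.range P, U m d p * f (n - m) (p - d) + Bs P n d +
      ∑ m ∈ Finset.range n, ∑ p ∈ Finset.range P,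
        (if d + 1 ≤ p ∧ p ≤ m then V m d (p - 1) else 0) * f (n - (m + 1)) (p - d) := by
    simp only [Phi, Bs]
    rw [Finset.sum_range_succ', Finset.sum_range_succ', Finset.sum_range_succ' (fun m =>
      ∑ p ∈ Finset.range P, Nw m d p * f (n - m) (p - d))]
    simp only [U_big (Nat.zero_le _), Nw_zero, zero_mul, Finset.sum_const_zero, add_zero]
    simp only [← Finset.sum_add_distrib]
    apply Finset.sum_congr rfl
    intro m _
    apply Finset.sum_congr rfl
    intro p _
    rw [U_rec, ← add_mul, ← add_mul]
    have : p + 1 - (d + 1) = p - d := by omega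
    rw [this]
  rw [e1]
  have e2 : Phi P n d =
      ∑ m ∈ Finset.range (n + 1), ∑ p ∈ Finset.range P, U m d p * f (n - m) (p - d) +
      ∑ m ∈ Finset.range n, ∑ p ∈ Finset.range P,
        (if d + 1 ≤ p ∧ p ≤ m then V m d (p - 1) else 0) * f (n - (m + 1)) (p - d) := by
    simp only [Phi]
    rw [Finset.sum_range_succ, Finset.sum_range_succ, Nat.sub_self]
    simp only [f_zero]
    rw [add_right_comm, ← Finset.sum_add_distrib]
    congr 1
    apply Finset.sum_congr rfl
    intro m hm
    rw [Finset.mem_range] at hm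
    obtain ⟨k, hk⟩ : ∃ k, n - m = k + 1 := ⟨n - m - 1, by omega⟩
    have : n - (m + 1) = k := by omega
    rw [hk, this]
    exact transfer P m d k (by omega)
  rw [e2]; ring

lemma Phi_zero (P n : ℕ) : Phi P n 0 = 0 := by
  simp [Phi, U_zero]

lemma Phi_eq (P n M : ℕ) (hP : n < P) : Phi P n M = ∑ d ∈ Finset.range M, Bs P n d := by
  induction M with
  | zero => simp [Phi_zero]
  | succ M ih => rw [Phi_succ P n M hP, ih, Finset.sum_range_succ]

lemma V_eq_Phi (P n M : ℕ) (hP : n < P) (hM : n ≤ M) : V n M 0 = Phi P n M := by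
  rw [V_eq n M 0 (Nat.zero_le _), Phi, Finset.sum_range_succ]
  rw [Finset.sum_eq_zero (s := Finset.range n), zero_add]
  · simp only [Nat.sub_self, f_zero, mul_one]
    apply Finset.sum_subset
    · intro q; simp only [Finset.mem_range, Finset.mem_Ico]; omega
    · intro q _ hq
      apply U_big
      simp only [Finset.mem_Ico] at hq
      omega
  · intro m hm
    rw [Finset.mem_range] at hm
    apply Finset.sum_eq_zero
    intro p _
    by_cases hpm : p < m
    · obtain ⟨k, hk⟩ : ∃ k, n - m = k + 1 := ⟨n - m - 1, by omega⟩
      have : p + 1 - M = 0 := by omega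
      rw [hk, this, f_succ_zero, mul_zero]
    · rw [U_big (by omega), zero_mul]

lemma Bs_succ (P n d : ℕ) (hP : n < P) : Bs P (n + 1) d = Bs P n d +
    ∑ m ∈ Finset.range (n + 1), W m d * Nat.choose (m - d + 2 * (n - m)) (2 * (n - m) + 1) := by
  simp only [Bs]
  rw [Finset.sum_range_succ']
  simp only [Nw_zero, zero_mul, Finset.sum_const_zero, add_zero]
  rw [← Finset.sum_add_distrib]
  apply Finset.sum_congr rfl
  intro m hm
  rw [Finset.mem_range] at hm
  rw [← sum_f (n - m) d m P (by omega), Finset.mul_sum, ← Finset.sum_add_distrib]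
  apply Finset.sum_congr rfl
  intro p _
  have : n + 1 - (m + 1) = n - m := by omega
  rw [Nw_rec, this]
  split_ifs <;> ring

lemma W_closed (m x : ℕ) (h : x ≤ m + 1) :
    W m x + Nat.choose (m + x - 1) (m + 1) = Nat.choose (m + x - 1) m := by
  induction m generalizing x with
  | zero =>
    rw [W_zero_zero]
    interval_cases x <;> simp
  | succ m ihm =>
    induction x with
    | zero =>
      rw [W_succ_zero, Nat.choose_eq_zero_of_lt, Nat.choose_eq_zero_of_lt] <;> omega
    | succ d ihd =>
      have ih := ihd (by omega)
      rw [W_rec]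
      have h1 : m + 1 + (d + 1) - 1 = m + d + 1 := by omega
      have h2 : m + 1 + d - 1 = m + d := by omega
      rw [h1, Nat.choose_succ_succ, Nat.choose_succ_succ]
      rw [h2] at ih
      split_ifs with hd
      · have ih2 := ihm (d + 1) (by omega)
        have h3 : m + (d + 1) - 1 = m + d := by omega
        rw [h3] at ih2
        simp only [Nat.succ_eq_add_one] at *
        omega
      · have : d = m + 1 := by omega
        subst this
        have hs : Nat.choose (m + (m + 1)) (m + 1) = Nat.choose (m + (m + 1)) m :=
          Nat.choose_symm_of_eq_add (by ring)
        simp only [Nat.succ_eq_add_one] at *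
        omega

lemma W_top (m d : ℕ) (h : m + 1 ≤ d) :
    W m d + Nat.choose (2 * m) (m + 1) = Nat.choose (2 * m) m := by
  induction d, h using Nat.le_induction with
  | base =>
    have := W_closed m (m + 1) le_rfl
    have h2 : m + (m + 1) - 1 = 2 * m := by omega
    rwa [h2] at this
  | succ d hd ih =>
    cases m with
    | zero => simp [W_zero_zero]
    | succ m =>
      rw [W_rec, if_neg (by omega)]; exact ih

lemma vander (s a b : ℕ) : ∑ i ∈ Finset.range (s + 1), Nat.choose i a * Nat.choose (s - i) b
    = Nat.choose (s + 1) (a + b + 1) := by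
  induction s generalizing b with
  | zero =>
    by_cases h : a = 0 ∧ b = 0
    · obtain ⟨rfl, rfl⟩ := h
      simp
    · rw [Nat.choose_eq_zero_of_lt (by omega : 0 + 1 < a + b + 1)]
      simp only [zero_add, Finset.sum_range_one, Nat.sub_zero]
      by_cases ha : a = 0
      · rw [Nat.choose_eq_zero_of_lt (by omega : 0 < b), mul_zero]
      · rw [Nat.choose_eq_zero_of_lt (by omega : 0 < a), zero_mul]
  | succ s ih =>
    cases b with
    | zero =>
      have := ih 0
      simp only [Nat.choose_zero_right, mul_one, add_zero] at *
      rw [Finset.sum_range_succ, this, Nat.choose_succ_succ (s + 1)]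
      ring
    | succ b =>
      rw [Finset.sum_range_succ, Nat.sub_self, Nat.choose_zero_succ, mul_zero, add_zero]
      have e : a + (b + 1) + 1 = (a + b + 1) + 1 := by ring
      have ih2 := ih (b + 1)
      rw [e] at ih2 ⊢
      rw [Nat.choose_succ_succ (s + 1), ← ih b, Nat.succ_eq_add_one, ← ih2,
        ← Finset.sum_add_distrib]
      apply Finset.sum_congr rfl
      intro i hi
      rw [Finset.mem_range] at hi
      have : s + 1 - i = (s - i) + 1 := by omega
      rw [this, Nat.choose_succ_succ]
      ring

lemma vander' (m k a : ℕ) (ha : m + 1 ≤ a) :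
    ∑ i ∈ Finset.range (m + 1), Nat.choose (m + 1 + i) a * Nat.choose (m - i + 2 * k) (2 * k + 1)
    = Nat.choose (2 * (m + 1 + k)) (a + 2 * k + 2) := by
  have h := vander (2 * m + 2 * k + 1) a (2 * k + 1)
  have e1 : 2 * m + 2 * k + 1 + 1 = (m + 1) + ((m + 1) + 2 * k) := by ring
  have e2 : 2 * (m + 1 + k) = (m + 1) + ((m + 1) + 2 * k) := by ring
  have e3 : a + 2 * k + 2 = a + (2 * k + 1) + 1 := by ring
  rw [e2, e3, ← e1, ← h, e1, Finset.sum_range_add _ (m + 1) (m + 1 + 2 * k),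
    Finset.sum_range_add _ (m + 1) (2 * k)]
  rw [Finset.sum_eq_zero (s := Finset.range (m + 1)) (f := fun x => Nat.choose x a * _), zero_add, Finset.sum_eq_zero (s := Finset.range (2 * k)), add_zero]
  · apply Finset.sum_congr rfl
    intro i hi
    rw [Finset.mem_range] at hi
    congr 2; omega
  · intro i hi
    rw [Nat.choose_eq_zero_of_lt (n := 2 * m + 2 * k + 1 - (m + 1 + (m + 1 + i))), mul_zero]
    omega
  · intro i hi
    rw [Finset.mem_range] at hi
    rw [Nat.choose_eq_zero_of_lt (n := i), zero_mul]
    omega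

lemma T_sum (M m k : ℕ) (hM : m < M) :
    ∑ d ∈ Finset.range M, W m d * Nat.choose (m - d + 2 * k) (2 * k + 1)
      + Nat.choose (2 * (m + k)) (m + 2 * k + 3) = Nat.choose (2 * (m + k)) (m + 2 * k + 2) := by
  have h1 : ∑ d ∈ Finset.range M, W m d * Nat.choose (m - d + 2 * k) (2 * k + 1) =
      ∑ d ∈ Finset.range (m + 1), W m d * Nat.choose (m - d + 2 * k) (2 * k + 1) := by
    symm
    apply Finset.sum_subset
    · intro q; simp only [Finset.mem_range]; omega
    · intro q _ hq
      rw [Finset.mem_range] at hq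
      rw [Nat.choose_eq_zero_of_lt, mul_zero]
      omega
  rw [h1]
  cases m with
  | zero =>
    simp only [zero_add, Finset.sum_range_one]
    rw [Nat.choose_eq_zero_of_lt, Nat.choose_eq_zero_of_lt, Nat.choose_eq_zero_of_lt] <;> omega
  | succ m =>
    rw [Finset.sum_range_succ', W_succ_zero, zero_mul, add_zero]
    have v1 := vander' m k (m + 1) le_rfl
    have v2 := vander' m k (m + 2) (by omega)
    have e : m + 2 + 2 * k + 2 = m + 1 + 2 * k + 3 := by ring
    rw [e] at v2
    rw [← v1, ← v2, ← Finset.sum_add_distrib]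
    apply Finset.sum_congr rfl
    intro i hi
    rw [Finset.mem_range] at hi
    have w := W_closed (m + 1) (i + 1) (by omega)
    have e2 : m + 1 + (i + 1) - 1 = m + 1 + i := by omega
    have e3 : m + 1 - (i + 1) = m - i := by omega
    rw [e2] at w
    rw [e3, ← add_mul, w]

lemma E_sum (M n : ℕ) (hM : n < M) :
    ∑ d ∈ Finset.range M, ∑ m ∈ Finset.range (n + 1),
      W m d * Nat.choose (m - d + 2 * (n - m)) (2 * (n - m) + 1) = Nat.choose (2 * n) (n + 2) := by
  rw [Finset.sum_comm, ← Finset.sum_range_reflect]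
  have key : ∀ r, r ≤ n + 1 → ∑ j ∈ Finset.range r, ∑ d ∈ Finset.range M,
      W (n + 1 - 1 - j) d * Nat.choose (n + 1 - 1 - j - d + 2 * (n - (n + 1 - 1 - j)))
        (2 * (n - (n + 1 - 1 - j)) + 1) + Nat.choose (2 * n) (n + 2 + r)
      = Nat.choose (2 * n) (n + 2) := by
    intro r hr
    induction r with
    | zero => simp
    | succ r ih =>
      have ih := ih (by omega)
      rw [Finset.sum_range_succ]
      have h1 : n - (n + 1 - 1 - r) = r := by omega
      have t := T_sum M (n + 1 - 1 - r) r (by omega)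
      have h2 : n + 1 - 1 - r + r = n := by omega
      have h3 : n + 1 - 1 - r + 2 * r + 3 = n + 2 + (r + 1) := by omega
      have h4 : n + 1 - 1 - r + 2 * r + 2 = n + 2 + r := by omega
      rw [h2, h3, h4] at t
      rw [h1]
      omega
  have := key (n + 1) le_rfl
  rw [Nat.choose_eq_zero_of_lt (by omega : 2 * n < n + 2 + (n + 1)), add_zero] at this
  exact this

noncomputable def tot (n : ℕ) : ℕ :=
  Nat.card {e : Fin n → ℕ // InvSeq e ∧ Avoids e [1,1,0] ∧ Avoids e [1,0,2]}

lemma tot_eq (P M n : ℕ) (hP : n < P) (hM : n ≤ M) :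
    tot n = W n M + ∑ d ∈ Finset.range M, Bs P n d := by
  rw [tot, card_eq n M hM, V_eq_Phi P n M hP hM, Phi_eq P n M hP]

lemma tot_diff (n : ℕ) (hn : 1 ≤ n) : tot (n + 1) = tot n + Nat.choose (2 * n) (n - 1) := by
  rw [tot_eq (n + 2) (n + 2) n (by omega) (by omega),
    tot_eq (n + 2) (n + 2) (n + 1) (by omega) (by omega)]
  have e := E_sum (n + 2) n (by omega)
  have w1 := W_top n (n + 2) (by omega)
  have w2 := W_top (n + 1) (n + 2) (by omega)
  have hB : ∑ d ∈ Finset.range (n + 2), Bs (n + 2) (n + 1) d =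
      ∑ d ∈ Finset.range (n + 2), Bs (n + 2) n d + Nat.choose (2 * n) (n + 2) := by
    rw [← e, ← Finset.sum_add_distrib]
    apply Finset.sum_congr rfl
    intro d _
    exact Bs_succ (n + 2) n d (by omega)
  rw [hB]
  obtain ⟨k, rfl⟩ : ∃ k, n = k + 1 := ⟨n - 1, by omega⟩
  have hs : Nat.choose (2 * (k + 1)) (k + 1 + 1) = Nat.choose (2 * (k + 1)) k :=
    Nat.choose_symm_of_eq_add (by ring)
  have h2 : 2 * (k + 1 + 1) = 2 * (k + 1) + 1 + 1 := by ring
  rw [h2] at w2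
  simp only [Nat.choose_succ_succ (2 * (k + 1) + 1), Nat.succ_eq_add_one] at w2
  rw [Nat.choose_succ_succ (2 * (k + 1)) k, Nat.choose_succ_succ (2 * (k + 1)) (k + 1),
    Nat.choose_succ_succ (2 * (k + 1)) (k + 1 + 1)] at w2
  have h5 : Nat.choose (2 * (k + 1)) (k + 1 + 2) = Nat.choose (2 * (k + 1)) (k + 2 + 1) := rfl
  have h6 : k + 1 - 1 = k := rfl
  rw [h5, h6]
  simp only [Nat.succ_eq_add_one] at w2
  clear e hB h5 h6 h2
  omega

lemma tot_one : tot 1 = 1 := by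
  rw [tot_eq 2 2 1 (by omega) (by omega)]
  have w := W_top 1 2 (by omega)
  have : ∀ d, Bs 2 1 d = 0 := by
    intro d
    rw [Bs_succ 2 0 d (by omega)]
    simp [Bs, Nw_zero]
  simp only [this]
  simp at w ⊢
  omega

end S11

theorem stmt_11 (n : ℕ) (hn : 1 ≤ n) :
    Nat.card {e : Fin n → ℕ // InvSeq e ∧ Avoids e [1,1,0] ∧ Avoids e [1,0,2]}
      = 1 + ∑ i ∈ Finset.Icc 1 (n - 1), Nat.choose (2 * i) (i - 1) := by
  change S11.tot n = _
  induction n, hn using Nat.le_induction with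
  | base => simp [S11.tot_one]
  | succ n hn ih =>
    rw [S11.tot_diff n hn, ih]
    obtain ⟨k, rfl⟩ : ∃ k, n = k + 1 := ⟨n - 1, by omega⟩
    simp only [Nat.add_sub_cancel]
    rw [Finset.sum_Icc_succ_top (by omega : 1 ≤ k + 1), Nat.add_sub_cancel]
    ring
end

section
/- For every integer n ≥ 1, the number of inversion sequences of length n avoiding both patterns 120 and 102 equals 1 + ∑_{i=1}^{n−1} binom(2i, i−1), i.e. |I_n(120,102)| = 1 + ∑_{i=1}^{n−1} binom(2i, i−1). -/
/-- Every entry is a weak minimum or a weak maximum of the suffix it starts. -/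
def MinMax {m : ℕ} (e : Fin m → ℕ) : Prop :=
  ∀ i, (∀ j, i < j → e i ≤ e j) ∨ (∀ j, i < j → e j ≤ e i)

/-- Words with growing upper bound. -/
def NSet (lo d m : ℕ) : Set (Fin m → ℕ) :=
  {e | (∀ i, lo ≤ e i ∧ e i < lo + d + (i : ℕ)) ∧ MinMax e}

/-- Words with fixed upper bound. -/
def FSet (lo k m : ℕ) : Set (Fin m → ℕ) :=
  {e | (∀ i, lo ≤ e i ∧ e i < lo + k) ∧ MinMax e}

lemma NSet_finite (lo d m : ℕ) : (NSet lo d m).Finite := by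
  apply (Set.finite_Iic (fun _ : Fin m => lo + d + m)).subset
  intro e he i
  have := (he.1 i).2
  have := i.2
  simp only
  omega

lemma FSet_finite (lo d m : ℕ) : (FSet lo d m).Finite := by
  apply (Set.finite_Iic (fun _ : Fin m => lo + d + m)).subset
  intro e he i
  have := (he.1 i).2
  have := i.2
  simp only
  omega

lemma minMax_cons {m : ℕ} (c : ℕ) (t : Fin m → ℕ) :
    MinMax (Fin.cons c t : Fin (m+1) → ℕ) ↔
      ((∀ i, c ≤ t i) ∨ (∀ i, t i ≤ c)) ∧ MinMax t := by
  simp [MinMax, Fin.forall_fin_succ]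

lemma ncard_cons {m : ℕ} (A : Set (Fin (m+1) → ℕ)) (hA : A.Finite) (lo d : ℕ)
    (h : ∀ e ∈ A, lo ≤ e 0 ∧ e 0 < lo + d) :
    A.ncard = ∑ c ∈ Finset.range d, {t : Fin m → ℕ | (Fin.cons (lo + c) t : Fin (m+1) → ℕ) ∈ A}.ncard := by
  classical
  rw [Set.ncard_eq_toFinset_card A hA]
  rw [Finset.card_eq_sum_card_fiberwise (f := fun e => e 0 - lo) (t := Finset.range d)]
  · apply Finset.sum_congr rfl
    intro c _
    rw [← Set.ncard_coe_finset]
    have hinj : Function.Injective (fun t : Fin m → ℕ => (Fin.cons (lo + c) t : Fin (m+1) → ℕ)) :=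
      fun a b hab => (Fin.cons_inj.1 hab).2
    rw [← Set.ncard_image_of_injective _ hinj]
    congr 1
    ext e
    simp only [Finset.coe_filter, Set.Finite.mem_toFinset, Set.mem_ofPred_eq, Set.mem_image]
    constructor
    · rintro ⟨he, h0⟩
      have := h e he
      have h1 : lo + c = e 0 := by omega
      refine ⟨Fin.tail e, ?_, ?_⟩
      · rw [h1, Fin.cons_self_tail]; exact he
      · rw [h1, Fin.cons_self_tail]
    · rintro ⟨t, ht, rfl⟩
      exact ⟨ht, by simp⟩
  · intro e he
    have := h e (by simpa using he)
    simp only [Finset.coe_range, Set.mem_Iio]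
    omega

lemma const_ncard (c m : ℕ) : ({fun _ => c} : Set (Fin m → ℕ)).ncard = 1 := Set.ncard_singleton _

lemma NSet_succ (lo d m : ℕ) :
    ((NSet lo d (m+1)).ncard : ℤ) = ∑ c ∈ Finset.range d,
      (((NSet (lo + c) (d + 1 - c) m).ncard : ℤ) + (FSet lo (c + 1) m).ncard - 1) := by
  rw [ncard_cons _ (NSet_finite _ _ _) lo d (fun e he => by simpa using he.1 0)]
  push_cast
  apply Finset.sum_congr rfl
  intro c hc
  have hc := Finset.mem_range.1 hc
  have hu : {t : Fin m → ℕ | (Fin.cons (lo + c) t : Fin (m+1) → ℕ) ∈ NSet lo d (m+1)}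
      = NSet (lo + c) (d + 1 - c) m ∪ FSet lo (c + 1) m := by
    ext t
    simp only [NSet, FSet, Set.mem_ofPred_eq, Set.mem_union, minMax_cons, Fin.forall_fin_succ,
      Fin.cons_zero, Fin.cons_succ, Fin.val_zero, Fin.val_succ]
    constructor
    · rintro ⟨⟨h0, h1⟩, h2 | h2, h3⟩
      · left; refine ⟨fun i => ?_, h3⟩
        have := h1 i; have := h2 i; omega
      · right; refine ⟨fun i => ?_, h3⟩
        have := h1 i; have := h2 i; omega
    · rintro (⟨h1, h3⟩ | ⟨h1, h3⟩)
      · refine ⟨⟨by omega, fun i => ?_⟩, Or.inl fun i => ?_, h3⟩ <;> have := h1 i <;> omega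
      · refine ⟨⟨by omega, fun i => ?_⟩, Or.inr fun i => ?_, h3⟩ <;> have := h1 i <;> omega
  have hi : NSet (lo + c) (d + 1 - c) m ∩ FSet lo (c + 1) m = {fun _ => lo + c} := by
    ext t
    simp only [NSet, FSet, Set.mem_ofPred_eq, Set.mem_inter_iff, Set.mem_singleton_iff]
    constructor
    · rintro ⟨⟨h1, _⟩, h2, _⟩
      funext i
      have := h1 i; have := h2 i; omega
    · rintro rfl
      have : MinMax (fun _ : Fin m => lo + c) := fun i => Or.inl fun _ _ => le_rfl
      exact ⟨⟨fun i => by simp only; omega, this⟩, fun i => by simp only; omega, this⟩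
  have := Set.ncard_union_add_ncard_inter (NSet (lo + c) (d + 1 - c) m) (FSet lo (c + 1) m)
    (NSet_finite _ _ _) (FSet_finite _ _ _)
  rw [hi, const_ncard] at this
  rw [hu]
  omega

lemma FSet_succ (lo d m : ℕ) :
    ((FSet lo d (m+1)).ncard : ℤ) = ∑ c ∈ Finset.range d,
      (((FSet (lo + c) (d - c) m).ncard : ℤ) + (FSet lo (c + 1) m).ncard - 1) := by
  rw [ncard_cons _ (FSet_finite _ _ _) lo d (fun e he => by simpa using he.1 0)]
  push_cast
  apply Finset.sum_congr rfl
  intro c hc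
  have hc := Finset.mem_range.1 hc
  have hu : {t : Fin m → ℕ | (Fin.cons (lo + c) t : Fin (m+1) → ℕ) ∈ FSet lo d (m+1)}
      = FSet (lo + c) (d - c) m ∪ FSet lo (c + 1) m := by
    ext t
    simp only [FSet, Set.mem_ofPred_eq, Set.mem_union, minMax_cons, Fin.forall_fin_succ,
      Fin.cons_zero, Fin.cons_succ]
    constructor
    · rintro ⟨⟨h0, h1⟩, h2 | h2, h3⟩
      · left; refine ⟨fun i => ?_, h3⟩
        have := h1 i; have := h2 i; omega
      · right; refine ⟨fun i => ?_, h3⟩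
        have := h1 i; have := h2 i; omega
    · rintro (⟨h1, h3⟩ | ⟨h1, h3⟩)
      · refine ⟨⟨by omega, fun i => ?_⟩, Or.inl fun i => ?_, h3⟩ <;> have := h1 i <;> omega
      · refine ⟨⟨by omega, fun i => ?_⟩, Or.inr fun i => ?_, h3⟩ <;> have := h1 i <;> omega
  have hi : FSet (lo + c) (d - c) m ∩ FSet lo (c + 1) m = {fun _ => lo + c} := by
    ext t
    simp only [FSet, Set.mem_ofPred_eq, Set.mem_inter_iff, Set.mem_singleton_iff]
    constructor
    · rintro ⟨⟨h1, _⟩, h2, _⟩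
      funext i
      have := h1 i; have := h2 i; omega
    · rintro rfl
      have : MinMax (fun _ : Fin m => lo + c) := fun i => Or.inl fun _ _ => le_rfl
      exact ⟨⟨fun i => by simp only; omega, this⟩, fun i => by simp only; omega, this⟩
  have := Set.ncard_union_add_ncard_inter (FSet (lo + c) (d - c) m) (FSet lo (c + 1) m)
    (FSet_finite _ _ _) (FSet_finite _ _ _)
  rw [hi, const_ncard] at this
  rw [hu]
  omega

/-- Number of words with fixed bound. -/
def Fz : ℕ → ℕ → ℤ
  | 0, _ => 1
  | m+1, k => ∑ c ∈ Finset.range k, (2 * Fz m (c+1) - 1)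

/-- Number of words with growing bound. -/
def Nz : ℕ → ℕ → ℤ
  | 0, _ => 1
  | m+1, d => ∑ c ∈ Finset.range d, (Nz m (c+2) + Fz m (c+1) - 1)

lemma reflect (f : ℕ → ℤ) (d s : ℕ) :
    ∑ c ∈ Finset.range d, f (d + s - c) = ∑ c ∈ Finset.range d, f (c + 1 + s) := by
  rw [← Finset.sum_range_reflect]
  apply Finset.sum_congr rfl
  intro c hc
  have hc := Finset.mem_range.1 hc
  congr 1
  omega

lemma FSet_card (m : ℕ) : ∀ lo k, ((FSet lo k m).ncard : ℤ) = Fz m k := by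
  induction m with
  | zero =>
    intro lo k
    have : FSet lo k 0 = {fun _ => 0} := by
      ext t
      simp [FSet, MinMax, Subsingleton.elim t (fun _ => 0)]
    rw [this, const_ncard]; simp [Fz]
  | succ m ih =>
    intro lo k
    rw [FSet_succ, Fz]
    simp only [ih]
    have := reflect (Fz m) k 0
    simp only [Nat.add_zero] at this
    simp only [Finset.sum_sub_distrib, Finset.sum_add_distrib, this, ← Finset.mul_sum]
    ring

lemma NSet_card (m : ℕ) : ∀ lo k, ((NSet lo k m).ncard : ℤ) = Nz m k := by
  induction m with
  | zero =>
    intro lo k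
    have : NSet lo k 0 = {fun _ => 0} := by
      ext t
      simp [NSet, MinMax, Subsingleton.elim t (fun _ => 0)]
    rw [this, const_ncard]; simp [Nz]
  | succ m ih =>
    intro lo k
    rw [NSet_succ, Nz]
    simp only [ih, FSet_card]
    have := reflect (Nz m) k 1
    simp only [Finset.sum_sub_distrib, Finset.sum_add_distrib, this]

lemma Fz_succ (m k : ℕ) : Fz (m+1) (k+1) = Fz (m+1) k + 2 * Fz m (k+1) - 1 := by
  simp only [Fz, Finset.sum_range_succ]; ring

lemma Nz_succ (m d : ℕ) : Nz (m+1) (d+1) = Nz (m+1) d + Nz m (d+2) + Fz m (d+1) - 1 := by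
  simp only [Nz, Finset.sum_range_succ]; ring

lemma Fz_one (m : ℕ) : Fz m 1 = 1 := by
  induction m with
  | zero => rfl
  | succ m ih => simp [Fz, ih]

lemma Nz_zero (m : ℕ) : Nz (m+1) 0 = 0 := by simp [Nz]

/-- Auxiliary partial binomial sums. -/
def Sz (d n : ℕ) : ℤ := ∑ k ∈ Finset.range (n+1), ((2*n+d+1).choose k : ℤ)

lemma Sz_zero (n : ℕ) : Sz 0 n = 4^n := by
  have := Nat.sum_range_choose_halfway n
  unfold Sz
  exact_mod_cast this

lemma pascal_sum (N n : ℕ) : ∑ k ∈ Finset.range (n+2), ((N+1).choose k : ℤ)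
    = ∑ k ∈ Finset.range (n+2), (N.choose k : ℤ) + ∑ k ∈ Finset.range (n+1), (N.choose k : ℤ) := by
  rw [Finset.sum_range_succ', Finset.sum_range_succ' (fun k => (N.choose k : ℤ))]
  simp only [Nat.choose_succ_succ, Nat.cast_add, Finset.sum_add_distrib]
  simp
  ring

lemma Sz_succ (d n : ℕ) : Sz (d+1) (n+1) = Sz d (n+1) + Sz (d+2) n := by
  unfold Sz
  have := pascal_sum (2*(n+1)+d+1) n
  rw [show 2*n+(d+2)+1 = 2*(n+1)+d+1 by ring]
  exact this

lemma Sz_one (n : ℕ) : 2 * Sz 1 n + ((2*n+2).choose (n+1) : ℤ) = 4^(n+1) := by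
  rw [← Sz_zero]
  unfold Sz
  have := pascal_sum (2*n+2) n
  rw [show 2*(n+1)+0+1 = 2*n+2+1 by ring, show 2*n+1+1 = 2*n+2 by ring, this,
    Finset.sum_range_succ _ (n+1)]
  ring

/-- Auxiliary array, `Qz d m` is the coefficient of index `(d+1, m)`. -/
def Qz : ℕ → ℕ → ℤ
  | _, 0 => 1
  | 0, m+1 => 2 * 4^m
  | d+1, m+1 => Qz d (m+1) + 2 * Qz (d+1) m

lemma Qz_zero (m : ℕ) : Qz 0 (m+1) = 2 * 4^m := by simp [Qz]
lemma Qz_succ (d m : ℕ) : Qz (d+1) (m+1) = Qz d (m+1) + 2 * Qz (d+1) m := by simp [Qz]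
lemma Qz_z (d : ℕ) : Qz d 0 = 1 := by cases d <;> simp [Qz]

lemma Qz_one (m : ℕ) : Qz 1 m = 4^m := by
  induction m with
  | zero => simp [Qz]
  | succ m ih => rw [Qz_succ, Qz_zero, ih]; ring

lemma Qz_m_one (d : ℕ) : Qz d 1 = 2 * d + 2 := by
  induction d with
  | zero => simp [Qz]
  | succ d ih => rw [Qz_succ, ih, Qz_z]; push_cast; ring

lemma Fz_m_one (d : ℕ) : Fz 1 d = d := by simp [Fz]
lemma Nz_m_one (d : ℕ) : Nz 1 d = d := by simp [Nz, Fz]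

lemma QF (m : ℕ) : ∀ d, 2 * Qz d (m+1) = Qz (d+1) (m+1) + 2 * (Fz (m+1) (d+1) - Fz m (d+1)) := by
  induction m with
  | zero =>
    intro d
    rw [Qz_m_one, Qz_m_one, Fz_m_one]; simp [Fz]; ring
  | succ m ih =>
    intro d
    induction d with
    | zero => rw [Qz_zero, Qz_one, Fz_one, Fz_one]; ring
    | succ d ihd =>
      have h := ih (d+1)
      have f1 := Fz_succ (m+1) (d+1)
      have f2 := Fz_succ m (d+1)
      have q1 := Qz_succ d (m+1)
      have q2 := Qz_succ (d+1) (m+1)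
      linarith

lemma main_diff (m : ℕ) : ∀ d, 2 * (Nz (m+2) (d+1) - Nz (m+1) (d+1))
    = Qz d (m+2) - 2 * (Sz (d+1) (m+1) - 2 * Sz (d+1) m) := by
  induction m with
  | zero =>
    intro d
    induction d with
    | zero =>
      rw [Nz_succ 1, Nz_zero, Nz_m_one, Nz_m_one, Fz_one, Qz_zero]
      simp [Sz, Finset.sum_range_succ]
    | succ d ih =>
      have h := QF 0 (d+1)
      rw [Nz_succ 1, Nz_succ 0 (d+1), Qz_succ, Sz_succ (d+1) 0]
      have e1 : Nz 1 (d+1+2) = d + 3 := by rw [Nz_m_one]; push_cast; ring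
      have e2 : Nz 0 (d+1+2) = 1 := rfl
      have e3 : Sz (d+1+2) 0 = 1 := by simp [Sz]
      have e4 : Sz (d+1+1) 0 = 1 := by simp [Sz]
      have e5 : Sz (d+1) 0 = 1 := by simp [Sz]
      have e6 : Qz (d+1) 1 = 2*d+4 := by rw [Qz_m_one]; push_cast; ring
      have e7 : Qz (d+1+1) 1 = 2*d+6 := by rw [Qz_m_one]; push_cast; ring
      simp only [Nat.zero_add, Nat.reduceAdd] at *
      linarith
  | succ m ihm =>
    intro d
    induction d with
    | zero =>
      have h := ihm 1
      rw [Nz_succ (m+2), Nz_succ (m+1) 0, Nz_zero, Nz_zero, Fz_one, Fz_one, Qz_zero]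
      rw [Qz_one] at h
      have s1 := Sz_succ 0 (m+1)
      have s2 := Sz_succ 0 m
      rw [Sz_zero] at s1 s2
      simp only [Nat.zero_add, Nat.reduceAdd] at *
      rw [s1, s2]
      have p1 : (4:ℤ)^(m+1+1) = 16 * 4^m := by ring
      have p2 : (4:ℤ)^(m+2) = 16 * 4^m := by ring
      have p3 : (4:ℤ)^(m+1) = 4 * 4^m := by ring
      rw [p1, p3]; rw [p2] at h
      linarith
    | succ d ih =>
      have h := QF (m+1) (d+1)
      have h2 := ihm (d+2)
      rw [Nz_succ (m+2), Nz_succ (m+1) (d+1), Qz_succ, Sz_succ (d+1) (m+1), Sz_succ (d+1) m]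
      simp only [Nat.add_assoc, Nat.reduceAdd] at *
      linarith

lemma Nz_final (m : ℕ) : Nz (m+2) 1 = Nz (m+1) 1 + ((2*(m+1)).choose m : ℤ) := by
  have h := main_diff m 0
  rw [Qz_zero] at h
  have s1 := Sz_one (m+1)
  have s2 := Sz_one m
  have c : ((2*(m+1)+2).choose (m+1+1) : ℤ) = 2 * ((2*m+2).choose m) + 2 * ((2*m+2).choose (m+1)) := by
    have e1 : (2*(m+1)+2).choose (m+1+1) = (2*m+2).choose m + (2*m+2).choose (m+1)
        + ((2*m+2).choose (m+1) + (2*m+2).choose (m+2)) := by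
      rw [show 2*(m+1)+2 = (2*m+2)+1+1 by ring, Nat.choose_succ_succ, Nat.choose_succ_succ _ m,
        Nat.choose_succ_succ _ (m+1)]
    have e2 : (2*m+2).choose (m+2) = (2*m+2).choose m := by
      apply Nat.choose_symm_of_eq_add; ring
    rw [e1, e2]; push_cast; ring
  rw [c] at s1
  rw [show 2*(m+1) = 2*m+2 by ring]
  simp only [Nat.zero_add] at h
  have p1 : (4:ℤ)^(m+1+1) = 16 * 4^m := by ring
  have p3 : (4:ℤ)^(m+1) = 4 * 4^m := by ring
  rw [p1] at s1; rw [p3] at s2 h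
  linarith

lemma contains_three {n : ℕ} (e : Fin n → ℕ) (p : List ℕ) (hp : p.length = 3) (i j k : Fin n)
    (hij : i < j) (hjk : j < k)
    (h : ∀ a b : Fin 3, (p.get (a.cast hp.symm) < p.get (b.cast hp.symm) ↔ e (![i,j,k] a) < e (![i,j,k] b)) ∧
      (p.get (a.cast hp.symm) = p.get (b.cast hp.symm) ↔ e (![i,j,k] a) = e (![i,j,k] b))) :
    Contains e p := by
  refine ⟨fun a => ![i,j,k] (a.cast hp), ?_, fun a b => by simpa using h (a.cast hp) (b.cast hp)⟩
  have hs : StrictMono ![i,j,k] := by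
    intro a b hab
    fin_cases a <;> fin_cases b <;> simp at hab ⊢ <;> first | assumption | exact hij.trans hjk
  intro a b hab
  exact hs hab

lemma set_eq (n : ℕ) (e : Fin n → ℕ) :
    (InvSeq e ∧ Avoids e [1,2,0] ∧ Avoids e [1,0,2]) ↔ e ∈ NSet 0 1 n := by
  have hb : InvSeq e ↔ (∀ i, 0 ≤ e i ∧ e i < 0 + 1 + (i : ℕ)) := by
    unfold InvSeq
    apply forall_congr'
    intro i; omega
  show _ ↔ _ ∧ _
  rw [hb]
  apply and_congr_right
  intro _
  constructor
  · rintro ⟨h1, h2⟩ i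
    by_contra hcon
    push Not at hcon
    obtain ⟨⟨j, hij, hj⟩, k, hik, hk⟩ := hcon
    rcases lt_trichotomy j k with hjk | rfl | hjk
    · apply h2
      apply contains_three e _ rfl i j k hij hjk
      intro a b
      fin_cases a <;> fin_cases b <;> simp <;> omega
    · omega
    · apply h1
      apply contains_three e _ rfl i k j hik hjk
      intro a b
      fin_cases a <;> fin_cases b <;> simp <;> omega
  · intro h
    constructor
    · rintro ⟨s, hs, hp⟩
      have a1 := hs (show (0 : Fin 3) < 1 by decide)
      have a2 := hs (show (0 : Fin 3) < 2 by decide)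
      have b1 := (hp (0 : Fin 3) (1 : Fin 3)).1.1 (by simp)
      have b2 := (hp (2 : Fin 3) (0 : Fin 3)).1.1 (by simp)
      rcases h (s (0 : Fin 3)) with h | h
      · exact absurd (h _ a2) (by omega)
      · exact absurd (h _ a1) (by omega)
    · rintro ⟨s, hs, hp⟩
      have a1 := hs (show (0 : Fin 3) < 1 by decide)
      have a2 := hs (show (0 : Fin 3) < 2 by decide)
      have b1 := (hp (1 : Fin 3) (0 : Fin 3)).1.1 (by simp)
      have b2 := (hp (0 : Fin 3) (2 : Fin 3)).1.1 (by simp)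
      rcases h (s (0 : Fin 3)) with h | h
      · exact absurd (h _ a1) (by omega)
      · exact absurd (h _ a2) (by omega)

theorem stmt_12 (n : ℕ) (hn : 1 ≤ n) :
    Nat.card {e : Fin n → ℕ // InvSeq e ∧ Avoids e [1,2,0] ∧ Avoids e [1,0,2]}
      = 1 + ∑ i ∈ Finset.Icc 1 (n - 1), Nat.choose (2 * i) (i - 1) := by
  have h1 : Nat.card {e : Fin n → ℕ // InvSeq e ∧ Avoids e [1,2,0] ∧ Avoids e [1,0,2]}
      = (NSet 0 1 n).ncard := by
    rw [← Nat.card_coe_set_eq]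
    exact Nat.card_congr (Equiv.subtypeEquivRight (set_eq n))
  rw [h1]
  have h2 := NSet_card n 0 1
  obtain ⟨m, rfl⟩ : ∃ m, n = m + 1 := ⟨n - 1, by omega⟩
  have h3 : ∀ m : ℕ, Nz (m+1) 1 =
      ((1 + ∑ i ∈ Finset.Icc 1 m, Nat.choose (2 * i) (i - 1) : ℕ) : ℤ) := by
    intro m
    induction m with
    | zero => simp [Nz_m_one]
    | succ m ih =>
      rw [Nz_final, ih, Finset.sum_Icc_succ_top (by omega)]
      push_cast
      ring
  rw [h3] at h2
  exact_mod_cast h2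
end

section
/- For every integer n ≥ 1, the number of inversion sequences of length n avoiding both patterns 101 and 021 equals the number of inversion sequences of length n avoiding both patterns 101 and 102, i.e. |I_n(101,021)| = |I_n(101,102)|. -/
/-! Both classes are grown by generating trees; the trees are matched by reversing lattice paths. -/

theorem contains_101 {n : ℕ} (e : Fin n → ℕ) : Contains e [1,0,1] ↔
    ∃ i j k : Fin n, i < j ∧ j < k ∧ e j < e i ∧ e i = e k := by
  constructor
  · rintro ⟨s, hs, h⟩
    refine ⟨s (0 : Fin 3), s (1 : Fin 3), s (2 : Fin 3), hs (by decide), hs (by decide), ?_, ?_⟩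
    · exact (h (1 : Fin 3) (0 : Fin 3)).1.1 (by decide)
    · exact (h (0 : Fin 3) (2 : Fin 3)).2.1 (by decide)
  · rintro ⟨i, j, k, hij, hjk, h1, h2⟩
    refine ⟨(![i, j, k] : Fin 3 → Fin n), ?_, ?_⟩
    · intro a b hab
      change Fin 3 at a b
      fin_cases a <;> fin_cases b <;> simp at hab ⊢ <;> first | exact absurd hab (by decide) | grind
    · intro a b
      change Fin 3 at a b
      fin_cases a <;> fin_cases b <;> simp <;> omega

theorem contains_021 {n : ℕ} (e : Fin n → ℕ) : Contains e [0,2,1] ↔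
    ∃ i j k : Fin n, i < j ∧ j < k ∧ e i < e k ∧ e k < e j := by
  constructor
  · rintro ⟨s, hs, h⟩
    refine ⟨s (0 : Fin 3), s (1 : Fin 3), s (2 : Fin 3), hs (by decide), hs (by decide), ?_, ?_⟩
    · exact (h (0 : Fin 3) (2 : Fin 3)).1.1 (by decide)
    · exact (h (2 : Fin 3) (1 : Fin 3)).1.1 (by decide)
  · rintro ⟨i, j, k, hij, hjk, h1, h2⟩
    refine ⟨(![i, j, k] : Fin 3 → Fin n), ?_, ?_⟩
    · intro a b hab
      change Fin 3 at a b
      fin_cases a <;> fin_cases b <;> simp at hab ⊢ <;> first | exact absurd hab (by decide) | grind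
    · intro a b
      change Fin 3 at a b
      fin_cases a <;> fin_cases b <;> simp <;> omega

theorem contains_102 {n : ℕ} (e : Fin n → ℕ) : Contains e [1,0,2] ↔
    ∃ i j k : Fin n, i < j ∧ j < k ∧ e j < e i ∧ e i < e k := by
  constructor
  · rintro ⟨s, hs, h⟩
    refine ⟨s (0 : Fin 3), s (1 : Fin 3), s (2 : Fin 3), hs (by decide), hs (by decide), ?_, ?_⟩
    · exact (h (1 : Fin 3) (0 : Fin 3)).1.1 (by decide)
    · exact (h (0 : Fin 3) (2 : Fin 3)).1.1 (by decide)
  · rintro ⟨i, j, k, hij, hjk, h1, h2⟩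
    refine ⟨(![i, j, k] : Fin 3 → Fin n), ?_, ?_⟩
    · intro a b hab
      change Fin 3 at a b
      fin_cases a <;> fin_cases b <;> simp at hab ⊢ <;> first | exact absurd hab (by decide) | grind
    · intro a b
      change Fin 3 at a b
      fin_cases a <;> fin_cases b <;> simp <;> omega

/-- Inversion sequences as functions on `ℕ`, zero from `n` on. -/
def InvF (n : ℕ) (f : ℕ → ℕ) : Prop := (∀ i, i < n → f i ≤ i) ∧ ∀ i, n ≤ i → f i = 0

/-- A (101,102)-avoider with the last position of its maximum. -/
def BB (n : ℕ) (x : (ℕ → ℕ) × ℕ) : Prop :=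
  InvF n x.1 ∧ (∀ i j k, i < j → j < k → k < n → x.1 j < x.1 i → x.1 k < x.1 i) ∧
  x.2 < n ∧ (∀ i, i < n → x.1 i ≤ x.1 x.2) ∧ ∀ i, i < n → x.2 < i → x.1 i < x.1 x.2

/-- A (101,021)-avoider with its maximum. -/
def AA (n : ℕ) (x : (ℕ → ℕ) × ℕ) : Prop :=
  InvF n x.1 ∧ (∀ i j, i < j → j < n → 0 < x.1 i → 0 < x.1 j → x.1 i ≤ x.1 j) ∧
  (∀ i j k, i < j → j < k → k < n → 0 < x.1 i → x.1 i = x.1 k → x.1 j ≠ 0) ∧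
  (∀ i, i < n → x.1 i ≤ x.2) ∧ ∃ i, i < n ∧ x.1 i = x.2

theorem finite_InvF (n : ℕ) : {f | InvF n f}.Finite := by
  have : Function.Injective (fun (f : {f // InvF n f}) (i : Fin n) =>
      (⟨f.1 i, lt_of_le_of_lt (f.2.1 i i.2) i.2⟩ : Fin n)) := by
    intro f g h
    apply Subtype.ext
    funext i
    by_cases hi : i < n
    · have := congrFun h ⟨i, hi⟩
      simpa using this
    · rw [f.2.2 i (by omega), g.2.2 i (by omega)]
  exact Finite.of_injective _ this

theorem finite_BB (n : ℕ) : {x | BB n x}.Finite :=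
  ((finite_InvF n).prod (Set.finite_Iio n)).subset fun _ hx => ⟨hx.1, hx.2.2.1⟩

theorem finite_AA (n : ℕ) : {x | AA n x}.Finite :=
  ((finite_InvF n).prod (Set.finite_Iio n)).subset fun x hx => ⟨hx.1, by
    obtain ⟨i, hi, h⟩ := hx.2.2.2.2
    have := hx.1.1 i hi
    simp only [Set.mem_Iio]; omega⟩

noncomputable def FB (n : ℕ) : Finset ((ℕ → ℕ) × ℕ) := (finite_BB n).toFinset
noncomputable def FA (n : ℕ) : Finset ((ℕ → ℕ) × ℕ) := (finite_AA n).toFinset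

theorem mem_FB {n : ℕ} {x} : x ∈ FB n ↔ BB n x := by simp [FB]
theorem mem_FA {n : ℕ} {x} : x ∈ FA n ↔ AA n x := by simp [FA]

theorem exists_last_max (f : ℕ → ℕ) (n : ℕ) (hn : 1 ≤ n) :
    ∃ p, p < n ∧ (∀ i, i < n → f i ≤ f p) ∧ ∀ i, i < n → p < i → f i < f p := by
  induction n, hn using Nat.le_induction with
  | base => exact ⟨0, by omega, fun i hi => by rw [show i = 0 by omega], fun i hi h => by omega⟩
  | succ n hn ih =>
    obtain ⟨p, hp, h1, h2⟩ := ih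
    by_cases h : f p ≤ f n
    · refine ⟨n, by omega, fun i hi => ?_, fun i hi h => by omega⟩
      rcases Nat.lt_succ_iff_lt_or_eq.1 hi with h' | rfl
      · exact (h1 i h').trans h
      · exact le_rfl
    · refine ⟨p, by omega, fun i hi => ?_, fun i hi hpi => ?_⟩ <;>
      rcases Nat.lt_succ_iff_lt_or_eq.1 hi with h' | rfl
      · exact h1 i h'
      · omega
      · exact h2 i h' hpi
      · omega

def extF {n : ℕ} (e : Fin n → ℕ) (i : ℕ) : ℕ := if h : i < n then e ⟨i, h⟩ else 0

theorem extF_lt {n : ℕ} (e : Fin n → ℕ) (i : ℕ) (h : i < n) : extF e i = e ⟨i, h⟩ := by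
  simp [extF, h]

theorem InvF_extF {n : ℕ} {e : Fin n → ℕ} (h : InvSeq e) : InvF n (extF e) := by
  refine ⟨fun i hi => ?_, fun i hi => ?_⟩
  · rw [extF_lt e i hi]; exact h ⟨i, hi⟩
  · simp [extF, hi]

theorem card_B (n : ℕ) (hn : 1 ≤ n) :
    Nat.card {e : Fin n → ℕ // InvSeq e ∧ Avoids e [1,0,1] ∧ Avoids e [1,0,2]} = (FB n).card := by
  rw [← Nat.card_eq_finsetCard (FB n)]
  symm
  refine Nat.card_eq_of_bijective (fun x => ⟨fun i => x.1.1 i, ?_, ?_, ?_⟩) ⟨?_, ?_⟩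
  · have := mem_FB.1 x.2
    exact fun i => this.1.1 i i.2
  · have := (mem_FB.1 x.2).2.1
    rw [Avoids, contains_101]
    rintro ⟨i, j, k, hij, hjk, h1, h2⟩
    have := this i j k hij hjk k.2 h1
    omega
  · have := (mem_FB.1 x.2).2.1
    rw [Avoids, contains_102]
    rintro ⟨i, j, k, hij, hjk, h1, h2⟩
    have := this i j k hij hjk k.2 h1
    omega
  · rintro ⟨⟨f, p⟩, hf⟩ ⟨⟨g, q⟩, hg⟩ h
    rw [mem_FB] at hf hg
    simp only [Subtype.mk.injEq] at h
    have hfg : f = g := by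
      funext i
      by_cases hi : i < n
      · exact congrFun h ⟨i, hi⟩
      · exact (hf.1.2 i (by omega)).trans (hg.1.2 i (by omega)).symm
    subst hfg
    obtain ⟨-, -, h1, h2, h3⟩ := hf
    obtain ⟨-, -, h4, h5, h6⟩ := hg
    simp only at h1 h2 h3 h4 h5 h6
    have : p = q := by
      rcases lt_trichotomy p q with h | h | h
      · have := h3 q h4 h; have := h5 p h1; omega
      · exact h
      · have := h6 p h1 h; have := h2 q h4; omega
    subst this; rfl
  · rintro ⟨e, he, h1, h2⟩
    obtain ⟨p, hp⟩ := exists_last_max (extF e) n hn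
    refine ⟨⟨(extF e, p), mem_FB.2 ⟨InvF_extF he, ?_, hp⟩⟩, ?_⟩
    · intro i j k hij hjk hk h
      simp only at h ⊢
      rw [extF_lt e i (by omega), extF_lt e j (by omega)] at h
      rw [extF_lt e i (by omega), extF_lt e k (by omega)]
      rw [Avoids, contains_101] at h1
      rw [Avoids, contains_102] at h2
      by_contra hc
      rcases (not_lt.1 hc).lt_or_eq with h' | h'
      · exact h2 ⟨_, _, _, hij, hjk, h, h'⟩
      · exact h1 ⟨_, _, _, hij, hjk, h, h'⟩
    · apply Subtype.ext
      funext i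
      exact extF_lt e i i.2

theorem card_A (n : ℕ) (hn : 1 ≤ n) :
    Nat.card {e : Fin n → ℕ // InvSeq e ∧ Avoids e [1,0,1] ∧ Avoids e [0,2,1]} = (FA n).card := by
  rw [← Nat.card_eq_finsetCard (FA n)]
  symm
  refine Nat.card_eq_of_bijective (fun x => ⟨fun i => x.1.1 i, ?_, ?_, ?_⟩) ⟨?_, ?_⟩
  · have := mem_FA.1 x.2
    exact fun i => this.1.1 i i.2
  · obtain ⟨-, h3, h4, -⟩ := mem_FA.1 x.2
    rw [Avoids, contains_101]
    rintro ⟨i, j, k, hij, hjk, h1, h2⟩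
    have := h4 i j k hij hjk k.2 (by omega) h2
    have := h3 i j hij j.2 (by omega) (by omega)
    omega
  · obtain ⟨-, h3, h4, -⟩ := mem_FA.1 x.2
    rw [Avoids, contains_021]
    rintro ⟨i, j, k, hij, hjk, h1, h2⟩
    have := h3 j k hjk k.2 (by omega) (by omega)
    omega
  · rintro ⟨⟨f, p⟩, hf⟩ ⟨⟨g, q⟩, hg⟩ h
    rw [mem_FA] at hf hg
    simp only [Subtype.mk.injEq] at h
    have hfg : f = g := by
      funext i
      by_cases hi : i < n
      · exact congrFun h ⟨i, hi⟩
      · exact (hf.1.2 i (by omega)).trans (hg.1.2 i (by omega)).symm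
    subst hfg
    obtain ⟨-, -, -, h2, i, h3, h4⟩ := hf
    obtain ⟨-, -, -, h5, j, h6, h7⟩ := hg
    simp only at h2 h3 h4 h5 h6 h7
    have : p = q := by
      have := h2 j h6; have := h5 i h3; omega
    subst this; rfl
  · rintro ⟨e, he, h1, h2⟩
    obtain ⟨p, hp⟩ := exists_last_max (extF e) n hn
    rw [Avoids, contains_101] at h1
    rw [Avoids, contains_021] at h2
    refine ⟨⟨(extF e, extF e p), mem_FA.2 ⟨InvF_extF he, ?_, ?_, hp.2.1, p, hp.1, rfl⟩⟩, ?_⟩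
    · intro i j hij hj hi0 hj0
      simp only at hi0 hj0 ⊢
      rw [extF_lt e i (by omega)] at hi0 ⊢
      rw [extF_lt e j (by omega)] at hj0 ⊢
      by_contra hc
      have h0 : e ⟨0, by omega⟩ = 0 := Nat.le_zero.1 (he ⟨0, by omega⟩)
      have hi : 0 < i := by
        rcases Nat.eq_zero_or_pos i with h | h
        · subst h; omega
        · exact h
      exact h2 ⟨⟨0, by omega⟩, ⟨i, by omega⟩, ⟨j, hj⟩, hi, hij, by omega, by omega⟩
    · intro i j k hij hjk hk hi0 hik
      simp only at hi0 hik ⊢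
      rw [extF_lt e i (by omega)] at hi0 hik
      rw [extF_lt e k (by omega)] at hik
      rw [extF_lt e j (by omega)]
      intro hj
      exact h1 ⟨⟨i, by omega⟩, ⟨j, by omega⟩, ⟨k, hk⟩, hij, hjk, by omega, hik⟩
    · apply Subtype.ext
      funext i
      exact extF_lt e i i.2

/-- Insert the value `V` at position `q`. -/
def insF (f : ℕ → ℕ) (q V : ℕ) (i : ℕ) : ℕ :=
  if i < q then f i else if i = q then V else f (i - 1)

/-- Delete position `q`. -/
def delF (f : ℕ → ℕ) (q : ℕ) (i : ℕ) : ℕ := if i < q then f i else f (i + 1)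

/-- Admissible insertions `(V, q)` for a sequence with maximum `M`, last at `p`. -/
def KB (M p : ℕ) : Finset (ℕ × ℕ) :=
  (Finset.range (p + 2) ×ˢ Finset.range (p + 2)).filter
    (fun y => y.1 ≤ y.2 ∧ (M < y.1 ∨ (y.1 = M ∧ y.2 = p + 1)))

theorem mem_KB {M p : ℕ} {y : ℕ × ℕ} (h : M ≤ p) : y ∈ KB M p ↔
    y.1 ≤ y.2 ∧ y.2 ≤ p + 1 ∧ (M < y.1 ∨ (y.1 = M ∧ y.2 = p + 1)) := by
  simp only [KB, Finset.mem_filter, Finset.mem_product, Finset.mem_range]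
  omega

theorem BB_mono {n : ℕ} {x : (ℕ → ℕ) × ℕ} (h : BB n x) (i j : ℕ) (hij : i < j) (hj : j ≤ x.2) :
    x.1 i ≤ x.1 j := by
  obtain ⟨-, h1, h2, h3, h4⟩ := h
  by_contra hc
  rcases hj.lt_or_eq with h5 | h5
  · have := h1 i j x.2 hij h5 h2 (by omega)
    have := h3 i (by omega)
    omega
  · have := h3 i (by omega)
    rw [h5] at hc
    omega

theorem BB_ins {n : ℕ} {x : (ℕ → ℕ) × ℕ} (h : BB n x) {V q : ℕ}
    (hk : V ≤ q ∧ q ≤ x.2 + 1 ∧ (x.1 x.2 < V ∨ (V = x.1 x.2 ∧ q = x.2 + 1))) :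
    BB (n + 1) (insF x.1 q V, q) := by
  have hm := BB_mono h
  obtain ⟨f, p⟩ := x
  obtain ⟨⟨h1, h1'⟩, h2, h3, h4, h5⟩ := h
  simp only at *
  refine ⟨⟨?_, ?_⟩, ?_, ?_, ?_, ?_⟩
  · intro i hi
    simp only [insF]
    split_ifs with ha hb
    · exact h1 i (by omega)
    · omega
    · have := h1 (i - 1) (by omega); omega
  · intro i hi
    simp only [insF]
    split_ifs with ha hb
    · omega
    · omega
    · exact h1' _ (by omega)
  · intro i j k hij hjk hk' hlt
    simp only [insF] at *
    by_cases hi : i < q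
    · by_cases hj : j < q
      · have := hm i j hij (by omega)
        simp only [hi, hj, if_true] at hlt
        omega
      · by_cases hj' : j = q
        · subst hj'
          have := h4 i (by omega)
          simp only [hi, if_true, lt_irrefl, if_false] at hlt
          omega
        · have a1 : ¬ k < q := by omega
          have a2 : ¬ k = q := by omega
          simp only [hi, hj, hj', a1, a2, if_true, if_false] at hlt ⊢
          exact h2 i (j - 1) (k - 1) (by omega) (by omega) (by omega) hlt
    · have b1 : ¬ j < q := by omega
      have b2 : ¬ j = q := by omega
      have a1 : ¬ k < q := by omega
      have a2 : ¬ k = q := by omega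
      by_cases hi' : i = q
      · subst hi'
        simp only [b1, b2, a1, a2, lt_irrefl, if_true, if_false] at hlt ⊢
        have := h4 (k - 1) (by omega)
        rcases hk.2.2 with h | ⟨h, h'⟩
        · omega
        · have := h5 (k - 1) (by omega) (by omega)
          omega
      · simp only [hi, hi', b1, b2, a1, a2, if_false] at hlt ⊢
        exact h2 (i - 1) (j - 1) (k - 1) (by omega) (by omega) (by omega) hlt
  · omega
  · intro i hi
    simp only [insF, lt_irrefl, if_true, if_false]
    split_ifs with ha hb
    · have := h4 i (by omega); omega
    · omega
    · have := h4 (i - 1) (by omega); omega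
  · intro i hi hq
    have a1 : ¬ i < q := by omega
    have a2 : ¬ i = q := by omega
    simp only [insF, lt_irrefl, if_true, if_false, a1, a2]
    have := h4 (i - 1) (by omega)
    rcases hk.2.2 with h | ⟨h, h'⟩
    · omega
    · have := h5 (i - 1) (by omega) (by omega)
      omega

/-- Position of the last maximum after deleting the last maximum. -/
noncomputable def lastMax (n : ℕ) (f : ℕ → ℕ) : ℕ :=
  open Classical in
  if h : ∃ p, p < n ∧ (∀ i, i < n → f i ≤ f p) ∧ ∀ i, i < n → p < i → f i < f p
  then h.choose else 0

theorem lastMax_spec (n : ℕ) (hn : 1 ≤ n) (f : ℕ → ℕ) :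
    lastMax n f < n ∧ (∀ i, i < n → f i ≤ f (lastMax n f)) ∧
      ∀ i, i < n → lastMax n f < i → f i < f (lastMax n f) := by
  have h := exists_last_max f n hn
  rw [lastMax, dif_pos h]
  exact h.choose_spec

theorem lastMax_eq {n : ℕ} {x : (ℕ → ℕ) × ℕ} (hx : BB n x) : lastMax n x.1 = x.2 := by
  obtain ⟨-, -, h1, h2, h3⟩ := hx
  obtain ⟨h4, h5, h6⟩ := lastMax_spec n (by omega) x.1
  rcases lt_trichotomy (lastMax n x.1) x.2 with h | h | h
  · have := h6 _ h1 h; have := h2 _ h4; omega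
  · exact h
  · have := h3 _ h4 h; have := h5 _ h1; omega

theorem BB_del {n : ℕ} (hn : 1 ≤ n) {x : (ℕ → ℕ) × ℕ} (h : BB (n + 1) x) :
    BB n (delF x.1 x.2, lastMax n (delF x.1 x.2)) := by
  have hm := BB_mono h
  obtain ⟨h7, h8, h9⟩ := lastMax_spec n hn (delF x.1 x.2)
  refine ⟨⟨?_, ?_⟩, ?_, h7, h8, h9⟩
  all_goals
    obtain ⟨f, p⟩ := x
    obtain ⟨⟨h1, h1'⟩, h2, h3, h4, h5⟩ := h
    simp only at *
  · intro i hi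
    simp only [delF]
    split_ifs with ha
    · exact h1 i (by omega)
    · have := h5 (i + 1) (by omega) (by omega)
      have := h1 p h3
      omega
  · intro i hi
    simp only [delF]
    split_ifs with ha
    · omega
    · exact h1' _ (by omega)
  · intro i j k hij hjk hk hlt
    simp only [delF] at *
    by_cases hi : i < p <;> by_cases hj : j < p <;> by_cases hk' : k < p <;>
      simp only [hi, hj, hk', if_true, if_false] at hlt ⊢ <;> first
      | omega
      | exact h2 _ _ _ (by omega) (by omega) (by omega) hlt

theorem BB_del_K {n : ℕ} (hn : 1 ≤ n) {x : (ℕ → ℕ) × ℕ} (h : BB (n + 1) x) :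
    x.1 x.2 ≤ x.2 ∧ x.2 ≤ lastMax n (delF x.1 x.2) + 1 ∧
    (delF x.1 x.2 (lastMax n (delF x.1 x.2)) < x.1 x.2 ∨
      (x.1 x.2 = delF x.1 x.2 (lastMax n (delF x.1 x.2)) ∧
        x.2 = lastMax n (delF x.1 x.2) + 1)) := by
  have hm := BB_mono h
  obtain ⟨h7, h8, h9⟩ := lastMax_spec n hn (delF x.1 x.2)
  generalize lastMax n (delF x.1 x.2) = r at *
  obtain ⟨f, p⟩ := x
  obtain ⟨⟨h1, h1'⟩, h2, h3, h4, h5⟩ := h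
  simp only at *
  have hp := h1 p h3
  have key : p ≤ r + 1 := by
    by_contra hc
    have := h9 (p - 1) (by omega) (by omega)
    have := hm r (p - 1) (by omega) (by omega)
    have a1 : p - 1 < p := by omega
    have a2 : r < p := by omega
    simp only [delF, a1, a2, if_true] at *
    omega
  refine ⟨hp, key, ?_⟩
  by_cases hr : r < p
  · simp only [delF, hr, if_true]
    have := h4 r (by omega)
    omega
  · simp only [delF, hr, if_false]
    have := h5 (r + 1) (by omega) (by omega)
    omega

theorem ins_del (f : ℕ → ℕ) (q : ℕ) : insF (delF f q) q (f q) = f := by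
  funext i
  simp only [insF, delF]
  split_ifs with h1 h2 h3
  · rfl
  · rw [h2]
  · omega
  · congr 1; omega

theorem del_ins (f : ℕ → ℕ) (q V : ℕ) : delF (insF f q V) q = f := by
  funext i
  simp only [insF, delF]
  split_ifs with h1 h2 h3
  · rfl
  · omega
  · omega
  · rfl

theorem sum_FB (n : ℕ) (hn : 1 ≤ n) (φ : ℕ → ℕ) :
    ∑ x ∈ FB (n + 1), φ (x.2 - x.1 x.2) =
      ∑ x ∈ FB n, ∑ y ∈ KB (x.1 x.2) x.2, φ (y.2 - y.1) := by
  rw [Finset.sum_sigma']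
  have hMp : ∀ x, BB n x → x.1 x.2 ≤ x.2 := fun x hx => hx.1.1 _ hx.2.2.1
  refine Finset.sum_bij'
    (fun x _ => (⟨(delF x.1 x.2, lastMax n (delF x.1 x.2)), (x.1 x.2, x.2)⟩ :
      (_ : (ℕ → ℕ) × ℕ) × (ℕ × ℕ)))
    (fun z _ => (insF z.1.1 z.2.2 z.2.1, z.2.2)) ?_ ?_ ?_ ?_ ?_
  · intro x hx
    rw [mem_FB] at hx
    have h1 := BB_del hn hx
    rw [Finset.mem_sigma, mem_FB]
    refine ⟨h1, ?_⟩
    rw [mem_KB (hMp _ h1)]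
    exact BB_del_K hn hx
  · rintro ⟨x, V, q⟩ hz
    rw [Finset.mem_sigma, mem_FB] at hz
    obtain ⟨h1, h2⟩ := hz
    rw [mem_KB (hMp _ h1)] at h2
    exact mem_FB.2 (BB_ins h1 h2)
  · intro x hx
    simp only [ins_del]
  · rintro ⟨x, V, q⟩ hz
    rw [Finset.mem_sigma, mem_FB] at hz
    obtain ⟨h1, h2⟩ := hz
    simp only at h1
    simp only [del_ins, lastMax_eq h1]
    simp [insF]
  · intro x hx
    rfl

theorem sum_KB (M p : ℕ) (h : M ≤ p) (φ : ℕ → ℕ) :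
    ∑ y ∈ KB M p, φ (y.2 - y.1) =
      φ (p - M + 1) + ∑ j ∈ Finset.range (p - M + 1), (p - M + 1 - j) * φ j := by
  have e1 : KB M p = insert (M, p + 1)
      (((Finset.range (p - M + 1)).sigma (fun j => Finset.range (p - M + 1 - j))).image
        (fun z => (M + 1 + z.2, M + 1 + z.2 + z.1))) := by
    ext ⟨V, q⟩
    rw [mem_KB h]
    simp only [Finset.mem_insert, Finset.mem_image, Finset.mem_sigma, Finset.mem_range,
      Prod.mk.injEq, Sigma.exists]
    constructor
    · rintro ⟨h1, h2, h3 | h3⟩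
      · exact Or.inr ⟨q - V, V - (M + 1), by omega, by omega, by omega⟩
      · exact Or.inl h3
    · rintro (h3 | ⟨a, b, h3, h4, h5⟩) <;> omega
  rw [e1, Finset.sum_insert, Finset.sum_image, Finset.sum_sigma]
  · congr 1
    · congr 1; omega
    · refine Finset.sum_congr rfl fun j _ => ?_
      simp only [Nat.add_sub_cancel_left, Finset.sum_const, Finset.card_range, smul_eq_mul]
  · rintro ⟨a, b⟩ - ⟨c, d⟩ - h
    simp only [Prod.mk.injEq] at h
    obtain rfl : b = d := by omega
    obtain rfl : a = c := by omega
    rfl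
  · simp only [Finset.mem_image, Prod.mk.injEq, not_exists]
    rintro ⟨a, b⟩
    simp only
    omega

theorem AA_le {n : ℕ} {x : (ℕ → ℕ) × ℕ} (h : AA n x) : x.2 < n := by
  obtain ⟨i, hi, h'⟩ := h.2.2.2.2
  have := h.1.1 i hi
  omega

/-- Admissible last letters. -/
def KA (n m l : ℕ) : Finset ℕ :=
  (Finset.range (n + 1)).filter (fun v => v = 0 ∨ m < v ∨ (v = m ∧ l ≠ 0))

theorem mem_KA {n m l v : ℕ} : v ∈ KA n m l ↔ v ≤ n ∧ (v = 0 ∨ m < v ∨ (v = m ∧ l ≠ 0)) := by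
  simp only [KA, Finset.mem_filter, Finset.mem_range]
  omega

def updF (f : ℕ → ℕ) (n v : ℕ) (i : ℕ) : ℕ := if i = n then v else f i

theorem AA_ins {n : ℕ} (hn : 1 ≤ n) {x : (ℕ → ℕ) × ℕ} (h : AA n x) {v : ℕ}
    (hv : v ∈ KA n x.2 (x.1 (n - 1))) : AA (n + 1) (updF x.1 n v, max x.2 v) := by
  rw [mem_KA] at hv
  have hxn := AA_le h
  obtain ⟨f, m⟩ := x
  obtain ⟨⟨h1, h1'⟩, h2, h3, h4, r, hr, hr'⟩ := h
  simp only at *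
  refine ⟨⟨?_, ?_⟩, ?_, ?_, ?_, ?_⟩
  · intro i hi
    simp only [updF]
    split_ifs with ha
    · omega
    · exact h1 i (by omega)
  · intro i hi
    have : ¬ i = n := by omega
    simp only [updF, this, if_false]
    exact h1' i (by omega)
  · intro i j hij hj
    have : ¬ i = n := by omega
    simp only [updF, this, if_false]
    split_ifs with ha
    · intro _ hv0
      have := h4 i (by omega)
      omega
    · exact h2 i j hij (by omega)
  · intro i j k hij hjk hk
    have a1 : ¬ i = n := by omega
    have a2 : ¬ j = n := by omega
    simp only [updF, a1, a2, if_false]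
    split_ifs with ha
    · intro hi0 hiv hj0
      have b1 := h4 i (by omega)
      have b2 : f (n - 1) ≠ 0 := by omega
      have b3 := h4 (n - 1) (by omega)
      have b4 := h2 i (n - 1) (by omega) (by omega) hi0 (by omega)
      have hjn : j ≠ n - 1 := by rintro rfl; exact b2 hj0
      exact h3 i j (n - 1) hij (by omega) (by omega) hi0 (by omega) hj0
    · exact h3 i j k hij hjk (by omega)
  · intro i hi
    simp only [updF]
    split_ifs with ha
    · omega
    · have := h4 i (by omega); omega
  · by_cases hmv : m < v
    · exact ⟨n, by omega, by simp only [updF, if_true]; omega⟩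
    · have : ¬ r = n := by omega
      exact ⟨r, by omega, by simp only [updF, this, if_false]; omega⟩

theorem AA_del {n : ℕ} (hn : 1 ≤ n) {x : (ℕ → ℕ) × ℕ} (h : AA (n + 1) x) :
    AA n (updF x.1 n 0, x.1 (lastMax n x.1)) := by
  obtain ⟨h7, h8, h9⟩ := lastMax_spec n hn x.1
  generalize lastMax n x.1 = r at *
  obtain ⟨f, m⟩ := x
  obtain ⟨⟨h1, h1'⟩, h2, h3, h4, -⟩ := h
  simp only at *
  have e : ∀ i, i < n → updF f n 0 i = f i := fun i hi => by
    have : ¬ i = n := by omega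
    simp [updF, this]
  refine ⟨⟨?_, ?_⟩, ?_, ?_, ?_, r, h7, e r h7⟩
  · intro i hi
    simp only [e i hi]
    exact h1 i (by omega)
  · intro i hi
    simp only [updF]
    split_ifs with ha
    · rfl
    · exact h1' i (by omega)
  · intro i j hij hj
    simp only [e i (by omega), e j hj]
    exact h2 i j hij (by omega)
  · intro i j k hij hjk hk
    simp only [e i (by omega), e j (by omega), e k hk]
    exact h3 i j k hij hjk (by omega)
  · intro i hi
    simp only [e i hi]
    exact h8 i hi

theorem AA_del_K {n : ℕ} (hn : 1 ≤ n) {x : (ℕ → ℕ) × ℕ} (h : AA (n + 1) x) :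
    x.1 n ∈ KA n (x.1 (lastMax n x.1)) (updF x.1 n 0 (n - 1)) ∧
      x.2 = max (x.1 (lastMax n x.1)) (x.1 n) := by
  rw [mem_KA]
  obtain ⟨h7, h8, h9⟩ := lastMax_spec n hn x.1
  generalize lastMax n x.1 = r at *
  obtain ⟨f, m⟩ := x
  obtain ⟨⟨h1, h1'⟩, h2, h3, h4, s, hs, hs'⟩ := h
  simp only at *
  have e : updF f n 0 (n - 1) = f (n - 1) := by
    have : ¬ n - 1 = n := by omega
    simp [updF, this]
  rw [e]
  refine ⟨⟨h1 n (by omega), ?_⟩, ?_⟩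
  · by_cases hz : f n = 0
    · exact Or.inl hz
    right
    by_cases hlt : f r < f n
    · exact Or.inl hlt
    right
    have := h2 r n h7 (by omega) (by omega) (by omega)
    refine ⟨by omega, ?_⟩
    by_cases hrn : r = n - 1
    · rw [← hrn]; omega
    · exact h3 r (n - 1) n (by omega) (by omega) (by omega) (by omega) (by omega)
  · have a1 := h4 r (by omega)
    have a2 := h4 n (by omega)
    by_cases hsn : s = n
    · subst hsn; omega
    · have := h8 s (by omega); omega

theorem AA_max {n : ℕ} (hn : 1 ≤ n) {x : (ℕ → ℕ) × ℕ} (h : AA n x) (v : ℕ) :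
    updF x.1 n v (lastMax n (updF x.1 n v)) = x.2 := by
  obtain ⟨h7, h8, h9⟩ := lastMax_spec n hn (updF x.1 n v)
  generalize lastMax n (updF x.1 n v) = r at *
  obtain ⟨-, -, -, h4, s, hs, hs'⟩ := h
  have e : ∀ i, i < n → updF x.1 n v i = x.1 i := fun i hi => by
    have : ¬ i = n := by omega
    simp [updF, this]
  have a1 := h8 s hs
  have a2 := h4 r h7
  rw [e s hs] at a1
  rw [e r h7] at a1 ⊢
  omega

theorem sum_FA (n : ℕ) (hn : 1 ≤ n) (φ : ℕ → ℕ → ℕ) :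
    ∑ x ∈ FA (n + 1), φ (x.1 n) x.2 =
      ∑ x ∈ FA n, ∑ v ∈ KA n x.2 (x.1 (n - 1)), φ v (max x.2 v) := by
  rw [Finset.sum_sigma']
  refine Finset.sum_bij'
    (fun x _ => (⟨(updF x.1 n 0, x.1 (lastMax n x.1)), x.1 n⟩ : (_ : (ℕ → ℕ) × ℕ) × ℕ))
    (fun z _ => (updF z.1.1 n z.2, max z.1.2 z.2)) ?_ ?_ ?_ ?_ ?_
  · intro x hx
    rw [mem_FA] at hx
    rw [Finset.mem_sigma, mem_FA]
    exact ⟨AA_del hn hx, (AA_del_K hn hx).1⟩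
  · rintro ⟨x, v⟩ hz
    rw [Finset.mem_sigma, mem_FA] at hz
    exact mem_FA.2 (AA_ins hn hz.1 hz.2)
  · intro x hx
    rw [mem_FA] at hx
    refine Prod.ext ?_ (AA_del_K hn hx).2.symm
    funext i
    simp only [updF]
    split_ifs with h
    · rw [h]
    · rfl
  · rintro ⟨x, v⟩ hz
    rw [Finset.mem_sigma, mem_FA] at hz
    obtain ⟨h1, h2⟩ := hz
    simp only at h1
    simp only [AA_max hn h1]
    have e : updF (updF x.1 n v) n 0 = x.1 := by
      funext i
      simp only [updF]
      split_ifs with h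
      · rw [h1.1.2 i (by omega)]
      · rfl
    rw [e]
    simp [updF]
  · intro x hx
    rw [mem_FA] at hx
    simp only [← (AA_del_K hn hx).2]

theorem sum_KA (n m l : ℕ) (hm : m < n) (hl : l ≤ m) (ζ ν : ℕ → ℕ) :
    ∑ v ∈ KA n m l, (if v = 0 then ζ (n - max m v) else ν (n - max m v)) =
      ζ (n - 1 - m + 1) +
        ∑ j ∈ Finset.range (n - 1 - m + 1 + (if l = 0 then 0 else 1)), ν j := by
  have e : KA n m l = insert 0 ((Finset.range (n - 1 - m + 1 + (if l = 0 then 0 else 1))).image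
      (fun j => n - j)) := by
    ext v
    rw [mem_KA]
    simp only [Finset.mem_insert, Finset.mem_image, Finset.mem_range]
    constructor
    · intro h
      by_cases hv : v = 0
      · exact Or.inl hv
      · refine Or.inr ⟨n - v, ?_, by omega⟩
        split_ifs <;> omega
    · rintro (h | ⟨j, h1, h2⟩)
      · omega
      · split_ifs at h1 <;> omega
  rw [e, Finset.sum_insert, Finset.sum_image]
  · congr 1
    · rw [if_pos rfl]; congr 1; omega
    · refine Finset.sum_congr rfl fun j hj => ?_
      rw [Finset.mem_range] at hj
      have h1 : n - j ≠ 0 := by split_ifs at hj <;> omega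
      rw [if_neg h1]
      congr 1
      split_ifs at hj <;> omega
  · intro i hi j hj h
    simp only [Finset.coe_range, Set.mem_Iio] at hi hj h
    split_ifs at hi hj <;> omega
  · simp only [Finset.mem_image, Finset.mem_range, not_exists]
    intro j
    split_ifs <;> omega

/-- Weighted path counts: number of (101,102)-avoiders of length `L+1` with statistic `g`. -/
def cc : ℕ → ℕ → ℕ
  | 0, g => if g = 0 then 1 else 0
  | L + 1, g => (if g = 0 then 0 else cc L (g - 1)) +
      ∑ h ∈ Finset.range (L + 1), (h + 1 - g) * cc L h

def WW (L j : ℕ) : ℕ := ∑ h ∈ Finset.range (L + 1), (h + 1 - j) * cc L h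
def TT (L j : ℕ) : ℕ := ∑ h ∈ Finset.range (L + 1), if j ≤ h then cc L h else 0

theorem cc_succ_zero (L : ℕ) : cc (L + 1) 0 = WW L 0 := by simp [cc, WW]
theorem cc_succ_succ (L g : ℕ) : cc (L + 1) (g + 1) = cc L g + WW L (g + 1) := by simp [cc, WW]

theorem cc_diag (L : ℕ) : cc L L = 1 := by
  induction L with
  | zero => simp [cc]
  | succ L ih =>
    rw [cc_succ_succ, ih, WW, Finset.sum_eq_zero, add_zero]
    intro h hh
    rw [Finset.mem_range] at hh
    rw [show h + 1 - (L + 1) = 0 by omega, zero_mul]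

theorem WW_eq (L j : ℕ) : WW L j = TT L j + WW L (j + 1) := by
  simp only [WW, TT, ← Finset.sum_add_distrib]
  refine Finset.sum_congr rfl fun h _ => ?_
  split_ifs with hj
  · rw [show h + 1 - j = 1 + (h + 1 - (j + 1)) by omega]; ring
  · rw [show h + 1 - j = 0 by omega, show h + 1 - (j + 1) = 0 by omega]; simp

theorem TT_eq (L j : ℕ) (h : j ≤ L) : TT L j = cc L j + TT L (j + 1) := by
  have : cc L j = ∑ h ∈ Finset.range (L + 1), if h = j then cc L h else 0 := by
    rw [Finset.sum_ite_eq' (Finset.range (L + 1)) j, if_pos (Finset.mem_range.2 (by omega))]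
  rw [this]
  simp only [TT, ← Finset.sum_add_distrib]
  refine Finset.sum_congr rfl fun h _ => ?_
  split_ifs <;> omega

theorem TT_diag (L : ℕ) : TT L L = 1 := by
  rw [TT_eq L L le_rfl, cc_diag, TT, Finset.sum_eq_zero, add_zero]
  intro h hh
  rw [Finset.mem_range] at hh
  rw [if_neg (by omega)]

theorem WW_diag (L : ℕ) : WW L L = 1 := by
  rw [WW_eq, TT_diag, WW, Finset.sum_eq_zero, add_zero]
  intro h hh
  rw [Finset.mem_range] at hh
  rw [show h + 1 - (L + 1) = 0 by omega, zero_mul]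

theorem cc_sum (l g : ℕ) : cc (l + 1 + g) g = ∑ j ∈ Finset.range (g + 1), WW (l + j) j := by
  induction g with
  | zero => simp [cc_succ_zero]
  | succ g ih =>
    rw [Finset.sum_range_succ, ← ih, ← add_assoc, cc_succ_succ,
      show l + 1 + g = l + (g + 1) by omega]

theorem Z_step (l g : ℕ) : TT (l + 1 + g) g =
    TT (l + (g + 1)) (g + 1) + ∑ j ∈ Finset.range (g + 1), WW (l + j) j := by
  rw [TT_eq _ _ (by omega), cc_sum, show l + 1 + g = l + (g + 1) by omega, add_comm]

theorem N_step (l g : ℕ) : WW (l + 1 + g) g =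
    TT (l + (g + 1)) (g + 1) + ∑ j ∈ Finset.range (g + 1 + 1), WW (l + j) j := by
  rw [WW_eq, Z_step, Finset.sum_range_succ _ (g + 1), show l + 1 + g = l + (g + 1) by omega]
  ring

theorem card_FA_gen (k m : ℕ) (hm : 1 ≤ m) : (FA (m + k)).card =
    ∑ x ∈ FA m, if x.1 (m - 1) = 0 then TT (k + (m - 1 - x.2)) (m - 1 - x.2)
      else WW (k + (m - 1 - x.2)) (m - 1 - x.2) := by
  induction k generalizing m with
  | zero =>
    simp [TT_diag, WW_diag]
  | succ k ih =>
    rw [show m + (k + 1) = (m + 1) + k by omega, ih (m + 1) (by omega)]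
    rw [Nat.add_sub_cancel]
    rw [sum_FA m hm (fun v M => if v = 0 then TT (k + (m - M)) (m - M) else WW (k + (m - M)) (m - M))]
    refine Finset.sum_congr rfl fun x hx => ?_
    rw [mem_FA] at hx
    rw [sum_KA m x.2 _ (AA_le hx) (hx.2.2.2.1 _ (by omega))
      (fun g => TT (k + g) g) (fun g => WW (k + g) g)]
    split_ifs with h
    · rw [Z_step]
    · rw [N_step]

theorem FA_one : FA 1 = {(fun _ => 0, 0)} := by
  ext ⟨f, m⟩
  rw [mem_FA, Finset.mem_singleton]
  constructor
  · intro h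
    have hf : f = fun _ => 0 := by
      funext i
      by_cases hi : i < 1
      · have := h.1.1 i hi
        simp only at this
        omega
      · exact h.1.2 i (by omega)
    have := AA_le h
    simp only at this
    rw [hf, show m = 0 by omega]
  · rintro h
    obtain ⟨rfl, rfl⟩ := Prod.mk.inj h
    refine ⟨⟨fun i _ => Nat.zero_le _, fun i _ => rfl⟩, fun i j _ _ _ _ => le_rfl, ?_, fun i _ => le_rfl,
      0, by omega, rfl⟩
    intro i j k _ _ _ h
    exact absurd h (lt_irrefl 0)

theorem FB_one : FB 1 = {(fun _ => 0, 0)} := by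
  ext ⟨f, m⟩
  rw [mem_FB, Finset.mem_singleton]
  constructor
  · intro h
    have hf : f = fun _ => 0 := by
      funext i
      by_cases hi : i < 1
      · have := h.1.1 i hi
        simp only at this
        omega
      · exact h.1.2 i (by omega)
    have := h.2.2.1
    simp only at this
    rw [hf, show m = 0 by omega]
  · rintro h
    obtain ⟨rfl, rfl⟩ := Prod.mk.inj h
    refine ⟨⟨fun i _ => Nat.zero_le _, fun i _ => rfl⟩, fun i j k _ _ _ h => h, by simp,
      fun i _ => le_rfl, fun i h1 h2 => ?_⟩
    simp only at h2
    omega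

theorem sum_FB_gen (L : ℕ) (φ : ℕ → ℕ) : ∑ x ∈ FB (L + 1), φ (x.2 - x.1 x.2) =
    ∑ h ∈ Finset.range (L + 1), cc L h * φ h := by
  induction L generalizing φ with
  | zero => simp [FB_one, cc]
  | succ L ih =>
    rw [sum_FB (L + 1) (by omega) φ]
    have e1 : ∑ x ∈ FB (L + 1), ∑ y ∈ KB (x.1 x.2) x.2, φ (y.2 - y.1) =
        ∑ x ∈ FB (L + 1), (fun g => φ (g + 1) + ∑ j ∈ Finset.range (g + 1), (g + 1 - j) * φ j)
          (x.2 - x.1 x.2) := by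
      refine Finset.sum_congr rfl fun x hx => ?_
      rw [mem_FB] at hx
      rw [sum_KB _ _ (hx.1.1 _ hx.2.2.1)]
    refine (e1.trans (ih (fun g => φ (g + 1) + ∑ j ∈ Finset.range (g + 1), (g + 1 - j) * φ j))).trans ?_
    have e2 : ∀ h ∈ Finset.range (L + 1), ∑ j ∈ Finset.range (h + 1), (h + 1 - j) * φ j =
        ∑ j ∈ Finset.range (L + 2), (h + 1 - j) * φ j := by
      intro h hh
      rw [Finset.mem_range] at hh
      refine Finset.sum_subset (Finset.range_subset_range.2 (by omega)) ?_
      intro j _ hj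
      rw [Finset.mem_range] at hj
      rw [show h + 1 - j = 0 by omega, zero_mul]
    have e3 : ∀ j, cc (L + 1) j * φ j = (if j = 0 then 0 else cc L (j - 1)) * φ j +
        ∑ h ∈ Finset.range (L + 1), cc L h * ((h + 1 - j) * φ j) := by
      intro j
      rw [cc, add_mul, Finset.sum_mul]
      congr 1
      exact Finset.sum_congr rfl fun h _ => by ring
    simp only [e3, mul_add, Finset.sum_add_distrib]
    congr 1
    · rw [Finset.sum_range_succ' _ (L + 1)]
      simp
    · rw [Finset.sum_comm]
      refine Finset.sum_congr rfl fun h hh => ?_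
      rw [e2 h hh, Finset.mul_sum]

theorem stmt_16 (n : ℕ) (hn : 1 ≤ n) :
    Nat.card {e : Fin n → ℕ // InvSeq e ∧ Avoids e [1,0,1] ∧ Avoids e [0,2,1]}
      = Nat.card {e : Fin n → ℕ // InvSeq e ∧ Avoids e [1,0,1] ∧ Avoids e [1,0,2]} := by
  rw [card_A n hn, card_B n hn]
  obtain ⟨L, rfl⟩ : ∃ L, n = L + 1 := ⟨n - 1, by omega⟩
  have h1 := card_FA_gen L 1 le_rfl
  have h2 := sum_FB_gen L (fun _ => 1)
  rw [add_comm, h1, FA_one]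
  rw [Finset.sum_const, smul_eq_mul, mul_one] at h2
  rw [add_comm 1 L, h2]
  simp [TT]
end

section
/- For every integer n ≥ 1 and all nonnegative integers a, b, c, the number of inversion sequences e of length n avoiding pattern 201 with zero(e) = a, dist(e) = b, satu(e) = c and avoiding pattern 010 equals the number of inversion sequences e of length n avoiding pattern 210 with zero(e) = a, dist(e) = b, satu(e) = c and avoiding pattern 010; moreover, the same equality holds with 'avoiding pattern 010' replaced by 'containing pattern 010' in both counts. In particular, |I_n(010,201)| = |I_n(010,210)|. -/
namespace Inv18

open Finset

variable {n : ℕ}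

/-- Pattern `201`, unfolded. -/
def C201 (e : Fin n → ℕ) : Prop := ∃ i j k : Fin n, i < j ∧ j < k ∧ e j < e k ∧ e k < e i
/-- Pattern `210`, unfolded. -/
def C210 (e : Fin n → ℕ) : Prop := ∃ i j k : Fin n, i < j ∧ j < k ∧ e k < e j ∧ e j < e i
/-- Pattern `010`, unfolded. -/
def C010 (e : Fin n → ℕ) : Prop := ∃ i j k : Fin n, i < j ∧ j < k ∧ e i = e k ∧ e i < e j

lemma contains3 (e : Fin n → ℕ) (a b c : ℕ) :
    Contains e [a, b, c] ↔ ∃ i j k : Fin n, i < j ∧ j < k ∧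
      ((a < b ↔ e i < e j) ∧ (a = b ↔ e i = e j)) ∧
      ((a < c ↔ e i < e k) ∧ (a = c ↔ e i = e k)) ∧
      ((b < c ↔ e j < e k) ∧ (b = c ↔ e j = e k)) := by
  constructor
  · rintro ⟨s, hs, h⟩
    refine ⟨s ⟨0, by simp⟩, s ⟨1, by simp⟩, s ⟨2, by simp⟩, hs (by simp), hs (by simp), ?_, ?_, ?_⟩
    · simpa using h ⟨0, by simp⟩ ⟨1, by simp⟩
    · simpa using h ⟨0, by simp⟩ ⟨2, by simp⟩
    · simpa using h ⟨1, by simp⟩ ⟨2, by simp⟩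
  · rintro ⟨i, j, k, hij, hjk, h1, h2, h3⟩
    refine ⟨(![i, j, k] : Fin 3 → Fin n), ?_, ?_⟩
    · intro x y hxy
      change Fin 3 at x y
      fin_cases x <;> fin_cases y <;> simp at hxy ⊢
      · exact hij
      · exact hij.trans hjk
      · exact hjk
    · intro x y
      change Fin 3 at x y
      fin_cases x <;> fin_cases y <;> simp <;> omega

lemma c201 (e : Fin n → ℕ) : Contains e [2,0,1] ↔ C201 e := by
  rw [contains3]
  refine exists_congr fun i => exists_congr fun j => exists_congr fun k => ?_
  omega

lemma c210 (e : Fin n → ℕ) : Contains e [2,1,0] ↔ C210 e := by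
  rw [contains3]
  refine exists_congr fun i => exists_congr fun j => exists_congr fun k => ?_
  omega

lemma c010 (e : Fin n → ℕ) : Contains e [0,1,0] ↔ C010 e := by
  rw [contains3]
  refine exists_congr fun i => exists_congr fun j => exists_congr fun k => ?_
  omega

/-- Weak left-to-right maximum. -/
def Top (e : Fin n → ℕ) (i : Fin n) : Prop := ∀ j < i, e j ≤ e i

lemma exists_top (e : Fin n → ℕ) (m : Fin n) : ∃ t ≤ m, Top e t ∧ e m ≤ e t := by
  induction m using WellFoundedLT.induction with
  | ind m ih =>
    by_cases h : Top e m
    · exact ⟨m, le_rfl, h, le_rfl⟩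
    · simp only [Top, not_forall, not_le] at h
      obtain ⟨j, hj, hje⟩ := h
      obtain ⟨t, ht, h1, h2⟩ := ih j hj
      exact ⟨t, ht.trans hj.le, h1, by omega⟩

/-- The same left-to-right maxima, with the same values. -/
def SameTop (e e' : Fin n → ℕ) : Prop := ∀ i, (Top e i ↔ Top e' i) ∧ (Top e i → e i = e' i)

lemma SameTop.symm {e e' : Fin n → ℕ} (h : SameTop e e') : SameTop e' e :=
  fun i => ⟨(h i).1.symm, fun t => ((h i).2 ((h i).1.2 t)).symm⟩

lemma SameTop.trans {e e' f : Fin n → ℕ} (h : SameTop e e') (h' : SameTop e' f) : SameTop e f :=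
  fun i => ⟨(h i).1.trans (h' i).1, fun t => ((h i).2 t).trans ((h' i).2 ((h i).1.1 t))⟩

lemma sameTop_of {e e' : Fin n → ℕ} (h1 : ∀ i, Top e i → e' i = e i)
    (h2 : ∀ i, ¬ Top e i → ∃ m < i, e' i < e m) : SameTop e e' := by
  have h3 : ∀ i, ¬ Top e i → ∃ m < i, Top e m ∧ e' i < e m := by
    intro i hi
    obtain ⟨m, hm, hme⟩ := h2 i hi
    obtain ⟨t, ht, htt, hte⟩ := exists_top e m
    exact ⟨t, ht.trans_lt hm, htt, by omega⟩
  intro i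
  refine ⟨⟨fun hi j hj => ?_, fun hi => ?_⟩, fun hi => (h1 i hi).symm⟩
  · rw [h1 i hi]
    by_cases ht : Top e j
    · rw [h1 j ht]; exact hi j hj
    · obtain ⟨m, hm, _, hme⟩ := h3 j ht
      have := hi m (hm.trans hj)
      omega
  · by_contra hn
    obtain ⟨m, hm, hmt, hme⟩ := h3 i hn
    have := hi m hm
    rw [h1 m hmt] at this
    omega

lemma SameTop.invSeq {e e' : Fin n → ℕ} (h : SameTop e e') (he : InvSeq e) : InvSeq e' := by
  intro i
  obtain ⟨t, ht, htt, hte⟩ := exists_top e' i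
  have h1 := (h.symm t).2 htt
  have h2 := he t
  have : (t : ℕ) ≤ i := ht
  omega

lemma SameTop.satu {e e' : Fin n → ℕ} (h : SameTop e e') (he : InvSeq e) (he' : InvSeq e') :
    satuStat e = satuStat e' := by
  have key : ∀ {f : Fin n → ℕ}, InvSeq f → ∀ i, f i = (i : ℕ) → Top f i := by
    intro f hf i hi j hj
    have := hf j
    have : (j : ℕ) < i := hj
    omega
  unfold satuStat
  congr 1
  ext i
  simp only [mem_filter, mem_univ, true_and]
  constructor
  · intro hi
    rw [← (h i).2 (key he i hi), hi]
  · intro hi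
    rw [← (h.symm i).2 (key he' i hi), hi]

/-- First difference property of a relation. -/
def Late (e e' : Fin n → ℕ) : Prop :=
  ∀ p, (∀ q < p, e q = e' q) → e p ≠ e' p → ∃ k, p < k ∧ e k = e' p

lemma uniq_aux {e e' : Fin n → ℕ} (hne : e ≠ e') :
    ∃ p, (∀ q < p, e q = e' q) ∧ e p ≠ e' p := by
  have : ∃ p, e p ≠ e' p := by
    by_contra h
    push Not at h
    exact hne (funext h)
  obtain ⟨p, hp, hmin⟩ := WellFounded.has_min (wellFounded_lt (α := Fin n)) {p | e p ≠ e' p} this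
  refine ⟨p, fun q hq => ?_, hp⟩
  by_contra h
  exact hmin q h hq

lemma uniq201' {e e' : Fin n → ℕ} (h : SameTop e e') (hl : Late e e') (hc : ¬ C201 e)
    (p : Fin n) (hp : ∀ q < p, e q = e' q) : ¬ e p < e' p := by
  intro hlt
  have hnt : ¬ Top e' p := fun ht => by
    have := (h.symm p).2 ht
    omega
  simp only [Top, not_forall, not_le] at hnt
  obtain ⟨m, hm, hme⟩ := hnt
  obtain ⟨k, hk, hke⟩ := hl p hp hlt.ne
  refine hc ⟨m, p, k, hm, hk, by omega, ?_⟩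
  rw [hp m hm]; omega

lemma uniq210' {e e' : Fin n → ℕ} (h : SameTop e e') (hl : Late e' e) (hc : ¬ C210 e')
    (p : Fin n) (hp : ∀ q < p, e q = e' q) : ¬ e p < e' p := by
  intro hlt
  have hnt : ¬ Top e' p := fun ht => by
    have := (h.symm p).2 ht
    omega
  simp only [Top, not_forall, not_le] at hnt
  obtain ⟨m, hm, hme⟩ := hnt
  obtain ⟨k, hk, hke⟩ := hl p (fun q hq => (hp q hq).symm) hlt.ne'
  exact hc ⟨m, p, k, hm, hk, by omega, hme⟩

lemma uniq201 {e e' : Fin n → ℕ} (h : SameTop e e') (hl : Late e e') (hl' : Late e' e)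
    (hc : ¬ C201 e) (hc' : ¬ C201 e') : e = e' := by
  by_contra hne
  obtain ⟨p, hp, hpe⟩ := uniq_aux hne
  rcases lt_or_gt_of_ne hpe with h1 | h1
  · exact uniq201' h hl hc p hp h1
  · exact uniq201' h.symm hl' hc' p (fun q hq => (hp q hq).symm) h1

lemma uniq210 {e e' : Fin n → ℕ} (h : SameTop e e') (hl : Late e e') (hl' : Late e' e)
    (hc : ¬ C210 e) (hc' : ¬ C210 e') : e = e' := by
  by_contra hne
  obtain ⟨p, hp, hpe⟩ := uniq_aux hne
  rcases lt_or_gt_of_ne hpe with h1 | h1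
  · exact uniq210' h hl' hc' p hp h1
  · exact uniq210' h.symm hl hc p (fun q hq => (hp q hq).symm) h1

lemma finite_inv : {e : Fin n → ℕ | InvSeq e}.Finite := by
  refine (Set.finite_Iic (fun i : Fin n => (i : ℕ))).subset ?_
  intro e he
  exact he

/-- Abstract setting: a relation preserved within a set `S` of sequences. -/
structure Good (S : (Fin n → ℕ) → Prop) (r : (Fin n → ℕ) → (Fin n → ℕ) → Prop) : Prop where
  inv : ∀ e, S e → InvSeq e
  refl : ∀ e, r e e
  symm : ∀ e f, r e f → r f e
  trans : ∀ e f g, r e f → r f g → r e g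
  top : ∀ e f, r e f → SameTop e f
  late : ∀ e f, r e f → Late e f
  move : ∀ e, S e → ∀ m j k, m < j → j < k → e j < e m → e k < e m → e j ≠ e k →
    ∃ f, S f ∧ r e f ∧ ∃ p, (∀ q < p, e q = f q) ∧ e p = e j ∧ f p = e k

variable {S : (Fin n → ℕ) → Prop} {r : (Fin n → ℕ) → (Fin n → ℕ) → Prop}

lemma Good.ex201 (g : Good S r) (e : Fin n → ℕ) (he : S e) : ∃ f, S f ∧ ¬ C201 f ∧ r e f := by
  have hfin : {f | S f ∧ r e f}.Finite := finite_inv.subset fun f hf => g.inv f hf.1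
  obtain ⟨f, hf, hmax⟩ := Set.exists_max_image _ (fun f => toLex f) hfin ⟨e, he, g.refl e⟩
  refine ⟨f, hf.1, ?_, hf.2⟩
  rintro ⟨m, j, k, hmj, hjk, h1, h2⟩
  obtain ⟨f', hS, hr, p, hp, hp1, hp2⟩ := g.move f hf.1 m j k hmj hjk (h1.trans h2) h2 h1.ne
  have := hmax f' ⟨hS, g.trans _ _ _ hf.2 hr⟩
  refine absurd this (not_le.2 ?_)
  exact ⟨p, hp, by change f p < f' p; omega⟩

lemma Good.ex210 (g : Good S r) (e : Fin n → ℕ) (he : S e) : ∃ f, S f ∧ ¬ C210 f ∧ r e f := by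
  have hfin : {f | S f ∧ r e f}.Finite := finite_inv.subset fun f hf => g.inv f hf.1
  obtain ⟨f, hf, hmin⟩ := Set.exists_min_image _ (fun f => toLex f) hfin ⟨e, he, g.refl e⟩
  refine ⟨f, hf.1, ?_, hf.2⟩
  rintro ⟨m, j, k, hmj, hjk, h1, h2⟩
  obtain ⟨f', hS, hr, p, hp, hp1, hp2⟩ := g.move f hf.1 m j k hmj hjk h2 (h1.trans h2) h1.ne'
  have := hmin f' ⟨hS, g.trans _ _ _ hf.2 hr⟩
  refine absurd this (not_le.2 ?_)
  exact ⟨p, fun q hq => (hp q hq).symm, by change f' p < f p; omega⟩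

lemma card_le_aux (hS : ∀ e, S e → InvSeq e) (hsymm : ∀ e f, r e f → r f e)
    (htrans : ∀ e f g, r e f → r f g → r e g)
    (P Q R : (Fin n → ℕ) → Prop) (hR : ∀ e f, S e → S f → r e f → R e → R f)
    (hex : ∀ e, S e → ∃ f, S f ∧ Q f ∧ r e f)
    (hu : ∀ e f, P e → P f → r e f → e = f) :
    Nat.card {e : Fin n → ℕ // S e ∧ P e ∧ R e} ≤ Nat.card {e : Fin n → ℕ // S e ∧ Q e ∧ R e} := by
  have hfin : Finite {e : Fin n → ℕ // S e ∧ Q e ∧ R e} :=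
    (finite_inv.subset fun f (hf : S f ∧ Q f ∧ R f) => hS f hf.1).to_subtype
  choose! φ h1 h2 h3 using hex
  refine Nat.card_le_card_of_injective
    (fun x : {e : Fin n → ℕ // S e ∧ P e ∧ R e} =>
      (⟨φ x.1, h1 _ x.2.1, h2 _ x.2.1, hR _ _ x.2.1 (h1 _ x.2.1) (h3 _ x.2.1) x.2.2.2⟩ :
        {e : Fin n → ℕ // S e ∧ Q e ∧ R e})) ?_
  intro x y hxy
  have hxy' : φ x.1 = φ y.1 := congrArg Subtype.val hxy
  apply Subtype.ext
  refine hu _ _ x.2.2.1 y.2.2.1 (htrans _ _ _ (h3 _ x.2.1) ?_)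
  rw [hxy']
  exact hsymm _ _ (h3 _ y.2.1)

lemma Good.card_eq (g : Good S r) (R : (Fin n → ℕ) → Prop)
    (hR : ∀ e f, S e → S f → r e f → R e → R f) :
    Nat.card {e : Fin n → ℕ // S e ∧ ¬ C201 e ∧ R e}
      = Nat.card {e : Fin n → ℕ // S e ∧ ¬ C210 e ∧ R e} := by
  apply le_antisymm
  · exact card_le_aux g.inv g.symm g.trans _ _ R hR g.ex210 fun e f he hf h =>
      uniq201 (g.top _ _ h) (g.late _ _ h) (g.late _ _ (g.symm _ _ h)) he hf
  · exact card_le_aux g.inv g.symm g.trans _ _ R hR g.ex201 fun e f he hf h =>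
      uniq210 (g.top _ _ h) (g.late _ _ h) (g.late _ _ (g.symm _ _ h)) he hf

/-- Number of occurrences of a value. -/
def cnt (e : Fin n → ℕ) (v : ℕ) : ℕ := (univ.filter fun i => e i = v).card

/-- First relation: same maxima, same multiset of values. -/
def r1 (e f : Fin n → ℕ) : Prop := SameTop e f ∧ ∀ v, cnt e v = cnt f v

lemma good1 : Good (n := n) InvSeq r1 where
  inv e h := h
  refl e := ⟨fun i => ⟨Iff.rfl, fun _ => rfl⟩, fun _ => rfl⟩
  symm e f h := ⟨h.1.symm, fun v => (h.2 v).symm⟩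
  trans e f g h h' := ⟨h.1.trans h'.1, fun v => (h.2 v).trans (h'.2 v)⟩
  top e f h := h.1
  late e f h := by
    intro p hp hne
    by_contra hcon
    push Not at hcon
    have hlt : cnt e (f p) < cnt f (f p) := by
      apply Finset.card_lt_card
      rw [Finset.ssubset_iff_of_subset]
      · refine ⟨p, by simp, by simpa using hne⟩
      · intro i hi
        simp only [mem_filter, mem_univ, true_and] at hi ⊢
        rcases lt_trichotomy i p with h1 | h1 | h1
        · rw [← hp i h1, hi]
        · rw [h1]
        · exact absurd hi (hcon i h1)
    have := h.2 (f p)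
    omega
  move e he m j k hmj hjk h1 h2 hne := by
    have hst : SameTop e (e ∘ Equiv.swap j k) := by
      apply sameTop_of
      · intro i hi
        have hij : i ≠ j := by
          rintro rfl
          have := hi m hmj
          omega
        have hik : i ≠ k := by
          rintro rfl
          have := hi m (hmj.trans hjk)
          omega
        simp [Equiv.swap_apply_of_ne_of_ne hij hik]
      · intro i hi
        by_cases hij : i = j
        · subst hij
          exact ⟨m, hmj, by simpa using h2⟩
        by_cases hik : i = k
        · subst hik
          exact ⟨m, hmj.trans hjk, by simpa using h1⟩
        simp only [Top, not_forall, not_le] at hi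
        obtain ⟨t, ht, hte⟩ := hi
        exact ⟨t, ht, by simpa [Equiv.swap_apply_of_ne_of_ne hij hik] using hte⟩
    refine ⟨e ∘ Equiv.swap j k, hst.invSeq he, ⟨hst, fun v => ?_⟩, j, fun q hq => ?_, rfl, by simp⟩
    · unfold cnt
      refine Finset.card_bij (fun i _ => Equiv.swap j k i) ?_ ?_ ?_
      · intro i hi
        simpa using hi
      · intro a _ b _ hab
        exact (Equiv.swap j k).injective hab
      · intro b hb
        exact ⟨Equiv.swap j k b, by simpa using hb, by simp⟩
    · simp [Equiv.swap_apply_of_ne_of_ne hq.ne (hq.trans hjk).ne]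

lemma cnt_pos (e : Fin n → ℕ) (v : ℕ) : 0 < cnt e v ↔ v ∈ univ.image e := by
  simp [cnt, Finset.card_pos, Finset.Nonempty]

lemma r1_image {e f : Fin n → ℕ} (h : r1 e f) : univ.image e = univ.image f := by
  ext v
  rw [← cnt_pos, ← cnt_pos, h.2 v]

/-- Second ground set. -/
def S2 (e : Fin n → ℕ) : Prop := InvSeq e ∧ (∀ q s p, q < s → s < p → e q = e p → e s ≤ e q) ∧
  (∀ q s p, q < s → s < p → e q = e p → ¬ Top e q → e s = e q)

/-- Second relation: same maxima, same value set, same equality pattern. -/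
def r2 (e f : Fin n → ℕ) : Prop := SameTop e f ∧ univ.image e = univ.image f ∧
  ∀ i j, e i = e j ↔ f i = f j

lemma good2 : Good (n := n) S2 r2 where
  inv e h := h.1
  refl e := ⟨fun i => ⟨Iff.rfl, fun _ => rfl⟩, rfl, fun _ _ => Iff.rfl⟩
  symm e f h := ⟨h.1.symm, h.2.1.symm, fun i j => (h.2.2 i j).symm⟩
  trans e f g h h' := ⟨h.1.trans h'.1, h.2.1.trans h'.2.1, fun i j => (h.2.2 i j).trans (h'.2.2 i j)⟩
  top e f h := h.1
  late e f h := by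
    intro p hp hne
    have : f p ∈ univ.image e := by rw [h.2.1]; simp
    simp only [mem_image, mem_univ, true_and] at this
    obtain ⟨k, hk⟩ := this
    refine ⟨k, ?_, hk⟩
    rcases lt_trichotomy k p with h1 | h1 | h1
    · have h2 := hp k h1
      have := (h.2.2 k p).2 (by omega)
      omega
    · subst h1; exact absurd hk hne
    · exact h1
  move e he m j k hmj hjk h1 h2 hne := by
    obtain ⟨hinv, ha, hb⟩ := he
    have hj : ∀ i, e i = e j → m < i := by
      intro i hi
      by_contra hcon
      rcases lt_or_eq_of_le (not_lt.1 hcon) with h | h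
      · have := ha i m j h hmj hi
        omega
      · subst h; omega
    have hk : ∀ i, e i = e k → m < i := by
      intro i hi
      by_contra hcon
      rcases lt_or_eq_of_le (not_lt.1 hcon) with h | h
      · have := ha i m k h (hmj.trans hjk) hi
        omega
      · subst h; omega
    have hkj : ∀ i, e i = e k → j < i := by
      intro i hi
      by_contra hcon
      rcases lt_or_eq_of_le (not_lt.1 hcon) with h | h
      · have := hb i j k h hjk hi (fun ht => by
          have := ht m (hk i hi)
          omega)
        omega
      · subst h; omega
    set f : Fin n → ℕ := Equiv.swap (e j) (e k) ∘ e with hf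
    have fj : ∀ i, e i = e j → f i = e k := fun i hi => by simp [hf, hi]
    have fk : ∀ i, e i = e k → f i = e j := fun i hi => by simp [hf, hi]
    have fo : ∀ i, e i ≠ e j → e i ≠ e k → f i = e i := fun i hi hi' => by
      simp [hf, Equiv.swap_apply_of_ne_of_ne hi hi']
    have finj : ∀ i i', e i = e i' ↔ f i = f i' := fun i i' => by simp [hf]
    have ftop : ∀ i, Top e i → f i = e i := by
      intro i hi
      apply fo
      · intro h
        have := hi m (hj i h)
        omega
      · intro h
        have := hi m (hk i h)
        omega
    have fnt : ∀ i, ¬ Top e i → ∃ t < i, f i < e t := by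
      intro i hi
      by_cases hij : e i = e j
      · exact ⟨m, hj i hij, by rw [fj i hij]; exact h2⟩
      by_cases hik : e i = e k
      · exact ⟨m, hk i hik, by rw [fk i hik]; exact h1⟩
      rw [fo i hij hik]
      simpa only [Top, not_forall, not_le, exists_prop] using hi
    have hst : SameTop e f := sameTop_of ftop fnt
    refine ⟨f, ⟨hst.invSeq hinv, ?_, ?_⟩, ⟨hst, ?_, finj⟩, ?_⟩
    · intro q s p hqs hsp heq
      have heq' := (finj q p).2 heq
      by_cases hq : Top e q
      · rw [ftop q hq]
        by_cases hs : Top e s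
        · rw [ftop s hs]; exact ha q s p hqs hsp heq'
        · obtain ⟨t, ht, hte⟩ := fnt s hs
          rcases lt_trichotomy t q with h | h | h
          · have := hq t h
            omega
          · subst h; omega
          · have := ha q t p h (ht.trans hsp) heq'
            omega
      · exact ((finj s q).1 (hb q s p hqs hsp heq' hq)).le
    · intro q s p hqs hsp heq hq
      exact (finj s q).1 (hb q s p hqs hsp ((finj q p).2 heq) (fun h => hq ((hst q).1.1 h)))
    · ext v
      simp only [mem_image, mem_univ, true_and]
      constructor
      · rintro ⟨i, rfl⟩
        by_cases hij : e i = e j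
        · exact ⟨k, by rw [fk k rfl, hij]⟩
        by_cases hik : e i = e k
        · exact ⟨j, by rw [fj j rfl, hik]⟩
        exact ⟨i, fo i hij hik⟩
      · rintro ⟨i, rfl⟩
        by_cases hij : e i = e j
        · exact ⟨k, by rw [fj i hij]⟩
        by_cases hik : e i = e k
        · exact ⟨j, by rw [fk i hik]⟩
        exact ⟨i, (fo i hij hik).symm⟩
    · obtain ⟨p, hp, hmin⟩ :=
        WellFounded.has_min (wellFounded_lt (α := Fin n)) {p | e p = e j} ⟨j, rfl⟩
      refine ⟨p, fun q hq => ?_, hp, fj p hp⟩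
      refine (fo q (fun h => hmin q h hq) (fun h => ?_)).symm
      have h3 := hkj q h
      exact hmin j rfl (h3.trans hq)

lemma S2_of_201 (e : Fin n → ℕ) : (S2 e ∧ ¬ C201 e) ↔ (InvSeq e ∧ ¬ C201 e ∧ ¬ C010 e) := by
  constructor
  · rintro ⟨⟨h1, h2, _⟩, h4⟩
    refine ⟨h1, h4, ?_⟩
    rintro ⟨i, j, k, hij, hjk, h5, h6⟩
    have := h2 i j k hij hjk h5
    omega
  · rintro ⟨h1, h2, h3⟩
    have ha : ∀ q s p, q < s → s < p → e q = e p → e s ≤ e q := fun q s p hqs hsp h => by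
      by_contra hcon
      exact h3 ⟨q, s, p, hqs, hsp, h, by omega⟩
    refine ⟨⟨h1, ha, ?_⟩, h2⟩
    intro q s p hqs hsp h ht
    simp only [Top, not_forall, not_le] at ht
    obtain ⟨t, htq, hte⟩ := ht
    have := ha q s p hqs hsp h
    by_contra hcon
    exact h2 ⟨t, s, p, htq.trans hqs, hsp, by omega, by omega⟩

lemma S2_of_210 (e : Fin n → ℕ) : (S2 e ∧ ¬ C210 e) ↔ (InvSeq e ∧ ¬ C210 e ∧ ¬ C010 e) := by
  constructor
  · rintro ⟨⟨h1, h2, _⟩, h4⟩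
    refine ⟨h1, h4, ?_⟩
    rintro ⟨i, j, k, hij, hjk, h5, h6⟩
    have := h2 i j k hij hjk h5
    omega
  · rintro ⟨h1, h2, h3⟩
    have ha : ∀ q s p, q < s → s < p → e q = e p → e s ≤ e q := fun q s p hqs hsp h => by
      by_contra hcon
      exact h3 ⟨q, s, p, hqs, hsp, h, by omega⟩
    refine ⟨⟨h1, ha, ?_⟩, h2⟩
    intro q s p hqs hsp h ht
    simp only [Top, not_forall, not_le] at ht
    obtain ⟨t, htq, hte⟩ := ht
    have := ha q s p hqs hsp h
    by_contra hcon
    exact h2 ⟨t, q, s, htq, hqs, by omega, by omega⟩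

/-- The three statistics. -/
def R (a b c : ℕ) (e : Fin n → ℕ) : Prop := zeroStat e = a ∧ distStat e = b ∧ satuStat e = c

lemma R1 (a b c : ℕ) (e f : Fin n → ℕ) (he : InvSeq e) (hf : InvSeq f) (h : r1 e f)
    (hR : R a b c e) : R a b c f := by
  obtain ⟨h1, h2, h3⟩ := hR
  refine ⟨?_, ?_, ?_⟩
  · rw [← h1]; exact (h.2 0).symm
  · rw [← h2]; unfold distStat; rw [r1_image h]
  · rw [← h3]; exact (h.1.satu he hf).symm

lemma R2 (hn : 1 ≤ n) (a b c : ℕ) (e f : Fin n → ℕ) (he : S2 e) (hf : S2 f) (h : r2 e f)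
    (hR : R a b c e) : R a b c f := by
  obtain ⟨h1, h2, h3⟩ := hR
  refine ⟨?_, ?_, ?_⟩
  · rw [← h1]
    have e0 : e ⟨0, hn⟩ = 0 := by simpa using he.1 ⟨0, hn⟩
    have f0 : f ⟨0, hn⟩ = 0 := by simpa using hf.1 ⟨0, hn⟩
    unfold zeroStat
    congr 1
    ext i
    have := h.2.2 i ⟨0, hn⟩
    rw [e0, f0] at this
    simp [this]
  · rw [← h2]; unfold distStat; rw [h.2.1]
  · rw [← h3]; exact (h.1.satu he.1 hf.1).symm

lemma avoid_eq (T : (Fin n → ℕ) → Prop) (hT : ∀ e f, S2 e → S2 f → r2 e f → T e → T f) :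
    Nat.card {e : Fin n → ℕ // InvSeq e ∧ ¬ C201 e ∧ T e ∧ ¬ C010 e}
      = Nat.card {e : Fin n → ℕ // InvSeq e ∧ ¬ C210 e ∧ T e ∧ ¬ C010 e} := by
  have := good2.card_eq T hT
  have h1 : ∀ e : Fin n → ℕ, (InvSeq e ∧ ¬ C201 e ∧ T e ∧ ¬ C010 e) ↔ (S2 e ∧ ¬ C201 e ∧ T e) := by
    intro e
    have := S2_of_201 e
    tauto
  have h2 : ∀ e : Fin n → ℕ, (InvSeq e ∧ ¬ C210 e ∧ T e ∧ ¬ C010 e) ↔ (S2 e ∧ ¬ C210 e ∧ T e) := by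
    intro e
    have := S2_of_210 e
    tauto
  simp only [h1, h2]
  exact this

lemma split_card (P : (Fin n → ℕ) → Prop) (T : (Fin n → ℕ) → Prop) :
    Nat.card {e : Fin n → ℕ // InvSeq e ∧ P e ∧ T e}
      = Nat.card {e : Fin n → ℕ // InvSeq e ∧ P e ∧ T e ∧ C010 e}
      + Nat.card {e : Fin n → ℕ // InvSeq e ∧ P e ∧ T e ∧ ¬ C010 e} := by
  have hf : ∀ U : (Fin n → ℕ) → Prop, {e : Fin n → ℕ | InvSeq e ∧ U e}.Finite := fun U =>
    finite_inv.subset fun e he => he.1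
  have := Set.ncard_union_eq (s := {e : Fin n → ℕ | InvSeq e ∧ P e ∧ T e ∧ C010 e})
    (t := {e : Fin n → ℕ | InvSeq e ∧ P e ∧ T e ∧ ¬ C010 e})
    (by
      rw [Set.disjoint_left]
      intro e h1 h2
      exact h2.2.2.2 h1.2.2.2) (hf _) (hf _)
  have hu : {e : Fin n → ℕ | InvSeq e ∧ P e ∧ T e ∧ C010 e} ∪
      {e : Fin n → ℕ | InvSeq e ∧ P e ∧ T e ∧ ¬ C010 e} = {e | InvSeq e ∧ P e ∧ T e} := by
    ext e
    simp only [Set.mem_union, Set.mem_ofPred_eq]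
    tauto
  rw [hu] at this
  exact this

end Inv18

theorem stmt_18 (n : ℕ) (hn : 1 ≤ n) :
    (∀ a b c : ℕ,
      Nat.card {e : Fin n → ℕ // InvSeq e ∧ Avoids e [2,0,1] ∧
        zeroStat e = a ∧ distStat e = b ∧ satuStat e = c ∧ Avoids e [0,1,0]}
      = Nat.card {e : Fin n → ℕ // InvSeq e ∧ Avoids e [2,1,0] ∧
        zeroStat e = a ∧ distStat e = b ∧ satuStat e = c ∧ Avoids e [0,1,0]}) ∧
    (∀ a b c : ℕ,
      Nat.card {e : Fin n → ℕ // InvSeq e ∧ Avoids e [2,0,1] ∧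
        zeroStat e = a ∧ distStat e = b ∧ satuStat e = c ∧ Contains e [0,1,0]}
      = Nat.card {e : Fin n → ℕ // InvSeq e ∧ Avoids e [2,1,0] ∧
        zeroStat e = a ∧ distStat e = b ∧ satuStat e = c ∧ Contains e [0,1,0]}) ∧
    (Nat.card {e : Fin n → ℕ // InvSeq e ∧ Avoids e [0,1,0] ∧ Avoids e [2,0,1]}
      = Nat.card {e : Fin n → ℕ // InvSeq e ∧ Avoids e [0,1,0] ∧ Avoids e [2,1,0]}) := by
  have key : ∀ a b c : ℕ,
      Nat.card {e : Fin n → ℕ // InvSeq e ∧ Avoids e [2,0,1] ∧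
        zeroStat e = a ∧ distStat e = b ∧ satuStat e = c ∧ Avoids e [0,1,0]}
      = Nat.card {e : Fin n → ℕ // InvSeq e ∧ Avoids e [2,1,0] ∧
        zeroStat e = a ∧ distStat e = b ∧ satuStat e = c ∧ Avoids e [0,1,0]} := by
    intro a b c
    have := Inv18.avoid_eq (n := n) (Inv18.R a b c) (Inv18.R2 hn a b c)
    simpa only [Avoids, Inv18.c201, Inv18.c210, Inv18.c010, Inv18.R, and_assoc] using this
  refine ⟨key, ?_, ?_⟩
  · intro a b c
    have h0 := Inv18.good1.card_eq (n := n) (Inv18.R a b c) (Inv18.R1 a b c)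
    have h1 := Inv18.avoid_eq (n := n) (Inv18.R a b c) (Inv18.R2 hn a b c)
    rw [Inv18.split_card (fun e => ¬ Inv18.C201 e), Inv18.split_card (fun e => ¬ Inv18.C210 e), h1] at h0
    have h2 := Nat.add_right_cancel h0
    simpa only [Avoids, Inv18.c201, Inv18.c210, Inv18.c010, Inv18.R, and_assoc] using h2
  · have := Inv18.avoid_eq (n := n) (fun _ => True) (fun _ _ _ _ _ _ => trivial)
    simp only [true_and] at this
    simp only [Avoids, Inv18.c201, Inv18.c210, Inv18.c010]
    simpa only [and_comm (a := ¬ Inv18.C010 _)] using this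
end
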